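/- Let A ≥ 1 be real, let z be a complex number with |z| ≤ A, let 0 < δ ≤ 1 and M > 0, and let 0 < c₀ ≤ 2/11. Suppose the Dirichlet series F(s) = ∑_{n≥1} a_n n^{−s} has property P(z; c₀, δ, M). Set c = (47/48)c₀. Then F extends to an analytic function on the open set Ω = {s = σ + iτ : σ > 1 − c/(1 + log⁺|τ|)} ∖ (−∞, 1], and there is a constant C_A, depending only on A, such that for all s ∈ Ω with σ ≤ 2: |F(s)| ≤ C_A·δ^{−A}·M·(1 + |τ|)^{1−δ/2} if |τ| ≥ 3, and |F(s)| ≤ C_A·M·|s − 1|^{−A} if |τ| ≤ 3. -/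

import Mathlib

noncomputable section

/-- `log⁺ y = max {0, log y}`. -/
def logPlus (y : ℝ) : ℝ := max 0 (Real.log y)

/-- The region `{s = σ + iτ : σ ≥ 1 - c₀ / (1 + log⁺ |τ|)}`. -/
def sdRegion (c₀ : ℝ) : Set ℂ := {s : ℂ | 1 - c₀ / (1 + logPlus |s.im|) ≤ s.re}

/-- `log ζ(s) = ∑_{n ≥ 2} Λ(n) / (n^s log n)`, for `Re s > 1`. -/
def logZeta (s : ℂ) : ℂ :=
  ∑' n : ℕ, (ArithmeticFunction.vonMangoldt n : ℂ) / ((n : ℂ) ^ s * (Real.log n : ℂ))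

/-- The Dirichlet series `F(s) = ∑_{n ≥ 1} a_n n^{-s}`. -/
def DSeries (a : ℕ → ℂ) (s : ℂ) : ℂ := ∑' n : ℕ, a (n + 1) / ((n + 1 : ℕ) : ℂ) ^ s

/-- `G, U` witness the analytic continuation and growth bound required in property
`P(z; c₀, δ, M)` for the Dirichlet series with coefficients `a`. -/
def IsPContinuation (a : ℕ → ℂ) (z : ℂ) (c₀ δ M : ℝ) (G : ℂ → ℂ) (U : Set ℂ) : Prop :=
  IsOpen U ∧ sdRegion c₀ ⊆ U ∧ AnalyticOnNhd ℂ G U ∧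
    (∀ s : ℂ, 1 < s.re → G s = DSeries a s * Complex.exp (-z * logZeta s)) ∧
    (∀ s ∈ sdRegion c₀, ‖G s‖ ≤ M * (1 + |s.im|) ^ (1 - δ))

/-- The Dirichlet series with coefficients `a` has property `P(z; c₀, δ, M)`. -/
def HasPropertyP (a : ℕ → ℂ) (z : ℂ) (c₀ δ M : ℝ) : Prop :=
  (∀ s : ℂ, 1 < s.re → Summable fun n : ℕ => ‖a (n + 1) / ((n + 1 : ℕ) : ℂ) ^ s‖) ∧
  ∃ (G : ℂ → ℂ) (U : Set ℂ), IsPContinuation a z c₀ δ M G U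

/-- The open set `Ω = {σ > 1 - c/(1 + log⁺|τ|)} ∖ (-∞, 1]`. -/
def sdOmega (c : ℝ) : Set ℂ :=
  {s : ℂ | 1 - c / (1 + logPlus |s.im|) < s.re} \ {s : ℂ | s.im = 0 ∧ s.re ≤ 1}

section

open Complex Filter Topology Metric

/-- A zero of finite order of an entire function can be divided out. -/
theorem exists_entire_factor {f : ℂ → ℂ} (hf : Differentiable ℂ f) {ρ : ℂ} (hρ : ρ ≠ 0) {n : ℕ}
    (hn : analyticOrderAt f ρ = n) :
    ∃ g : ℂ → ℂ, Differentiable ℂ g ∧ g ρ ≠ 0 ∧ ∀ z, f z = (1 - z / ρ) ^ n * g z := by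
  classical
  obtain ⟨h, hh, hh0, hev⟩ := (hf.analyticAt ρ).analyticOrderAt_eq_natCast.1 hn
  have key : ∀ z, (z - ρ) = (1 - z / ρ) * (-ρ) := fun z => by field_simp; ring
  have hne : ∀ z, z ≠ ρ → (1 - z / ρ) ≠ 0 := fun z hz h0 => by
    have := key z; rw [h0, zero_mul, sub_eq_zero] at this; exact hz this
  let g : ℂ → ℂ := Function.update (fun z => f z / (1 - z / ρ) ^ n) ρ ((-ρ) ^ n * h ρ)
  have hg : ∀ z, z ≠ ρ → g z = f z / (1 - z / ρ) ^ n := fun z hz => by simp [g, hz]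
  have hgρ : g ρ = (-ρ) ^ n * h ρ := by simp [g]
  have hgev : g =ᶠ[𝓝 ρ] fun z => (-ρ) ^ n * h z := by
    filter_upwards [hev] with z hz
    rcases eq_or_ne z ρ with rfl | hzρ
    · exact hgρ
    · rw [hg z hzρ, hz, key z, smul_eq_mul, mul_pow, div_eq_iff (pow_ne_zero _ (hne z hzρ))]
      ring
  refine ⟨g, fun z => ?_, ?_, fun z => ?_⟩
  · rcases eq_or_ne z ρ with rfl | hzρ
    · exact ((hh.differentiableAt.const_mul _).congr_of_eventuallyEq hgev)
    · have : g =ᶠ[𝓝 z] fun z => f z / (1 - z / ρ) ^ n := by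
        filter_upwards [isOpen_ne.mem_nhds hzρ] with w hw using hg w hw
      refine DifferentiableAt.congr_of_eventuallyEq ?_ this
      exact (hf z).div (by fun_prop) (pow_ne_zero _ (hne z hzρ))
  · rw [hgρ]; exact mul_ne_zero (pow_ne_zero _ (neg_ne_zero.2 hρ)) hh0
  · rcases eq_or_ne z ρ with rfl | hzρ
    · rw [hgρ, hev.self_of_nhds, key z, smul_eq_mul, mul_pow]; ring
    · rw [hg z hzρ, mul_div_cancel₀ _ (pow_ne_zero _ (hne z hzρ))]

theorem exists_entire_factor_finset {f : ℂ → ℂ} (hf : Differentiable ℂ f) (h0 : f 0 ≠ 0)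
    (S : Finset ℂ) (hS : ∀ ρ ∈ S, ρ ≠ 0) :
    ∃ g : ℂ → ℂ, Differentiable ℂ g ∧ (∀ ρ ∈ S, g ρ ≠ 0) ∧
      ∀ z, f z = (∏ ρ ∈ S, (1 - z / ρ) ^ analyticOrderNatAt f ρ) * g z := by
  classical
  induction S using Finset.induction_on with
  | empty => exact ⟨f, hf, by simp, by simp⟩
  | insert ρ S hρS ih =>
    obtain ⟨g, hg, hgS, hfg⟩ := ih fun x hx => hS x (Finset.mem_insert_of_mem hx)
    have hρ : ρ ≠ 0 := hS ρ (Finset.mem_insert_self _ _)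
    have hP : Differentiable ℂ fun z => ∏ x ∈ S, (1 - z / x) ^ analyticOrderNatAt f x := by
      fun_prop
    have hPρ : (∏ x ∈ S, (1 - ρ / x) ^ analyticOrderNatAt f x) ≠ 0 := by
      refine Finset.prod_ne_zero_iff.2 fun x hx => pow_ne_zero _ fun h => ?_
      have hx0 := hS x (Finset.mem_insert_of_mem hx)
      have : ρ / x = 1 := (sub_eq_zero.1 h).symm
      rw [div_eq_one_iff_eq hx0] at this
      exact hρS (this ▸ hx)
    have htop : analyticOrderAt f ρ ≠ ⊤ := fun h => by
      have := AnalyticOnNhd.eqOn_zero_of_preconnected_of_eventuallyEq_zero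
        (fun z _ => hf.analyticAt z) isPreconnected_univ (Set.mem_univ ρ)
        (analyticOrderAt_eq_top.1 h)
      exact h0 (this (Set.mem_univ 0))
    have hord : analyticOrderAt g ρ = analyticOrderNatAt f ρ := by
      rw [Nat.cast_analyticOrderNatAt htop]
      have : f = (fun z => ∏ x ∈ S, (1 - z / x) ^ analyticOrderNatAt f x) * g := funext hfg
      conv_rhs => rw [this]
      rw [analyticOrderAt_mul (hP.analyticAt ρ) (hg.analyticAt ρ),
        (hP.analyticAt ρ).analyticOrderAt_eq_zero.2 hPρ, zero_add]
    obtain ⟨k, hk, hkρ, hgk⟩ := exists_entire_factor hg hρ hord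
    refine ⟨k, hk, fun x hx => ?_, fun z => ?_⟩
    · rcases Finset.mem_insert.1 hx with rfl | hx
      · exact hkρ
      · exact fun h => hgS x hx (by rw [hgk, h, mul_zero])
    · rw [hfg, hgk, Finset.prod_insert hρS]; ring

theorem finite_zeros_closedBall {f : ℂ → ℂ} (hf : Differentiable ℂ f) (h0 : f 0 ≠ 0) (R : ℝ) :
    {z | f z = 0 ∧ ‖z‖ ≤ R}.Finite := by
  by_contra hinf
  obtain ⟨x, -, hx⟩ := Set.Infinite.exists_accPt_of_subset_isCompact hinf
    (isCompact_closedBall (0 : ℂ) R) (fun z hz => by simpa using hz.2)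
  have hfr : ∃ᶠ z in 𝓝[≠] x, f z = 0 :=
    (accPt_iff_frequently_nhdsNE.1 hx).mono fun z hz => hz.1
  have := AnalyticOnNhd.eqOn_zero_of_preconnected_of_frequently_eq_zero
    (fun z _ => hf.analyticAt z) isPreconnected_univ (Set.mem_univ x) hfr
  exact h0 (this (Set.mem_univ 0))

theorem norm_logDeriv_sub_le_of_bound {g : ℂ → ℂ} (hg : Differentiable ℂ g) {R M : ℝ} (hR : 0 < R)
    (hM : 0 < M) (hne : ∀ z ∈ ball (0 : ℂ) R, g z ≠ 0)
    (hb : ∀ z ∈ ball (0 : ℂ) R, ‖g z‖ ≤ ‖g 0‖ * Real.exp M) {z : ℂ} (hz : ‖z‖ < R / 4) :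
    ‖logDeriv g z - logDeriv g 0‖ ≤ 64 * M / R ^ 2 * ‖z‖ := by
  have hd : DifferentiableOn ℂ (logDeriv g) (ball 0 R) := fun w hw => by
    have : DifferentiableAt ℂ (deriv g) w := hg.analyticAt w |>.deriv.differentiableAt
    exact (this.div (hg w) (hne w hw)).differentiableWithinAt
  obtain ⟨l, hl⟩ := hd.isExactOn_ball
  have h0 : (0 : ℂ) ∈ ball (0 : ℂ) R := by simpa
  have hg0 := hne 0 h0
  set k : ℂ → ℂ := fun w => l w - l 0 with hk
  have hkd : ∀ w ∈ ball (0 : ℂ) R, HasDerivAt k (logDeriv g w) w := fun w hw =>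
    (hl w hw).sub_const _
  have hkdo : DifferentiableOn ℂ k (ball 0 R) := fun w hw =>
    (hkd w hw).differentiableAt.differentiableWithinAt
  have hconst : ∀ w ∈ ball (0 : ℂ) R, g w * exp (-k w) = g 0 := by
    intro w hw
    have hder : ∀ x ∈ ball (0 : ℂ) R, HasDerivAt (fun x => g x * exp (-k x)) 0 x := by
      intro x hx
      have h1 : HasDerivAt (fun x => g x * exp (-k x))
          (deriv g x * exp (-k x) + g x * (exp (-k x) * -logDeriv g x)) x :=
        (hg x).hasDerivAt.mul (hkd x hx).fun_neg.cexp
      refine h1.congr_deriv ?_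
      rw [logDeriv_apply]
      have := hne x hx
      field_simp
      ring
    have := (convex_ball (0 : ℂ) R).is_const_of_fderivWithin_eq_zero (𝕜 := ℂ)
      (f := fun x => g x * exp (-k x))
      (fun x hx => (hder x hx).differentiableAt.differentiableWithinAt)
      (fun x hx => by
        rw [fderivWithin_of_isOpen isOpen_ball hx]
        have h1 := (hder x hx).hasFDerivAt.fderiv
        rw [h1]; ext; simp) hw h0
    rw [this]; simp [hk]
  have hre : Set.MapsTo k (ball 0 R) {z | z.re ≤ M} := by
    intro w hw
    have h1 : g w = g 0 * exp (k w) := by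
      rw [← hconst w hw, mul_assoc, ← exp_add]; simp
    have h2 := hb w hw
    rw [h1, norm_mul, norm_exp] at h2
    exact Real.exp_le_exp.1 (le_of_mul_le_mul_left h2 (norm_pos_iff.2 hg0))
  have hkb : ∀ w : ℂ, ‖w‖ ≤ R / 2 → ‖k w‖ ≤ 2 * M := by
    intro w hw
    have hwb : w ∈ ball (0 : ℂ) R := by rw [mem_ball_zero_iff]; linarith
    refine (borelCaratheodory_zero hM hkdo hre hR hwb (by simp [hk])).trans ?_
    rw [div_le_iff₀ (by linarith)]
    nlinarith
  have hld : ∀ w : ℂ, ‖w‖ < R / 4 → ‖logDeriv g w‖ ≤ 8 * M / R := by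
    intro w hw
    have hwb : w ∈ ball (0 : ℂ) R := by rw [mem_ball_zero_iff]; linarith
    have hsub : closedBall w (R / 4) ⊆ ball 0 R := fun x hx => by
      rw [mem_ball_zero_iff]
      have := norm_le_norm_add_norm_sub' x w
      rw [mem_closedBall, dist_eq_norm] at hx
      linarith
    have := norm_deriv_le_of_forall_mem_sphere_norm_le (c := w) (R := R / 4) (C := 2 * M) (f := k)
      (by positivity) ((hkdo.mono hsub).diffContOnCl_ball subset_rfl) (fun x hx => by
        apply hkb
        have := norm_le_norm_add_norm_sub' x w
        rw [mem_sphere, dist_eq_norm] at hx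
        linarith)
    rw [(hkd w hwb).deriv] at this
    refine this.trans (le_of_eq ?_)
    field_simp; ring
  have := dist_le_div_mul_dist_of_mapsTo_ball (f := logDeriv g) (c := 0) (R₁ := R / 4)
    (R₂ := 16 * M / R) (z := z) (hd.mono (ball_subset_ball (by linarith))) (fun w hw => by
      rw [mem_closedBall, dist_eq_norm]
      refine (norm_sub_le _ _).trans ?_
      have h1 := hld w (by simpa using hw)
      have h2 := hld 0 (by simp; positivity)
      calc _ ≤ 8 * M / R + 8 * M / R := add_le_add h1 h2
        _ = _ := by ring) (by simpa using hz)
  rw [dist_eq_norm, dist_zero_right] at this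
  refine this.trans (le_of_eq ?_)
  field_simp; ring

/-- The zeros of an entire function in a closed ball about the origin. -/
def zerosBall {f : ℂ → ℂ} (hf : Differentiable ℂ f) (h0 : f 0 ≠ 0) (R : ℝ) : Finset ℂ :=
  (finite_zeros_closedBall hf h0 R).toFinset

theorem mem_zerosBall {f : ℂ → ℂ} (hf : Differentiable ℂ f) (h0 : f 0 ≠ 0) {R : ℝ} {z : ℂ} :
    z ∈ zerosBall hf h0 R ↔ f z = 0 ∧ ‖z‖ ≤ R := by
  simp [zerosBall]

theorem logDeriv_one_sub_div_pow {ρ z : ℂ} (hρ : ρ ≠ 0) (hz : z ≠ ρ) (n : ℕ) :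
    logDeriv (fun z => (1 - z / ρ) ^ n) z = n * (1 / (z - ρ)) := by
  have h1 : DifferentiableAt ℂ (fun z => 1 - z / ρ) z := by fun_prop
  rw [logDeriv_fun_pow h1, logDeriv_apply]
  have hd : HasDerivAt (fun z => 1 - z / ρ) (-(1 / ρ)) z :=
    ((hasDerivAt_id z).div_const ρ).const_sub 1
  rw [hd.deriv]
  have h2 : z - ρ ≠ 0 := sub_ne_zero.2 hz
  have h3 : ρ - z ≠ 0 := sub_ne_zero.2 hz.symm
  congr 1
  rw [show 1 - z / ρ = (ρ - z) / ρ by field_simp]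
  rw [← neg_sub ρ z]
  field_simp

theorem norm_logDeriv_sub_sum_le {f : ℂ → ℂ} (hf : Differentiable ℂ f) (h0 : f 0 ≠ 0) {C : ℝ}
    (hC : 0 ≤ C) (hgr : ∀ z, ‖f z‖ ≤ Real.exp (C * (1 + ‖z‖) ^ (3 / 2 : ℝ))) {z : ℂ} (hz : f z ≠ 0)
    {N : ℝ} (hN : 4 * ‖z‖ < N) :
    ‖logDeriv f z - logDeriv f 0 -
      ∑ ρ ∈ zerosBall hf h0 N, analyticOrderNatAt f ρ * (1 / (z - ρ) + 1 / ρ)‖ ≤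
      64 * (C * (1 + 4 * N) ^ (3 / 2 : ℝ) + |Real.log ‖f 0‖| + 1) / N ^ 2 * ‖z‖ := by
  have hN0 : 0 < N := lt_of_le_of_lt (by positivity) hN
  set S := zerosBall hf h0 N with hS
  have hS0 : ∀ ρ ∈ S, ρ ≠ 0 := fun ρ hρ h => h0 (h ▸ ((mem_zerosBall hf h0).1 hρ).1)
  obtain ⟨g, hg, hgS, hfg⟩ := exists_entire_factor_finset hf h0 S hS0
  have hg0 : g 0 = f 0 := by rw [hfg 0]; simp
  have hgne : ∀ w, ‖w‖ ≤ N → g w ≠ 0 := by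
    intro w hw hgw
    by_cases hwS : w ∈ S
    · exact hgS w hwS hgw
    · exact hwS ((mem_zerosBall hf h0).2 ⟨by rw [hfg, hgw, mul_zero], hw⟩)
  set M := C * (1 + 4 * N) ^ (3 / 2 : ℝ) + |Real.log ‖f 0‖| + 1 with hM
  have hMpos : 0 < M := by positivity
  have hbd : ∀ w, ‖w‖ ≤ 4 * N → ‖g w‖ ≤ Real.exp (C * (1 + 4 * N) ^ (3 / 2 : ℝ)) := by
    intro w hw
    refine norm_le_of_forall_mem_frontier_norm_le (U := ball 0 (4 * N)) isBounded_ball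
      hg.diffContOnCl (fun x hx => ?_) (by
        rw [closure_ball _ (by positivity)]; simpa using hw)
    rw [frontier_ball _ (by positivity), mem_sphere_zero_iff_norm] at hx
    have h1 := hgr x
    rw [hx, hfg, norm_mul] at h1
    refine le_trans (le_mul_of_one_le_left (norm_nonneg _) ?_) h1
    rw [norm_prod]
    refine Finset.prod_induction _ (fun x : ℝ => 1 ≤ x) (fun _ _ => one_le_mul_of_one_le_of_one_le) le_rfl
      (fun ρ hρ => ?_)
    rw [norm_pow]
    refine one_le_pow₀ ?_
    have hρ0 : 0 < ‖ρ‖ := norm_pos_iff.2 (hS0 ρ hρ)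
    have h2 : ‖ρ‖ ≤ N := ((mem_zerosBall hf h0).1 hρ).2
    have h3 : 4 ≤ ‖x / ρ‖ := by
      rw [norm_div, hx, le_div_iff₀ hρ0]; linarith
    have h4 : ‖x / ρ‖ - ‖(1 : ℂ)‖ ≤ ‖x / ρ - 1‖ := norm_sub_norm_le _ _
    rw [norm_sub_rev, norm_one] at h4
    linarith
  have key := norm_logDeriv_sub_le_of_bound hg (R := N) (M := M) hN0 hMpos
    (fun w hw => hgne w (by simpa using (mem_ball_zero_iff.1 hw).le)) (fun w hw => by
      refine (hbd w (by have := mem_ball_zero_iff.1 hw; linarith)).trans ?_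
      rw [hg0]
      have hf0 : 0 < ‖f 0‖ := norm_pos_iff.2 h0
      calc _ = ‖f 0‖ * Real.exp (C * (1 + 4 * N) ^ (3 / 2 : ℝ) - Real.log ‖f 0‖) := by
            rw [Real.exp_sub, Real.exp_log hf0]; field_simp
        _ ≤ _ := by
            gcongr
            have := neg_abs_le (Real.log ‖f 0‖)
            rw [hM]; linarith) (z := z) (by linarith)
  have hld : ∀ w, ‖w‖ ≤ N → f w ≠ 0 → logDeriv f w =
      ∑ ρ ∈ S, analyticOrderNatAt f ρ * (1 / (w - ρ)) + logDeriv g w := by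
    intro w hw hfw
    have hfe : f = fun z => (∏ ρ ∈ S, (1 - z / ρ) ^ analyticOrderNatAt f ρ) * g z := funext hfg
    have hwS : ∀ ρ ∈ S, w ≠ ρ := fun ρ hρ h => hfw (h ▸ ((mem_zerosBall hf h0).1 hρ).1)
    have hne : ∀ ρ ∈ S, (1 - w / ρ) ^ analyticOrderNatAt f ρ ≠ 0 := by
      intro ρ hρ
      refine pow_ne_zero _ fun h => hwS ρ hρ ?_
      have h' : w / ρ = 1 := (sub_eq_zero.1 h).symm
      rwa [div_eq_one_iff_eq (hS0 ρ hρ)] at h'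
    conv_lhs => rw [hfe]
    rw [logDeriv_mul (f := fun z => ∏ ρ ∈ S, (1 - z / ρ) ^ analyticOrderNatAt f ρ) w
      (Finset.prod_ne_zero_iff.2 hne) (hgne w hw) (by fun_prop) (hg w)]
    congr 1
    have := logDeriv_prod (s := S) (f := fun ρ z => (1 - z / ρ) ^ analyticOrderNatAt f ρ) (x := w)
      hne (fun ρ _ => by fun_prop)
    rw [this]
    exact Finset.sum_congr rfl fun ρ hρ => logDeriv_one_sub_div_pow (hS0 ρ hρ) (hwS ρ hρ) _
  have hzN : ‖z‖ ≤ N := by have := norm_nonneg z; linarith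
  have e1 := hld z hzN hz
  have e2 := hld 0 (by simpa using hN0.le) h0
  have e3 : logDeriv f z - logDeriv f 0 -
      ∑ ρ ∈ S, analyticOrderNatAt f ρ * (1 / (z - ρ) + 1 / ρ) = logDeriv g z - logDeriv g 0 := by
    rw [e1, e2]
    simp only [zero_sub, one_div, mul_add, Finset.sum_add_distrib, inv_neg, mul_neg,
      Finset.sum_neg_distrib]
    ring
  rw [e3]
  exact key

theorem tendsto_sum_zeros {f : ℂ → ℂ} (hf : Differentiable ℂ f) (h0 : f 0 ≠ 0) {C : ℝ}
    (hC : 0 ≤ C) (hgr : ∀ z, ‖f z‖ ≤ Real.exp (C * (1 + ‖z‖) ^ (3 / 2 : ℝ))) {z : ℂ}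
    (hz : f z ≠ 0) :
    Tendsto (fun N : ℕ => ∑ ρ ∈ zerosBall hf h0 N, analyticOrderNatAt f ρ * (1 / (z - ρ) + 1 / ρ))
      atTop (𝓝 (logDeriv f z - logDeriv f 0)) := by
  rw [tendsto_iff_norm_sub_tendsto_zero]
  set K := |Real.log ‖f 0‖| + 1 with hK
  have hlim : Tendsto (fun N : ℝ => 64 * (C * 5 ^ (3 / 2 : ℝ) + K) * ‖z‖ * N ^ (-(1 / 2) : ℝ)) atTop
      (𝓝 0) := by
    simpa using (tendsto_rpow_neg_atTop (y := 1 / 2) (by norm_num)).const_mul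
      (64 * (C * 5 ^ (3 / 2 : ℝ) + K) * ‖z‖)
  refine squeeze_zero' (Eventually.of_forall fun _ => norm_nonneg _) ?_
    (hlim.comp tendsto_natCast_atTop_atTop)
  filter_upwards [eventually_ge_atTop 1,
    tendsto_natCast_atTop_atTop.eventually (eventually_gt_atTop (4 * ‖z‖))] with N h1 h2
  rw [norm_sub_rev]
  refine (norm_logDeriv_sub_sum_le hf h0 hC hgr hz h2).trans ?_
  have hN : (1 : ℝ) ≤ N := by exact_mod_cast h1
  have hN0 : (0 : ℝ) < N := by linarith
  have hb : (1 + 4 * (N : ℝ)) ^ (3 / 2 : ℝ) ≤ 5 ^ (3 / 2 : ℝ) * (N : ℝ) ^ (3 / 2 : ℝ) := by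
    rw [← Real.mul_rpow (by norm_num) hN0.le]
    exact Real.rpow_le_rpow (by positivity) (by linarith) (by norm_num)
  have hb1 : 1 ≤ (N : ℝ) ^ (3 / 2 : ℝ) := Real.one_le_rpow hN (by norm_num)
  have hb2 : (N : ℝ) ^ (3 / 2 : ℝ) / (N : ℝ) ^ 2 = (N : ℝ) ^ (-(1 / 2) : ℝ) := by
    rw [← Real.rpow_natCast (N : ℝ) 2, ← Real.rpow_sub hN0]; norm_num
  have hKpos : 0 ≤ K := by positivity
  calc _ ≤ 64 * ((C * 5 ^ (3 / 2 : ℝ) + K) * (N : ℝ) ^ (3 / 2 : ℝ)) / (N : ℝ) ^ 2 * ‖z‖ := by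
        gcongr
        rw [add_assoc, ← hK, add_mul, mul_assoc C]
        gcongr
        exact le_mul_of_one_le_right hKpos hb1
    _ = 64 * (C * 5 ^ (3 / 2 : ℝ) + K) * ‖z‖ * ((N : ℝ) ^ (3 / 2 : ℝ) / (N : ℝ) ^ 2) := by ring
    _ = _ := by rw [hb2]; rfl

end

section

open Complex Filter Topology Metric MeasureTheory Set

/-- The completed zeta function with its poles removed, normalised by value `1` at `s = 0, 1`. -/
def xi (s : ℂ) : ℂ := s * (s - 1) * completedRiemannZeta₀ s + 1

theorem differentiable_xi : Differentiable ℂ xi := by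
  unfold xi
  have := differentiable_completedZeta₀
  fun_prop

theorem xi_one_sub (s : ℂ) : xi (1 - s) = xi s := by
  rw [xi, xi, completedRiemannZeta₀_one_sub]; ring

theorem xi_one : xi 1 = 1 := by simp [xi]

theorem xi_eq_completed {s : ℂ} (h0 : s ≠ 0) (h1 : s ≠ 1) :
    xi s = s * (s - 1) * completedRiemannZeta s := by
  have : 1 - s ≠ 0 := sub_ne_zero.2 h1.symm
  rw [completedRiemannZeta_eq, xi]
  field_simp
  ring

theorem xi_eq_zeta {s : ℂ} (hs : 0 < s.re) (h1 : s ≠ 1) :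
    xi s = s * (s - 1) * (Gammaℝ s * riemannZeta s) := by
  have h0 : s ≠ 0 := fun h => by simp [h] at hs
  rw [xi_eq_completed h0 h1, riemannZeta_def_of_ne_zero h0,
    mul_div_cancel₀ _ (Gammaℝ_ne_zero_of_re_pos hs)]

theorem xi_eq_zero_iff {s : ℂ} (hs : 0 < s.re) (h1 : s ≠ 1) : xi s = 0 ↔ riemannZeta s = 0 := by
  have h0 : s ≠ 0 := fun h => by simp [h] at hs
  rw [xi_eq_zeta hs h1]
  simp [h0, sub_eq_zero, h1, Gammaℝ_ne_zero_of_re_pos hs]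

theorem xi_ne_zero_of_one_le_re {s : ℂ} (hs : 1 ≤ s.re) : xi s ≠ 0 := by
  rcases eq_or_ne s 1 with rfl | h1
  · simp [xi_one]
  · rw [Ne, xi_eq_zero_iff (by linarith) h1]
    exact riemannZeta_ne_zero_of_one_le_re hs

theorem re_mem_of_xi_eq_zero {s : ℂ} (hs : xi s = 0) : 0 < s.re ∧ s.re < 1 := by
  constructor
  · by_contra h
    exact xi_ne_zero_of_one_le_re (s := 1 - s) (by simp; linarith) (by rw [xi_one_sub, hs])
  · by_contra h
    exact xi_ne_zero_of_one_le_re (s := s) (by linarith) hs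

theorem norm_mellin_le {f : ℝ → ℂ} {a b : ℝ} (ha : MellinConvergent f a) (hb : MellinConvergent f b)
    {s : ℂ} (h1 : a ≤ s.re) (h2 : s.re ≤ b) :
    ‖mellin f s‖ ≤ ∫ t in Ioi (0 : ℝ), (‖(t : ℂ) ^ ((a : ℂ) - 1) • f t‖ +
      ‖(t : ℂ) ^ ((b : ℂ) - 1) • f t‖) := by
  refine norm_integral_le_of_norm_le (ha.norm.add hb.norm) ?_
  filter_upwards [self_mem_ae_restrict measurableSet_Ioi] with t ht
  have ht0 : 0 < t := ht
  rw [norm_smul, norm_smul, norm_smul, ← add_mul]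
  refine mul_le_mul_of_nonneg_right ?_ (norm_nonneg _)
  rw [norm_cpow_eq_rpow_re_of_pos ht0, norm_cpow_eq_rpow_re_of_pos ht0,
    norm_cpow_eq_rpow_re_of_pos ht0]
  simp only [sub_re, ofReal_re, one_re]
  rcases le_total 1 t with h | h
  · have := Real.rpow_le_rpow_of_exponent_le h (show s.re - 1 ≤ b - 1 by linarith)
    have := Real.rpow_nonneg ht0.le (a - 1)
    linarith
  · have := Real.rpow_le_rpow_of_exponent_ge ht0 h (show a - 1 ≤ s.re - 1 by linarith)
    have := Real.rpow_nonneg ht0.le (b - 1)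
    linarith

theorem mellinConvergent_f_modif (P : WeakFEPair ℂ) (s : ℂ) : MellinConvergent P.f_modif s :=
  (P.isStrongFEPair_toStrongFEPair.hasMellin s).1

theorem exists_bound_completedRiemannZeta₀ (a b : ℝ) :
    ∃ C : ℝ, ∀ s : ℂ, a ≤ s.re → s.re ≤ b → ‖completedRiemannZeta₀ s‖ ≤ C := by
  have key : ∀ s : ℂ, a ≤ s.re → s.re ≤ b → ‖mellin (HurwitzZeta.hurwitzEvenFEPair 0).f_modif (s / 2)‖
      ≤ _ := fun s h1 h2 => by
    have : (s / 2).re = s.re / 2 := by simp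
    exact norm_mellin_le (a := a / 2) (b := b / 2) (mellinConvergent_f_modif _ _)
      (mellinConvergent_f_modif _ _) (by linarith) (by linarith)
  refine ⟨(∫ t in Ioi (0 : ℝ), (‖(t : ℂ) ^ (((a / 2 : ℝ) : ℂ) - 1) •
        (HurwitzZeta.hurwitzEvenFEPair 0).f_modif t‖ + ‖(t : ℂ) ^ (((b / 2 : ℝ) : ℂ) - 1) •
        (HurwitzZeta.hurwitzEvenFEPair 0).f_modif t‖)) / ‖(2 : ℂ)‖, fun s h1 h2 => ?_⟩
  rw [completedRiemannZeta₀, HurwitzZeta.completedHurwitzZetaEven₀, norm_div]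
  exact div_le_div_of_nonneg_right (key s h1 h2) (norm_nonneg _)

theorem norm_Gamma_le {s : ℂ} (hs : 0 < s.re) : ‖Complex.Gamma s‖ ≤ Real.Gamma s.re := by
  rw [Complex.Gamma_eq_integral hs, Real.Gamma_eq_integral hs]
  refine norm_integral_le_of_norm_le (Real.GammaIntegral_convergent hs) ?_
  filter_upwards [self_mem_ae_restrict measurableSet_Ioi] with t ht
  have ht0 : 0 < t := ht
  rw [norm_mul, norm_cpow_eq_rpow_re_of_pos ht0, norm_real, Real.norm_of_nonneg (Real.exp_pos _).le]
  simp

theorem Gamma_le_exp_rpow {x : ℝ} (hx : 1 ≤ x) :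
    Real.Gamma x ≤ Real.exp (2 * (x + 1) ^ (3 / 2 : ℝ)) := by
  have hx0 : 0 < x := by linarith
  have h1 : Real.Gamma x ≤ Real.Gamma (x + 1) := by
    rw [Real.Gamma_add_one hx0.ne']
    exact le_mul_of_one_le_left (Real.Gamma_pos_of_pos hx0).le hx
  have h2 : Real.Gamma (x + 1) ≤ Real.Gamma (⌈x⌉₊ + 1) :=
    Real.Gamma_strictMonoOn_Ici.monotoneOn (by simp; linarith)
      (by have := Nat.le_ceil x; simp only [Set.mem_Ici]; linarith)
      (by have := Nat.le_ceil x; linarith)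
  rw [Real.Gamma_nat_eq_factorial] at h2
  have h3 : ((⌈x⌉₊.factorial : ℕ) : ℝ) ≤ (⌈x⌉₊ : ℝ) ^ ⌈x⌉₊ := by
    exact_mod_cast Nat.factorial_le_pow _
  have h4 : (⌈x⌉₊ : ℝ) ≤ x + 1 := (Nat.ceil_lt_add_one hx0.le).le
  have h5 : (⌈x⌉₊ : ℝ) ^ ⌈x⌉₊ ≤ (x + 1) ^ (x + 1) := by
    rw [← Real.rpow_natCast]
    calc _ ≤ (x + 1) ^ (⌈x⌉₊ : ℝ) := Real.rpow_le_rpow (by positivity) h4 (by positivity)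
      _ ≤ _ := Real.rpow_le_rpow_of_exponent_le (by linarith) h4
  refine h1.trans (h2.trans (h3.trans (h5.trans ?_)))
  have hy : 0 < x + 1 := by linarith
  rw [Real.rpow_def_of_pos hy]
  refine Real.exp_le_exp.2 ?_
  have h6 : Real.log (x + 1) ≤ 2 * (x + 1) ^ (1 / 2 : ℝ) := by
    have := Real.log_le_rpow_div hy.le (show (0 : ℝ) < 1 / 2 by norm_num)
    linarith
  calc Real.log (x + 1) * (x + 1) ≤ 2 * (x + 1) ^ (1 / 2 : ℝ) * (x + 1) := by gcongr
    _ = 2 * ((x + 1) ^ (1 / 2 : ℝ) * (x + 1) ^ (1 : ℝ)) := by rw [Real.rpow_one]; ring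
    _ = _ := by rw [← Real.rpow_add hy]; norm_num

theorem norm_riemannZeta_le {s : ℂ} {σ : ℝ} (hσ : 1 < σ) (hs : σ ≤ s.re) :
    ‖riemannZeta s‖ ≤ ∑' n : ℕ, 1 / (n : ℝ) ^ σ := by
  rw [zeta_eq_tsum_one_div_nat_cpow (by linarith)]
  have hsum := Real.summable_one_div_nat_rpow.2 hσ
  refine tsum_of_norm_bounded hsum.hasSum fun n => ?_
  rcases Nat.eq_zero_or_pos n with rfl | hn
  · rw [Nat.cast_zero, Nat.cast_zero, zero_cpow (fun h => by simp [h] at hs; linarith),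
      Real.zero_rpow (by linarith)]
    simp
  · rw [norm_div, norm_one, norm_natCast_cpow_of_pos hn]
    gcongr
    exact_mod_cast hn

theorem exists_growth_xi : ∃ C : ℝ, 0 ≤ C ∧
    ∀ z : ℂ, ‖xi (1 / 2 + z)‖ ≤ Real.exp (C * (1 + ‖z‖) ^ (3 / 2 : ℝ)) := by
  obtain ⟨C₁, hC₁⟩ := exists_bound_completedRiemannZeta₀ 0 2
  set C₂ : ℝ := ∑' n : ℕ, 1 / (n : ℝ) ^ (2 : ℝ)
  have hC₂ : 0 ≤ C₂ := tsum_nonneg fun n => by positivity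
  have hC₁' : 0 ≤ C₁ := (norm_nonneg _).trans (hC₁ 1 (by simp) (by simp))
  set C := C₁ + C₂ + 6 with hC
  have main : ∀ z : ℂ, 0 ≤ z.re → ‖xi (1 / 2 + z)‖ ≤ Real.exp (C * (1 + ‖z‖) ^ (3 / 2 : ℝ)) := by
    intro z hz
    set s := 1 / 2 + z with hs
    set r := 1 + ‖z‖ with hr
    have hr1 : 1 ≤ r := by simp [hr]
    have hsr : s.re = 1 / 2 + z.re := by simp [hs]
    have hzre : z.re ≤ ‖z‖ := re_le_norm z
    have hr32 : r ≤ r ^ (3 / 2 : ℝ) := by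
      simpa using Real.rpow_le_rpow_of_exponent_le hr1 (show (1 : ℝ) ≤ 3 / 2 by norm_num)
    have hns : ‖s‖ ≤ r := by
      refine (norm_add_le _ _).trans ?_
      rw [hr]; norm_num
    have hns1 : ‖s - 1‖ ≤ r := by
      rw [show s - 1 = -(1 / 2) + z by rw [hs]; ring]
      refine (norm_add_le _ _).trans ?_
      rw [hr]; norm_num
    have hpoly : ‖s * (s - 1)‖ ≤ Real.exp (2 * r) := by
      rw [norm_mul]
      calc _ ≤ r * r := by gcongr
        _ ≤ Real.exp r * Real.exp r := by
          have := Real.add_one_le_exp r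
          gcongr <;> linarith
        _ = _ := by rw [← Real.exp_add]; ring_nf
    have fin : ∀ B, 0 ≤ B → B ≤ (C₁ + C₂) * Real.exp (3 * r ^ (3 / 2 : ℝ)) →
        Real.exp (2 * r) * B + 1 ≤ Real.exp (C * r ^ (3 / 2 : ℝ)) := by
      intro B hB0 hB
      set q := r ^ (3 / 2 : ℝ)
      have hq1 : 1 ≤ q := hr1.trans hr32
      have e1 : Real.exp (2 * r) * B + 1 ≤ (C₁ + C₂ + 1) * Real.exp (5 * q) := by
        have i1 : Real.exp (2 * r) * B ≤ Real.exp (2 * q) * ((C₁ + C₂) * Real.exp (3 * q)) := by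
          gcongr
        have i2 : Real.exp (2 * q) * ((C₁ + C₂) * Real.exp (3 * q)) =
            (C₁ + C₂) * Real.exp (5 * q) := by
          rw [show 5 * q = 2 * q + 3 * q by ring, Real.exp_add]; ring
        have i3 : 1 ≤ Real.exp (5 * q) := Real.one_le_exp (by linarith)
        nlinarith
      refine e1.trans ?_
      have e2 : C₁ + C₂ + 1 ≤ Real.exp ((C₁ + C₂ + 1) * q) := by
        have := Real.add_one_le_exp ((C₁ + C₂ + 1) * q)
        nlinarith
      calc _ ≤ Real.exp ((C₁ + C₂ + 1) * q) * Real.exp (5 * q) := by gcongr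
        _ = _ := by rw [← Real.exp_add, hC]; ring_nf
    rcases le_total s.re 2 with h2 | h2
    · rw [xi]
      refine (norm_add_le _ _).trans ?_
      rw [norm_mul, norm_one]
      refine le_trans (b := Real.exp (2 * r) * C₁ + 1) ?_ (fin C₁ hC₁' ?_)
      · gcongr
        exact hC₁ s (by linarith) h2
      · have : 1 ≤ Real.exp (3 * r ^ (3 / 2 : ℝ)) := Real.one_le_exp (by positivity)
        nlinarith
    · have hs1 : s ≠ 1 := fun h => by rw [h] at h2; norm_num at h2
      rw [xi_eq_zeta (by linarith) hs1, norm_mul]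
      have hG : ‖Gammaℝ s‖ ≤ Real.exp (3 * r ^ (3 / 2 : ℝ)) := by
        rw [Gammaℝ_def, norm_mul, norm_cpow_eq_rpow_re_of_pos Real.pi_pos]
        have g1 : Real.pi ^ (-s / 2).re ≤ 1 := by
          refine Real.rpow_le_one_of_one_le_of_nonpos (by linarith [Real.pi_gt_three]) ?_
          have : (-s / 2).re = - s.re / 2 := by simp
          linarith
        have hs2 : (s / 2).re = s.re / 2 := by simp
        have g2 := (norm_Gamma_le (s := s / 2) (by linarith)).trans
          (Gamma_le_exp_rpow (x := (s / 2).re) (by linarith))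
        calc _ ≤ 1 * Real.exp (2 * ((s / 2).re + 1) ^ (3 / 2 : ℝ)) :=
              mul_le_mul g1 g2 (norm_nonneg _) zero_le_one
          _ ≤ _ := by
            rw [one_mul]
            refine Real.exp_le_exp.2 ?_
            have k1 : ((s / 2).re + 1) ^ (3 / 2 : ℝ) ≤ (5 / 4 * r) ^ (3 / 2 : ℝ) := by
              refine Real.rpow_le_rpow (by linarith) ?_ (by norm_num)
              linarith
            rw [Real.mul_rpow (by norm_num) (by linarith)] at k1
            have k2 : (5 / 4 : ℝ) ^ (3 / 2 : ℝ) ≤ 3 / 2 := by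
              rw [show (3 / 2 : ℝ) = 1 + 1 / 2 by norm_num, Real.rpow_add (by norm_num),
                ← Real.sqrt_eq_rpow, Real.rpow_one]
              have : Real.sqrt (5 / 4) ≤ 6 / 5 := Real.sqrt_le_iff.2 (by norm_num)
              linarith
            have k3 : 0 ≤ r ^ (3 / 2 : ℝ) := by positivity
            nlinarith
      have hZ := norm_riemannZeta_le (s := s) (σ := 2) (by norm_num) h2
      have hnb : ‖Gammaℝ s * riemannZeta s‖ ≤ Real.exp (3 * r ^ (3 / 2 : ℝ)) * C₂ := by
        rw [norm_mul]
        gcongr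
      have := fin (Real.exp (3 * r ^ (3 / 2 : ℝ)) * C₂) (by positivity) (by
        have := Real.exp_pos (3 * r ^ (3 / 2 : ℝ)); nlinarith)
      have h9 : ‖s * (s - 1)‖ * ‖Gammaℝ s * riemannZeta s‖ ≤
          Real.exp (2 * r) * (Real.exp (3 * r ^ (3 / 2 : ℝ)) * C₂) := by gcongr
      linarith
  refine ⟨C, by positivity, fun z => ?_⟩
  rcases le_total 0 z.re with h | h
  · exact main z h
  · have := main (-z) (by simp; linarith)
    rwa [norm_neg, ← xi_one_sub, show 1 - (1 / 2 + -z) = 1 / 2 + z by ring] at this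

end

section

open Complex Filter Topology Metric MeasureTheory Set HurwitzZeta

theorem one_le_evenKernel_zero {t : ℝ} (ht : 0 < t) : 1 ≤ evenKernel 0 t := by
  have h := hasSum_int_evenKernel₀ 0 ht
  have h2 : 0 ≤ evenKernel ((0 : ℝ) : UnitAddCircle) t - if ((0 : ℝ) : UnitAddCircle) = 0 then 1 else 0 :=
    h.nonneg fun n => by split_ifs <;> positivity
  simpa using h2

theorem f_modif_eq_norm {t : ℝ} (ht : 0 < t) :
    (hurwitzEvenFEPair 0).f_modif t = (‖(hurwitzEvenFEPair 0).f_modif t‖ : ℂ) := by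
  suffices h : ∃ r : ℝ, 0 ≤ r ∧ (hurwitzEvenFEPair 0).f_modif t = r by
    obtain ⟨r, hr, he⟩ := h
    rw [he, norm_real, Real.norm_of_nonneg hr]
  rcases lt_trichotomy t 1 with h | h | h
  · refine ⟨evenKernel 0 t - t ^ (-(1 / 2) : ℝ), ?_, ?_⟩
    · rw [evenKernel_functional_equation, ← evenKernel_eq_cosKernel_of_zero, Real.rpow_neg ht.le,
        ← one_div, sub_nonneg]
      exact le_mul_of_one_le_right (by positivity) (one_le_evenKernel_zero (by positivity))
    · rw [WeakFEPair.f_modif, Pi.add_apply, indicator_of_notMem (by simp; linarith),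
        indicator_of_mem (by exact ⟨ht, h⟩)]
      simp [hurwitzEvenFEPair]
  · refine ⟨0, le_rfl, ?_⟩
    rw [WeakFEPair.f_modif, Pi.add_apply, indicator_of_notMem (by simp [h]),
        indicator_of_notMem (by simp [h])]
    simp
  · refine ⟨evenKernel 0 t - 1, by linarith [one_le_evenKernel_zero ht], ?_⟩
    rw [WeakFEPair.f_modif, Pi.add_apply, indicator_of_mem (by exact h),
        indicator_of_notMem (by simp; intro; linarith)]
    simp [hurwitzEvenFEPair]

theorem norm_completedRiemannZeta₀_le {s : ℂ} (h0 : 0 ≤ s.re) (h1 : s.re ≤ 1) :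
    ‖completedRiemannZeta₀ s‖ ≤ ‖completedRiemannZeta₀ 1‖ := by
  set φ := (hurwitzEvenFEPair 0).f_modif with hφ
  have hInt : ∀ a : ℝ, IntegrableOn (fun t : ℝ => t ^ (a - 1) * ‖φ t‖) (Ioi 0) := fun a => by
    refine IntegrableOn.congr_fun (mellinConvergent_f_modif (hurwitzEvenFEPair 0) a).norm
      (fun t ht => ?_) measurableSet_Ioi
    have ht0 : 0 < t := ht
    rw [norm_smul, norm_cpow_eq_rpow_re_of_pos ht0]
    simp [hφ]
  have hval : ∀ a : ℝ, completedRiemannZeta₀ (2 * a : ℝ) =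
      ((∫ t in Ioi (0 : ℝ), t ^ (a - 1) * ‖φ t‖) / 2 : ℝ) := fun a => by
    rw [completedRiemannZeta₀, completedHurwitzZetaEven₀, WeakFEPair.Λ₀, mellin]
    push_cast
    rw [← integral_complex_ofReal]
    congr 1
    refine setIntegral_congr_fun measurableSet_Ioi fun t ht => ?_
    have ht0 : 0 < t := ht
    simp only [smul_eq_mul]
    rw [f_modif_eq_norm ht0, mul_div_cancel_left₀ _ (two_ne_zero), ofReal_mul,
      ofReal_cpow ht0.le]
    simp [hφ]
  set I : ℝ → ℝ := fun a => ∫ t in Ioi (0 : ℝ), t ^ (a - 1) * ‖φ t‖ with hI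
  have hI0 : ∀ a, 0 ≤ I a := fun a => setIntegral_nonneg measurableSet_Ioi fun t ht => by
    have ht0 : 0 < t := ht
    positivity
  have e1 : completedRiemannZeta₀ 1 = ((I (1 / 2)) / 2 : ℝ) := by
    have := hval (1 / 2); rwa [show ((2 * (1 / 2 : ℝ) : ℝ) : ℂ) = 1 by norm_num] at this
  have e0 : completedRiemannZeta₀ 1 = ((I 0) / 2 : ℝ) := by
    have := hval 0
    rw [← completedRiemannZeta₀_one_sub, sub_self]
    simpa [hI] using this
  have e01 : I 0 = I (1 / 2) := by
    have : ((I 0 / 2 : ℝ) : ℂ) = ((I (1 / 2) / 2 : ℝ) : ℂ) := e0.symm.trans e1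
    have := ofReal_injective this
    linarith
  rw [e1, norm_real, Real.norm_of_nonneg (by have := hI0 (1 / 2); positivity),
    completedRiemannZeta₀, completedHurwitzZetaEven₀, norm_div, WeakFEPair.Λ₀, mellin]
  have h2 : ‖(2 : ℂ)‖ = 2 := by simp
  rw [h2]
  refine div_le_div_of_nonneg_right ?_ (by norm_num)
  set σ := s.re with hσ
  have key : ∫ t in Ioi (0 : ℝ), ((1 - σ) * (t ^ ((0 : ℝ) - 1) * ‖φ t‖) +
      σ * (t ^ ((1 / 2 : ℝ) - 1) * ‖φ t‖)) = I (1 / 2) := by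
    rw [integral_add ((hInt 0).const_mul _) ((hInt (1 / 2)).const_mul _), integral_const_mul,
      integral_const_mul]
    change (1 - σ) * I 0 + σ * I (1 / 2) = _
    rw [e01]; ring
  rw [← key]
  refine norm_integral_le_of_norm_le (((hInt 0).const_mul _).add ((hInt (1 / 2)).const_mul _)) ?_
  filter_upwards [self_mem_ae_restrict measurableSet_Ioi] with t ht
  have ht0 : 0 < t := ht
  rw [norm_smul, norm_cpow_eq_rpow_re_of_pos ht0, ← mul_assoc, ← mul_assoc, ← add_mul]
  refine mul_le_mul_of_nonneg_right ?_ (norm_nonneg _)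
  have am := Real.geom_mean_le_arith_mean2_weighted (w₁ := 1 - σ) (w₂ := σ)
    (p₁ := t ^ ((0 : ℝ) - 1)) (p₂ := t ^ ((1 / 2 : ℝ) - 1)) (by linarith) h0 (by positivity)
    (by positivity) (by ring)
  refine le_trans (le_of_eq ?_) am
  rw [← Real.rpow_mul ht0.le, ← Real.rpow_mul ht0.le, ← Real.rpow_add ht0]
  congr 1
  have : (s / 2 - 1).re = σ / 2 - 1 := by simp [hσ]
  rw [this]; ring

theorem eulerMascheroniConstant_lt : Real.eulerMascheroniConstant < 0.594 := by
  refine (Real.eulerMascheroniConstant_lt_eulerMascheroniSeq' 32).trans ?_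
  rw [Real.eulerMascheroniSeq']
  have : (harmonic 32 : ℚ) < 4.059 := by decide +kernel
  have h2 : ((harmonic 32 : ℚ) : ℝ) < 4.059 := by
    refine ((Rat.cast_lt (K := ℝ)).2 this).trans_eq ?_
    norm_num
  have h3 : Real.log ((32 : ℕ) : ℝ) = 5 * Real.log 2 := by
    rw [show (((32 : ℕ) : ℝ)) = 2 ^ 5 by norm_num, Real.log_pow]; norm_num
  have := Real.log_two_gt_d9
  rw [if_neg (by norm_num), h3]
  linarith

theorem norm_completedRiemannZeta₀_one_lt : ‖completedRiemannZeta₀ 1‖ < 1 / 30 := by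
  have hpi := Real.pi_gt_d2
  have hl : 2.529 < Real.log (4 * Real.pi) := by
    rw [show 4 * Real.pi = 2 ^ 3 * (Real.pi / 2) by ring, Real.log_mul (by norm_num) (by positivity),
      Real.log_pow]
    have h1 : 0.45 < Real.log (Real.pi / 2) := by
      rw [Real.lt_log_iff_exp_lt (by positivity)]
      have : Real.exp 0.45 < 1.57 := by
        have := Real.exp_bound' (x := 0.45) (by norm_num) (by norm_num) (n := 6) (by norm_num)
        refine this.trans_lt ?_
        norm_num [Finset.sum_range_succ, Nat.factorial]
      linarith
    have := Real.log_two_gt_d9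
    push_cast
    linarith
  have hu : Real.log (4 * Real.pi) < 2.535 := by
    rw [Real.log_lt_iff_lt_exp (by positivity)]
    have h1 := Real.exp_one_gt_d9
    have h2 : Real.exp 2.535 = Real.exp 1 ^ 2 * Real.exp 0.535 := by
      rw [← Real.exp_nat_mul, ← Real.exp_add]; norm_num
    have h3 : (1.706 : ℝ) ≤ Real.exp 0.535 := by
      have := Real.sum_le_exp_of_nonneg (x := 0.535) (by norm_num) 6
      refine le_trans ?_ this
      norm_num [Finset.sum_range_succ, Nat.factorial]
    have := Real.pi_lt_d2
    have h4 : (2.718 : ℝ) ^ 2 ≤ Real.exp 1 ^ 2 := by gcongr; linarith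
    rw [h2]
    nlinarith
  have hg := Real.one_half_lt_eulerMascheroniConstant
  have hg' := eulerMascheroniConstant_lt
  have he : completedRiemannZeta₀ 1 =
      (((Real.eulerMascheroniConstant - Real.log (4 * Real.pi)) / 2 + 1 : ℝ) : ℂ) := by
    rw [completedRiemannZeta₀_one]
    push_cast
    rw [ofReal_log (by positivity)]
    push_cast; rfl
  rw [he, norm_real, Real.norm_eq_abs, abs_lt]
  constructor <;> linarith

theorem five_lt_abs_im_of_xi_eq_zero {s : ℂ} (hs : xi s = 0) : 5 < |s.im| := by
  obtain ⟨h0, h1⟩ := re_mem_of_xi_eq_zero hs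
  have hb := (norm_completedRiemannZeta₀_le h0.le h1.le).trans_lt norm_completedRiemannZeta₀_one_lt
  rw [xi] at hs
  have h2 : ‖s * (s - 1)‖ * ‖completedRiemannZeta₀ s‖ = 1 := by
    rw [← norm_mul, eq_neg_of_add_eq_zero_left hs]; simp
  have h3 : 30 < ‖s * (s - 1)‖ := by
    by_contra h
    push Not at h
    have : ‖s * (s - 1)‖ * ‖completedRiemannZeta₀ s‖ ≤ 30 * ‖completedRiemannZeta₀ s‖ := by gcongr
    linarith
  by_contra h
  push Not at h
  have h4 : s.im ^ 2 ≤ 25 := by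
    rw [← sq_abs]; nlinarith [abs_nonneg s.im]
  have h5 : ‖s * (s - 1)‖ ^ 2 ≤ 26 * 26 := by
    rw [norm_mul, mul_pow, Complex.sq_norm, Complex.sq_norm, normSq_apply, normSq_apply]
    simp only [sub_re, sub_im, one_re, one_im]
    have a1 : s.re * s.re + s.im * s.im ≤ 26 := by nlinarith
    have a2 : (s.re - 1) * (s.re - 1) + (s.im - 0) * (s.im - 0) ≤ 26 := by nlinarith
    refine mul_le_mul a1 a2 (by nlinarith) (by norm_num)
  nlinarith

theorem xi_half_ne_zero : xi (1 / 2) ≠ 0 := fun h => by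
  have := five_lt_abs_im_of_xi_eq_zero h
  norm_num at this

end

section

open Complex Filter Topology Metric MeasureTheory Set ComplexConjugate HurwitzZeta

theorem completedRiemannZeta₀_conj (s : ℂ) :
    completedRiemannZeta₀ (conj s) = conj (completedRiemannZeta₀ s) := by
  rw [completedRiemannZeta₀, completedRiemannZeta₀, completedHurwitzZetaEven₀,
    completedHurwitzZetaEven₀, WeakFEPair.Λ₀, mellin, mellin, map_div₀, ← integral_conj,
    map_ofNat]
  congr 1
  refine setIntegral_congr_fun measurableSet_Ioi fun t ht => ?_
  have ht0 : 0 < t := ht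
  simp only [smul_eq_mul, map_mul]
  have h := cpow_conj (t : ℂ) (s / 2 - 1) (by
    rw [arg_ofReal_of_nonneg ht0.le]; exact Real.pi_pos.ne)
  simp only [map_sub, map_div₀, map_ofNat, map_one, conj_ofReal] at h
  rw [f_modif_eq_norm ht0, conj_ofReal, h]

theorem xi_conj (s : ℂ) : xi (conj s) = conj (xi s) := by
  simp [xi, completedRiemannZeta₀_conj]

theorem xi_one_sub_conj (s : ℂ) : xi (1 - conj s) = conj (xi s) := by
  rw [xi_one_sub, xi_conj]

theorem logDeriv_xi_one_sub_conj (s : ℂ) :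
    logDeriv xi (1 - conj s) = -conj (logDeriv xi s) := by
  have h1 : deriv xi (1 - conj s) = -conj (deriv xi s) := by
    have e1 : HasDerivAt xi (conj (deriv xi s)) (conj s) := by
      have := (differentiable_xi s).hasDerivAt.conj_conj
      have hf : conj ∘ xi ∘ conj = xi := by
        funext z; simp [xi_conj]
      rwa [hf] at this
    have e2 := deriv_comp_const_sub (f := xi) 1 (conj s)
    rw [show (fun z => xi (1 - z)) = xi from funext xi_one_sub, e1.deriv] at e2
    rw [e2, neg_neg]
  rw [logDeriv_apply, logDeriv_apply, h1, xi_one_sub_conj, map_div₀, neg_div]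

/-- Real part of the contribution of a zero `ρ` together with `1 - conj ρ` to the
logarithmic derivative of `ξ`. -/
def pairKernel (s ρ : ℂ) : ℝ := (1 / (s - ρ)).re + (1 / (s - (1 - conj ρ))).re

theorem pairKernel_one_sub_conj (s ρ : ℂ) : pairKernel s (1 - conj ρ) = pairKernel s ρ := by
  simp [pairKernel, add_comm]

def xiShift (z : ℂ) : ℂ := xi (1 / 2 + z)

theorem differentiable_xiShift : Differentiable ℂ xiShift := by
  unfold xiShift
  have := differentiable_xi
  fun_prop

theorem xiShift_zero : xiShift 0 ≠ 0 := by simpa [xiShift] using xi_half_ne_zero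

/-- The zeros of `ξ` in a large disc about `1 / 2`. -/
def xiZeros (N : ℝ) : Finset ℂ :=
  (zerosBall differentiable_xiShift xiShift_zero N).map ⟨fun z => 1 / 2 + z, add_right_injective _⟩

theorem mem_xiZeros {N : ℝ} {ρ : ℂ} : ρ ∈ xiZeros N ↔ xi ρ = 0 ∧ ‖ρ - 1 / 2‖ ≤ N := by
  simp only [xiZeros, Finset.mem_map, mem_zerosBall, Function.Embedding.coeFn_mk, xiShift]
  constructor
  · rintro ⟨z, ⟨h1, h2⟩, rfl⟩
    exact ⟨h1, by simpa using h2⟩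
  · rintro ⟨h1, h2⟩
    exact ⟨ρ - 1 / 2, ⟨by simpa using h1, h2⟩, by ring⟩

/-- The multiplicity of a zero of `ξ`. -/
def xiMult (ρ : ℂ) : ℕ := analyticOrderNatAt xiShift (ρ - 1 / 2)

theorem one_le_xiMult {ρ : ℂ} (h : xi ρ = 0) : 1 ≤ xiMult ρ := by
  have h0 : xiShift (ρ - 1 / 2) = 0 := by simpa [xiShift] using h
  have han := differentiable_xiShift.analyticAt (ρ - 1 / 2)
  have hne : analyticOrderAt xiShift (ρ - 1 / 2) ≠ 0 := by
    rwa [Ne, han.analyticOrderAt_eq_zero, not_not]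
  have htop : analyticOrderAt xiShift (ρ - 1 / 2) ≠ ⊤ := fun h => by
    have := AnalyticOnNhd.eqOn_zero_of_preconnected_of_eventuallyEq_zero
      (fun z _ => differentiable_xiShift.analyticAt z) isPreconnected_univ (Set.mem_univ (ρ - 1 / 2))
      (analyticOrderAt_eq_top.1 h)
    exact xiShift_zero (this (Set.mem_univ 0))
  rw [← Nat.cast_analyticOrderNatAt htop] at hne
  rw [xiMult, Nat.one_le_iff_ne_zero]
  exact_mod_cast hne

theorem tendsto_sum_xiZeros {s : ℂ} (hs : xi s ≠ 0) :
    Tendsto (fun N : ℕ => ∑ ρ ∈ xiZeros N, xiMult ρ * (1 / (s - ρ) + 1 / (ρ - 1 / 2)))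
      atTop (𝓝 (logDeriv xi s)) := by
  obtain ⟨C, hC, hgr⟩ := exists_growth_xi
  have hld : ∀ z, logDeriv xiShift z = logDeriv xi (1 / 2 + z) := fun z => by
    rw [logDeriv_apply, logDeriv_apply]
    rw [show xiShift = fun z => xi (1 / 2 + z) from rfl, deriv_comp_const_add]
  have h0 : logDeriv xiShift 0 = 0 := by
    have he : (fun z => xiShift (-z)) = xiShift := by
      funext z
      rw [xiShift, ← xi_one_sub, xiShift]; ring_nf
    have h4 := deriv_comp_neg xiShift 0
    rw [he, neg_zero] at h4
    have h5 : deriv xiShift 0 = 0 := by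
      linear_combination (1 / 2 : ℂ) * h4
    rw [logDeriv_apply, h5, zero_div]
  have := tendsto_sum_zeros differentiable_xiShift xiShift_zero hC hgr (z := s - 1 / 2)
    (by simpa [xiShift] using hs)
  rw [h0, hld, sub_zero, show 1 / 2 + (s - 1 / 2) = s by ring] at this
  refine this.congr fun N => ?_
  rw [xiZeros, Finset.sum_map]
  refine Finset.sum_congr rfl fun z _ => ?_
  simp only [Function.Embedding.coeFn_mk, xiMult]
  rw [show (1 / 2 + z - 1 / 2 : ℂ) = z by ring, show s - (1 / 2 + z) = s - 1 / 2 - z by ring]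

theorem tendsto_sum_pairKernel {s : ℂ} (hs : xi s ≠ 0) :
    Tendsto (fun N : ℕ => ∑ ρ ∈ xiZeros N, (xiMult ρ : ℝ) * (pairKernel s ρ / 2))
      atTop (𝓝 (logDeriv xi s).re) := by
  have h1 := tendsto_sum_xiZeros hs
  have h2 := tendsto_sum_xiZeros (s := 1 - conj s) (by
    rw [xi_one_sub_conj]; simpa using hs)
  rw [logDeriv_xi_one_sub_conj] at h2
  have h3 := (continuous_re.tendsto _).comp (h1.sub h2)
  have h4 := h3.div_const 2
  have e : (logDeriv xi s - -conj (logDeriv xi s)).re / 2 = (logDeriv xi s).re := by simp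
  rw [e] at h4
  refine h4.congr fun N => ?_
  rw [Function.comp_apply, ← Finset.sum_sub_distrib, re_sum, Finset.sum_div]
  refine Finset.sum_congr rfl fun ρ _ => ?_
  have e1 : (xiMult ρ : ℂ) * (1 / (s - ρ) + 1 / (ρ - 1 / 2)) -
      (xiMult ρ : ℂ) * (1 / (1 - conj s - ρ) + 1 / (ρ - 1 / 2)) =
      ((xiMult ρ : ℝ) : ℂ) * (1 / (s - ρ) - 1 / (1 - conj s - ρ)) := by
    push_cast; ring
  rw [e1, re_ofReal_mul, sub_re, pairKernel, mul_div_assoc]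
  congr 2
  rw [sub_eq_add_neg, ← neg_re, ← conj_re (-(1 / (1 - conj s - ρ)))]
  congr 2
  simp only [one_div, map_neg, map_inv₀, map_sub, map_one, conj_conj]
  rw [← inv_neg]
  congr 1
  ring

theorem tendsto_weighted_sum_pairKernel {ι : Type*} (I : Finset ι) (w : ι → ℝ) (s : ι → ℂ)
    (hs : ∀ i ∈ I, xi (s i) ≠ 0) :
    Tendsto (fun N : ℕ => ∑ ρ ∈ xiZeros N,
      (xiMult ρ : ℝ) * ((∑ i ∈ I, w i * pairKernel (s i) ρ) / 2)) atTop
      (𝓝 (∑ i ∈ I, w i * (logDeriv xi (s i)).re)) := by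
  have := tendsto_finsetSum I fun i hi => (tendsto_sum_pairKernel (hs i hi)).const_mul (w i)
  refine this.congr fun N => ?_
  simp_rw [Finset.mul_sum, Finset.sum_div, Finset.mul_sum]
  rw [Finset.sum_comm]
  refine Finset.sum_congr rfl fun ρ _ => Finset.sum_congr rfl fun i _ => by ring

theorem weighted_sum_nonneg {ι : Type*} (I : Finset ι) (w : ι → ℝ) (s : ι → ℂ)
    (hs : ∀ i ∈ I, xi (s i) ≠ 0) (hK : ∀ ρ, xi ρ = 0 → 0 ≤ ∑ i ∈ I, w i * pairKernel (s i) ρ) :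
    0 ≤ ∑ i ∈ I, w i * (logDeriv xi (s i)).re :=
  ge_of_tendsto' (tendsto_weighted_sum_pairKernel I w s hs) fun N =>
    Finset.sum_nonneg fun ρ hρ => mul_nonneg (Nat.cast_nonneg _)
      (div_nonneg (hK ρ (mem_xiZeros.1 hρ).1) (by norm_num))

theorem pairKernel_sum_le {ι : Type*} (I : Finset ι) (w : ι → ℝ) (s : ι → ℂ)
    (hs : ∀ i ∈ I, xi (s i) ≠ 0) (hK : ∀ ρ, xi ρ = 0 → 0 ≤ ∑ i ∈ I, w i * pairKernel (s i) ρ)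
    {ρ₀ : ℂ} (h0 : xi ρ₀ = 0) (h2 : ρ₀.re ≠ 1 / 2) :
    ∑ i ∈ I, w i * pairKernel (s i) ρ₀ ≤ ∑ i ∈ I, w i * (logDeriv xi (s i)).re := by
  refine ge_of_tendsto (tendsto_weighted_sum_pairKernel I w s hs) ?_
  filter_upwards [tendsto_natCast_atTop_atTop.eventually (eventually_ge_atTop ‖ρ₀ - 1 / 2‖)]
    with N hN
  have hne : ρ₀ ≠ 1 - conj ρ₀ := fun h => by
    have := congrArg re h
    simp at this
    apply h2; linarith
  have hm1 : ρ₀ ∈ xiZeros N := mem_xiZeros.2 ⟨h0, hN⟩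
  have hm2 : 1 - conj ρ₀ ∈ xiZeros N := by
    refine mem_xiZeros.2 ⟨by rw [xi_one_sub_conj, h0, map_zero], ?_⟩
    have : 1 - conj ρ₀ - 1 / 2 = -conj (ρ₀ - 1 / 2) := by
      simp only [map_sub, map_div₀, map_one, map_ofNat]; ring
    rw [this, norm_neg, norm_conj]; exact hN
  have hsub : ({ρ₀, 1 - conj ρ₀} : Finset ℂ) ⊆ xiZeros N := by
    intro x hx
    simp only [Finset.mem_insert, Finset.mem_singleton] at hx
    rcases hx with rfl | rfl <;> assumption
  refine le_trans ?_ (Finset.sum_le_sum_of_subset_of_nonneg hsub fun ρ hρ _ =>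
    mul_nonneg (Nat.cast_nonneg _) (div_nonneg (hK ρ (mem_xiZeros.1 hρ).1) (by norm_num)))
  rw [Finset.sum_pair hne]
  simp only [pairKernel_one_sub_conj]
  have q := hK ρ₀ h0
  have m1 : (1 : ℝ) ≤ xiMult ρ₀ := by exact_mod_cast one_le_xiMult h0
  have m2 : (1 : ℝ) ≤ xiMult (1 - conj ρ₀) := by
    exact_mod_cast one_le_xiMult (mem_xiZeros.1 hm2).1
  nlinarith

theorem norm_logDeriv_xi_sub_le {s s₁ : ℂ} (hs : xi s ≠ 0) (hs₁ : xi s₁ ≠ 0) {C : ℝ}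
    (hK : ∀ ρ, xi ρ = 0 → ‖1 / (s - ρ) - 1 / (s₁ - ρ)‖ ≤ C * (pairKernel s₁ ρ / 2)) :
    ‖logDeriv xi s - logDeriv xi s₁‖ ≤ C * (logDeriv xi s₁).re := by
  refine le_of_tendsto_of_tendsto' ((tendsto_sum_xiZeros hs).sub (tendsto_sum_xiZeros hs₁)).norm
    ((tendsto_sum_pairKernel hs₁).const_mul C) fun N => ?_
  rw [← Finset.sum_sub_distrib, Finset.mul_sum]
  refine norm_sum_le_of_le _ fun ρ hρ => ?_
  rw [← mul_sub, norm_mul, add_sub_add_right_eq_sub, mul_left_comm]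
  simp only [norm_natCast]
  exact mul_le_mul_of_nonneg_left (hK ρ (mem_xiZeros.1 hρ).1) (Nat.cast_nonneg _)

end

section

open Complex Filter Topology Metric

theorem tendsto_deriv_of_bounded {f : ℕ → ℂ → ℂ} {g : ℂ → ℂ} {c : ℂ} {R B : ℝ} (hR : 0 < R)
    (hf : ∀ᶠ n in atTop, DifferentiableOn ℂ (f n) (closedBall c R))
    (hg : DifferentiableOn ℂ g (closedBall c R))
    (hB : ∀ᶠ n in atTop, ∀ z ∈ sphere c R, ‖f n z‖ ≤ B)
    (hlim : ∀ z ∈ sphere c R, Tendsto (fun n => f n z) atTop (𝓝 (g z))) :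
    Tendsto (fun n => deriv (f n) c) atTop (𝓝 (deriv g c)) := by
  have key : ∀ h : ℂ → ℂ, DifferentiableOn ℂ h (closedBall c R) →
      deriv h c = (2 * Real.pi * I)⁻¹ • ∮ z in C(c, R), (1 / (z - c) ^ 2) • h z := by
    intro h hh
    rw [DiffContOnCl.deriv_eq_smul_circleIntegral hR
      ((hh.mono closure_ball_subset_closedBall).diffContOnCl), smul_smul, inv_mul_cancel₀, one_smul]
    simp [Real.pi_ne_zero]
  rw [key g hg]
  have h1 : Tendsto (fun n => ∮ z in C(c, R), (1 / (z - c) ^ 2) • f n z) atTop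
      (𝓝 (∮ z in C(c, R), (1 / (z - c) ^ 2) • g z)) := by
    unfold circleIntegral
    refine intervalIntegral.tendsto_integral_filter_of_dominated_convergence
      (fun _ => R * (1 / R ^ 2 * B)) ?_ ?_ (by simp) ?_
    · filter_upwards [hf] with n hn
      refine Continuous.aestronglyMeasurable ?_
      have hc : Continuous fun θ => f n (circleMap c R θ) :=
        hn.continuousOn.comp_continuous (continuous_circleMap c R)
          (fun θ => circleMap_mem_closedBall c hR.le θ)
      have h0 : ∀ θ, (circleMap c R θ - c) ^ 2 ≠ 0 := fun θ =>
        pow_ne_zero 2 (sub_ne_zero.2 (circleMap_ne_center hR.ne'))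
      simp only [deriv_circleMap]
      have hm := continuous_circleMap c R
      have hm' := continuous_circleMap 0 R
      exact (hm'.mul continuous_const).smul
        ((continuous_const.div ((hm.sub continuous_const).pow 2) h0).smul hc)
    · filter_upwards [hB] with n hn
      refine Eventually.of_forall fun θ _ => ?_
      rw [norm_smul, norm_smul, deriv_circleMap]
      have h2 := hn _ (circleMap_mem_sphere c hR.le θ)
      have h3 : ‖circleMap c R θ - c‖ = R := by simp [abs_of_pos hR]
      simp only [norm_mul, norm_circleMap_zero, norm_I, mul_one, norm_div, norm_one, norm_pow, h3,
        abs_of_pos hR]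
      gcongr
    · refine Eventually.of_forall fun θ _ => ?_
      exact ((hlim _ (circleMap_mem_sphere c hR.le θ)).const_smul _).const_smul _
  refine (h1.const_smul ((2 * Real.pi * I : ℂ)⁻¹)).congr' ?_
  filter_upwards [hf] with n hn
  exact (key _ hn).symm

theorem norm_GammaSeq_le {s : ℂ} (hs : 0 < s.re) {n : ℕ} (hn : n ≠ 0) :
    ‖GammaSeq s n‖ ≤ Real.Gamma s.re := by
  rw [GammaSeq_eq_approx_Gamma_integral hs hn, Real.Gamma_eq_integral hs,
    intervalIntegral.integral_of_le (by positivity)]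
  have hInt := Real.GammaIntegral_convergent hs
  have h1 : ∀ t ∈ Set.Ioc (0 : ℝ) n, ‖((((1 - t / n) ^ n : ℝ) : ℂ)) * (t : ℂ) ^ (s - 1)‖
      ≤ Real.exp (-t) * t ^ (s.re - 1) := by
    intro t ht
    rw [norm_mul, norm_cpow_eq_rpow_re_of_pos ht.1, norm_real, Real.norm_of_nonneg]
    · have := Real.one_sub_div_pow_le_exp_neg ht.2
      have h0 : 0 ≤ t ^ (s - 1).re := Real.rpow_nonneg ht.1.le _
      simpa using mul_le_mul_of_nonneg_right this h0
    · refine pow_nonneg ?_ _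
      have : t / n ≤ 1 := (div_le_one (by have := ht.1; linarith [ht.2])).2 ht.2
      linarith
  refine (MeasureTheory.norm_integral_le_of_norm_le (hInt.mono_set Set.Ioc_subset_Ioi_self)
    ((MeasureTheory.ae_restrict_iff' measurableSet_Ioc).2 (Eventually.of_forall h1))).trans ?_
  refine MeasureTheory.setIntegral_mono_set hInt ?_ Set.Ioc_subset_Ioi_self.eventuallyLE
  filter_upwards [MeasureTheory.self_mem_ae_restrict measurableSet_Ioi] with t ht
  have : (0 : ℝ) < t := ht
  simp only [Pi.zero_apply]
  positivity

theorem hasDerivAt_logDeriv_GammaSeq {s : ℂ} (hs : 0 < s.re) {n : ℕ} (hn : n ≠ 0) :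
    HasDerivAt (fun s => GammaSeq s n)
      (GammaSeq s n * (Real.log n - ∑ j ∈ Finset.range (n + 1), 1 / (s + j))) s := by
  have hne : ∀ j : ℕ, s + j ≠ 0 := fun j h => by
    have := congrArg re h
    simp at this
    linarith [(Nat.cast_nonneg j : (0 : ℝ) ≤ j)]
  have hn' : (n : ℂ) ≠ 0 := Nat.cast_ne_zero.2 hn
  have h1 : HasDerivAt (fun s : ℂ => (n : ℂ) ^ s * (n.factorial : ℂ))
      ((n : ℂ) ^ s * Real.log n * n.factorial) s := by
    have := ((hasDerivAt_id s).const_cpow (Or.inl hn')).mul_const (n.factorial : ℂ)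
    simpa [natCast_log] using this
  have h2 : HasDerivAt (fun s : ℂ => ∏ j ∈ Finset.range (n + 1), (s + j))
      ((∏ j ∈ Finset.range (n + 1), (s + j)) * ∑ j ∈ Finset.range (n + 1), 1 / (s + j)) s := by
    have := HasDerivAt.fun_finsetProd (u := Finset.range (n + 1)) (f := fun j s => s + (j : ℂ))
      (f' := fun _ => 1) (x := s) (fun j _ => (hasDerivAt_id s).add_const _)
    refine this.congr_deriv ?_
    rw [Finset.mul_sum]
    refine Finset.sum_congr rfl fun j hj => ?_
    rw [← Finset.prod_erase_mul _ _ hj]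
    field_simp [hne j]
    simp
  have h0 : (∏ j ∈ Finset.range (n + 1), (s + (j : ℂ))) ≠ 0 :=
    Finset.prod_ne_zero_iff.2 fun j _ => hne j
  refine (h1.div h2 h0).congr_deriv ?_
  unfold GammaSeq
  field_simp

theorem tendsto_digamma {s : ℂ} (hs : 0 < s.re) :
    Tendsto (fun n : ℕ => (Real.log n : ℂ) - ∑ j ∈ Finset.range (n + 1), 1 / (s + j)) atTop
      (𝓝 (digamma s)) := by
  set R := s.re / 2 with hRdef
  have hR : 0 < R := by positivity
  have hre : ∀ z ∈ closedBall s R, 0 < z.re := by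
    intro z hz
    have h1 := (abs_re_le_norm (z - s)).trans (mem_closedBall_iff_norm.1 hz)
    rw [sub_re] at h1
    have := (abs_le.1 h1).1
    linarith
  have hcont : ContinuousOn (fun z : ℂ => Real.Gamma z.re) (closedBall s R) := by
    intro z hz
    refine ContinuousAt.continuousWithinAt ?_
    have h2 : ContinuousAt Real.Gamma z.re :=
      (Real.differentiableAt_Gamma (fun m => by
        have := hre z hz
        have := (Nat.cast_nonneg m : (0 : ℝ) ≤ m)
        linarith)).continuousAt
    exact h2.comp continuous_re.continuousAt
  obtain ⟨B, hB⟩ := (isCompact_closedBall s R).exists_bound_of_continuousOn hcont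
  have hd : Tendsto (fun n => deriv (fun z => GammaSeq z n) s) atTop (𝓝 (deriv Gamma s)) := by
    refine tendsto_deriv_of_bounded (B := B) hR ?_ ?_ ?_ (fun z _ => GammaSeq_tendsto_Gamma z)
    · filter_upwards [eventually_ne_atTop 0] with n hn z hz
      exact (hasDerivAt_logDeriv_GammaSeq (hre z hz) hn).differentiableAt.differentiableWithinAt
    · intro z hz
      exact (differentiableAt_Gamma _ (fun m h => by
        have := hre z hz
        rw [h] at this
        simp at this
        linarith [(Nat.cast_nonneg m : (0 : ℝ) ≤ m)])).differentiableWithinAt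
    · filter_upwards [eventually_ne_atTop 0] with n hn z hz
      have hz' := sphere_subset_closedBall hz
      exact (norm_GammaSeq_le (hre z hz') hn).trans ((le_abs_self _).trans (hB z hz'))
  have hG : Gamma s ≠ 0 := Gamma_ne_zero_of_re_pos hs
  have h3 := hd.div (GammaSeq_tendsto_Gamma s) hG
  rw [digamma_def, logDeriv_apply]
  refine h3.congr' ?_
  have h4 : ∀ᶠ n in atTop, GammaSeq s n ≠ 0 := (GammaSeq_tendsto_Gamma s).eventually_ne hG
  filter_upwards [eventually_ne_atTop 0, h4] with n hn hn2
  rw [Pi.div_apply, (hasDerivAt_logDeriv_GammaSeq hs hn).deriv, mul_div_cancel_left₀ _ hn2]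

theorem norm_trapezoid_inv_le {w : ℂ} (hw : 0 < w.re) :
    ‖(1 / 2 : ℂ) * (1 / w + 1 / (w + 1)) - (log (w + 1) - log w)‖ ≤ 1 / (6 * ‖w‖ ^ 3) := by
  have hw0 : w ≠ 0 := fun h => by simp [h] at hw
  have hn : 0 < ‖w‖ := norm_pos_iff.2 hw0
  have hre : ∀ x : ℝ, 0 ≤ x → 0 < (w + x).re := fun x hx => by simp; linarith
  have hne : ∀ x : ℝ, 0 ≤ x → w + x ≠ 0 := fun x hx h => by
    have := hre x hx
    rw [h] at this
    simp at this
  have hle : ∀ x : ℝ, 0 ≤ x → ‖w‖ ≤ ‖w + x‖ := fun x hx => by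
    rw [Complex.norm_eq_sqrt_sq_add_sq, Complex.norm_eq_sqrt_sq_add_sq]
    refine Real.sqrt_le_sqrt ?_
    simp only [add_re, ofReal_re, add_im, ofReal_im, add_zero]
    nlinarith
  set E : ℝ → ℂ := fun x => (1 / 2 : ℂ) * x * (1 / w + 1 / (w + x)) - (log (w + x) - log w) with hE
  have hderiv : ∀ x : ℝ, 0 ≤ x → HasDerivAt E ((1 / 2 : ℂ) * x ^ 2 / (w * (w + x) ^ 2)) x := by
    intro x hx
    have hx1 : HasDerivAt (fun x : ℝ => (x : ℂ)) 1 x := ofRealCLM.hasDerivAt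
    have h1 : HasDerivAt (fun x : ℝ => w + (x : ℂ)) 1 x := hx1.const_add w
    have h2 : HasDerivAt (fun x : ℝ => log (w + (x : ℂ))) (1 / (w + x)) x := by
      have := (Complex.hasDerivAt_log (Or.inl (hre x hx))).comp x h1
      refine this.congr_deriv ?_
      simp
    have h3 : HasDerivAt (fun x : ℝ => 1 / (w + (x : ℂ))) (-1 / (w + x) ^ 2) x := by
      simpa only [one_div] using h1.fun_inv (hne x hx)
    have h4 := ((hx1.const_mul (1 / 2 : ℂ)).fun_mul (h3.const_add (1 / w))).fun_sub
      (h2.sub_const (log w))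
    refine h4.congr_deriv ?_
    have := hne x hx
    field_simp
    ring
  have hcube : ∀ x : ℝ, HasDerivAt (fun x : ℝ => x ^ 3 / (6 * ‖w‖ ^ 3)) (x ^ 2 / (2 * ‖w‖ ^ 3)) x := by
    intro x
    refine ((hasDerivAt_pow 3 x).div_const _).congr_deriv ?_
    field_simp
    ring
  have key := image_norm_le_of_norm_deriv_right_le_deriv_boundary (f := E)
    (f' := fun x => (1 / 2 : ℂ) * x ^ 2 / (w * (w + x) ^ 2)) (a := 0) (b := 1)
    (B := fun x => x ^ 3 / (6 * ‖w‖ ^ 3)) (B' := fun x => x ^ 2 / (2 * ‖w‖ ^ 3))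
    (fun x hx => (hderiv x hx.1).continuousAt.continuousWithinAt)
    (fun x hx => (hderiv x hx.1).hasDerivWithinAt) (by simp [hE]) hcube
    (fun x hx => by
      have h5 := hle x hx.1
      rw [norm_div, norm_mul, norm_mul, norm_pow, norm_pow, norm_real, Real.norm_eq_abs, sq_abs]
      have h6 : ‖(1 / 2 : ℂ)‖ = 1 / 2 := by norm_num
      have h9 : 0 < ‖w + x‖ := hn.trans_le h5
      rw [h6, div_le_div_iff₀ (by positivity) (by positivity)]
      have h7 : ‖w‖ ^ 2 ≤ ‖w + x‖ ^ 2 := by gcongr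
      have h8 : ‖w‖ ^ 3 ≤ ‖w‖ * ‖w + x‖ ^ 2 := by nlinarith
      nlinarith [sq_nonneg x, mul_le_mul_of_nonneg_left h8 (sq_nonneg x)])
  have := key (Set.right_mem_Icc.2 zero_le_one)
  simpa [hE] using this

theorem inv_norm_cube_le {y : ℝ} (hy : 0 < y) {w : ℂ} (hw : w.im = y) {x : ℝ} (hx : 0 ≤ x)
    (hxw : x + 1 ≤ w.re) :
    1 / ‖w‖ ^ 3 ≤ (x + 1) / (y ^ 2 * √((x + 1) ^ 2 + y ^ 2)) - x / (y ^ 2 * √(x ^ 2 + y ^ 2)) := by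
  have hpos : ∀ u : ℝ, 0 < u ^ 2 + y ^ 2 := fun u => by positivity
  have hd : ∀ u : ℝ, HasDerivAt (fun u => u / (y ^ 2 * √(u ^ 2 + y ^ 2)))
      (1 / (√(u ^ 2 + y ^ 2)) ^ 3) u := by
    intro u
    have h1 : HasDerivAt (fun u : ℝ => u ^ 2 + y ^ 2) (2 * u) u := by
      simpa using (hasDerivAt_pow 2 u).add_const (y ^ 2)
    have h2 := (h1.sqrt (hpos u).ne').const_mul (y ^ 2)
    have hs : 0 < √(u ^ 2 + y ^ 2) := Real.sqrt_pos.2 (hpos u)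
    have hsq : √(u ^ 2 + y ^ 2) ^ 2 = u ^ 2 + y ^ 2 := Real.sq_sqrt (hpos u).le
    refine ((hasDerivAt_id u).fun_div h2 (by positivity)).congr_deriv ?_
    have : y ^ 2 = √(u ^ 2 + y ^ 2) ^ 2 - u ^ 2 := by linarith
    simp only [id]
    field_simp
    rw [hsq]; ring
  obtain ⟨u, hu, hu2⟩ := exists_hasDerivAt_eq_slope (fun u => u / (y ^ 2 * √(u ^ 2 + y ^ 2)))
    (fun u => 1 / (√(u ^ 2 + y ^ 2)) ^ 3) (show x < x + 1 by linarith)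
    (fun u _ => (hd u).continuousAt.continuousWithinAt) (fun u _ => hd u)
  simp only [add_sub_cancel_left, div_one] at hu2
  rw [← hu2]
  have hs : 0 < √(u ^ 2 + y ^ 2) := Real.sqrt_pos.2 (hpos u)
  refine one_div_le_one_div_of_le (by positivity) ?_
  gcongr
  rw [Complex.norm_eq_sqrt_sq_add_sq, hw]
  refine Real.sqrt_le_sqrt ?_
  have := hu.1
  have := hu.2
  nlinarith

theorem sum_inv_norm_cube_le {z : ℂ} (hz : 0 < z.re) (hy : 0 < z.im) (n : ℕ) :
    ∑ j ∈ Finset.range n, 1 / ‖z + j‖ ^ 3 ≤ 1 / z.im ^ 3 + 1 / z.im ^ 2 := by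
  set y := z.im with hydef
  set G : ℝ → ℝ := fun u => u / (y ^ 2 * √(u ^ 2 + y ^ 2)) with hG
  have hG1 : ∀ u, 0 ≤ u → G u ≤ 1 / y ^ 2 := by
    intro u hu
    simp only [hG]
    have h1 : u ≤ √(u ^ 2 + y ^ 2) := Real.le_sqrt_of_sq_le (by nlinarith)
    have h2 : 0 < √(u ^ 2 + y ^ 2) := Real.sqrt_pos.2 (by positivity)
    rw [div_le_div_iff₀ (by positivity) (by positivity)]
    nlinarith [sq_nonneg y, mul_le_mul_of_nonneg_right h1 (sq_nonneg y)]
  have h0 : 1 / ‖z‖ ^ 3 ≤ 1 / y ^ 3 := by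
    refine one_div_le_one_div_of_le (by positivity) ?_
    gcongr
    exact (le_abs_self _).trans (abs_im_le_norm z)
  have hmain : ∀ n : ℕ, ∑ j ∈ Finset.range (n + 1), 1 / ‖z + j‖ ^ 3 ≤ 1 / y ^ 3 + G n := by
    intro n
    induction n with
    | zero => simpa [hG] using h0
    | succ n ih =>
      rw [Finset.sum_range_succ]
      have := inv_norm_cube_le (y := y) hy (w := z + ((n + 1 : ℕ) : ℂ)) (by simp [hydef])
        (x := n) (by positivity) (by simp; linarith)
      simp only [hG] at ih ⊢
      push_cast at this ⊢
      linarith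
  rcases n with _ | n
  · simp; positivity
  · linarith [hmain n, hG1 n (by positivity)]

theorem norm_digamma_sub_log_le {z : ℂ} (hz : 0 < z.re) (hy : 0 < z.im) :
    ‖digamma z - (log z - 1 / (2 * z))‖ ≤ (1 / 6) * (1 / z.im ^ 3 + 1 / z.im ^ 2) := by
  have hre : ∀ j : ℕ, 0 < (z + j).re := fun j => by
    simp; linarith [(Nat.cast_nonneg j : (0 : ℝ) ≤ j)]
  have hne : ∀ j : ℕ, z + j ≠ 0 := fun j h => by
    have := hre j
    rw [h] at this
    simp at this
  set e : ℕ → ℂ := fun j => (1 / 2 : ℂ) * (1 / (z + j) + 1 / (z + j + 1))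
    - (log (z + j + 1) - log (z + j)) with he
  have hid : ∀ n : ℕ, ∑ j ∈ Finset.range (n + 1), 1 / (z + j)
      = ∑ j ∈ Finset.range n, e j + (log (z + n) - log z) + 1 / (2 * z) + 1 / (2 * (z + n)) := by
    intro n
    induction n with
    | zero =>
      have := hne 0
      simp at this ⊢
      field_simp
      norm_num
    | succ n ih =>
      rw [Finset.sum_range_succ, ih, Finset.sum_range_succ]
      simp only [he]
      push_cast
      have h1 := hne n
      have h2 := hne (n + 1)
      push_cast at h2
      rw [← add_assoc] at h2 ⊢
      field_simp
      ring
  have hE : ∀ n : ℕ, ‖∑ j ∈ Finset.range n, e j‖ ≤ (1 / 6) * (1 / z.im ^ 3 + 1 / z.im ^ 2) := by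
    intro n
    refine (norm_sum_le _ _).trans ?_
    refine le_trans ?_ (mul_le_mul_of_nonneg_left (sum_inv_norm_cube_le hz hy n) (by norm_num))
    rw [Finset.mul_sum]
    refine Finset.sum_le_sum fun j _ => ?_
    refine (norm_trapezoid_inv_le (hre j)).trans (le_of_eq ?_)
    field_simp
  have hlog : Tendsto (fun n : ℕ => log (z + n) - Real.log n) atTop (𝓝 0) := by
    have h1 : Tendsto (fun n : ℕ => log (1 + z / n)) atTop (𝓝 (log (1 + 0))) := by
      have h2 : Tendsto (fun n : ℕ => 1 + z / n) atTop (𝓝 (1 + 0)) :=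
        (tendsto_const_div_atTop_nhds_zero_nat z).const_add 1
      exact h2.clog (by simp)
    rw [add_zero, log_one] at h1
    refine h1.congr' ?_
    filter_upwards [eventually_gt_atTop 0] with n hn
    have hn' : (0 : ℝ) < n := Nat.cast_pos.2 hn
    have hnc : (n : ℂ) ≠ 0 := Nat.cast_ne_zero.2 hn.ne'
    have h3 : z + n = (n : ℝ) * (1 + z / n) := by
      push_cast
      field_simp
      ring
    rw [h3, log_ofReal_mul hn' ?_]
    · simp
    · intro h
      rw [h, mul_zero] at h3
      exact hne n h3
  have hinv : Tendsto (fun n : ℕ => 1 / (2 * (z + n))) atTop (𝓝 0) := by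
    rw [tendsto_zero_iff_norm_tendsto_zero]
    refine squeeze_zero' (Eventually.of_forall fun n => norm_nonneg _) ?_
      (tendsto_one_div_atTop_nhds_zero_nat (𝕜 := ℝ))
    filter_upwards [eventually_gt_atTop 0] with n hn
    have hn' : (0 : ℝ) < n := Nat.cast_pos.2 hn
    rw [norm_div, norm_one, norm_mul]
    refine one_div_le_one_div_of_le hn' ?_
    have h5 := (le_abs_self _).trans (abs_re_le_norm (z + n))
    simp at h5 ⊢
    linarith
  have hT : Tendsto (fun n => -∑ j ∈ Finset.range n, e j) atTop
      (𝓝 (digamma z - (log z - 1 / (2 * z)))) := by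
    have h1 := ((((tendsto_digamma hz).add hlog).add hinv)).sub_const (log z - 1 / (2 * z))
    simp only [add_zero] at h1
    refine h1.congr fun n => ?_
    rw [hid n]
    ring
  exact le_of_tendsto hT.norm (Eventually.of_forall fun n => by rw [norm_neg]; exact hE n)

end

section

open Complex Filter Topology ArithmeticFunction
open scoped LSeries.notation

/-- The archimedean and polar part of the negative logarithmic derivative of `ζ`. -/
def archTerm (s : ℂ) : ℂ := 1 / (s - 1) + digamma (s / 2 + 1) / 2 - Real.log Real.pi / 2

theorem LSeries_vonMangoldt_eq_archTerm {s : ℂ} (hs : 1 < s.re) :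
    LSeries ↗Λ s = archTerm s - logDeriv xi s := by
  have hs0 : s ≠ 0 := fun h => by simp [h] at hs; linarith
  have hs1 : s ≠ 1 := fun h => by simp [h] at hs
  have hζ : riemannZeta s ≠ 0 := riemannZeta_ne_zero_of_one_lt_re hs
  have hG : Gamma (s / 2) ≠ 0 := Gamma_ne_zero_of_re_pos (by simp; linarith)
  have hpi : (Real.pi : ℂ) ≠ 0 := ofReal_ne_zero.2 Real.pi_ne_zero
  have heq : xi =ᶠ[𝓝 s] fun s => s * (s - 1) * (((Real.pi : ℂ) ^ (-s / 2) * Gamma (s / 2)) *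
      riemannZeta s) := by
    have : {s : ℂ | 1 < s.re} ∈ 𝓝 s := (isOpen_lt continuous_const continuous_re).mem_nhds hs
    filter_upwards [this] with w hw
    have hw' : 1 < w.re := hw
    rw [xi_eq_zeta (by linarith) (fun h => by rw [h] at hw'; simp at hw'), Gammaℝ_def]
  have hd1 : HasDerivAt (fun s : ℂ => (Real.pi : ℂ) ^ (-s / 2))
      ((Real.pi : ℂ) ^ (-s / 2) * (-(Real.log Real.pi : ℂ) / 2)) s := by
    have := ((hasDerivAt_id s).fun_neg.div_const 2).const_cpow (c := (Real.pi : ℂ)) (Or.inl hpi)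
    refine this.congr_deriv ?_
    rw [ofReal_log Real.pi_pos.le]
    simp only [id]
    ring
  have hΓd : DifferentiableAt ℂ Gamma (s / 2) := differentiableAt_Gamma _ (fun m h => by
    have := congrArg re h
    simp at this
    linarith [(Nat.cast_nonneg m : (0 : ℝ) ≤ m)])
  have hd2 : HasDerivAt (fun s : ℂ => Gamma (s / 2)) (deriv Gamma (s / 2) * (1 / 2)) s :=
    hΓd.hasDerivAt.comp s ((hasDerivAt_id s).div_const 2)
  have hd3 := (differentiableAt_riemannZeta hs1).hasDerivAt
  have hd4 : HasDerivAt (fun s : ℂ => s * (s - 1)) (1 * (s - 1) + s * 1) s :=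
    (hasDerivAt_id s).fun_mul ((hasDerivAt_id s).sub_const 1)
  have hd := hd4.fun_mul ((hd1.fun_mul hd2).fun_mul hd3)
  have hdig : digamma (s / 2 + 1) = digamma (s / 2) + (s / 2)⁻¹ :=
    digamma_apply_add_one _ (fun m h => by
      have := congrArg re h
      simp at this
      linarith [(Nat.cast_nonneg m : (0 : ℝ) ≤ m)])
  rw [LSeries_vonMangoldt_eq_deriv_riemannZeta_div hs, archTerm, hdig, digamma_def, logDeriv_apply,
    logDeriv_apply, heq.deriv_eq, heq.eq_of_nhds, hd.deriv]
  have hs2 : s - 1 ≠ 0 := sub_ne_zero.2 hs1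
  have hp : (Real.pi : ℂ) ^ (-s / 2) ≠ 0 := by simp [cpow_eq_zero_iff, hpi]
  field_simp
  ring

theorem weighted_vonMangoldt_nonneg {κ : Type*} (I : Finset κ) (w : κ → ℝ) (s : κ → ℂ)
    (hs : ∀ i ∈ I, 1 < (s i).re)
    (hP : ∀ u : ℝ, 0 ≤ u → 0 ≤ ∑ i ∈ I, w i * (Real.exp (-(s i).re * u) * Real.cos ((s i).im * u))) :
    0 ≤ ∑ i ∈ I, w i * (LSeries ↗Λ (s i)).re := by
  have hsum : HasSum (fun n : ℕ => ∑ i ∈ I, w i * (LSeries.term ↗Λ (s i) n).re)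
      (∑ i ∈ I, w i * (LSeries ↗Λ (s i)).re) := by
    refine hasSum_sum fun i hi => ?_
    exact (hasSum_re (LSeriesSummable_vonMangoldt (hs i hi)).hasSum).mul_left _
  refine hsum.nonneg fun n => ?_
  rcases Nat.eq_zero_or_pos n with rfl | hn
  · simp
  have hn' : (0 : ℝ) < n := Nat.cast_pos.2 hn
  have hterm : ∀ i, (LSeries.term ↗Λ (s i) n).re =
      Λ n * (Real.exp (-(s i).re * Real.log n) * Real.cos ((s i).im * Real.log n)) := by
    intro i
    rw [LSeries.term_of_ne_zero hn.ne', div_eq_mul_inv, ← cpow_neg, re_ofReal_mul,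
      cpow_def_of_ne_zero (Nat.cast_ne_zero.2 hn.ne'), exp_re]
    have h1 : log (n : ℂ) = (Real.log n : ℝ) := (natCast_log).symm
    rw [h1]
    simp only [re_ofReal_mul, im_ofReal_mul, neg_re, neg_im]
    rw [show Real.log n * -(s i).im = -((s i).im * Real.log n) by ring, Real.cos_neg]
    congr 3
    ring
  simp only [hterm]
  have := mul_nonneg (vonMangoldt_nonneg (n := n)) (hP (Real.log n) (Real.log_natCast_nonneg n))
  rw [Finset.mul_sum] at this
  refine this.trans (le_of_eq (Finset.sum_congr rfl fun i _ => by ring))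

/-- The archimedean term is close to `log (y / 2π) / 2`. -/
theorem archTerm_re_bounds {s : ℂ} (hs : 1 < s.re) (hy : 0 < s.im) :
    Real.log (s.im / (2 * Real.pi)) / 2 - (1 + 2 / s.im) / (3 * s.im ^ 2) ≤ (archTerm s).re ∧
    (archTerm s).re ≤ Real.log (s.im / (2 * Real.pi)) / 2 + (1 + 2 / s.im) / (3 * s.im ^ 2)
      + (s.re ^ 2 / 4 + 2 * s.re) / s.im ^ 2 := by
  set σ := s.re with hσ
  set y := s.im with hydef
  set z := s / 2 + 1 with hz
  have hzre : z.re = (σ + 2) / 2 := by simp [hz, hσ]; ring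
  have hzim : z.im = y / 2 := by simp [hz, hydef]
  have hz0 : z ≠ 0 := fun h => by rw [h] at hzre; simp at hzre; linarith
  have hmain := norm_digamma_sub_log_le (z := z) (by rw [hzre]; linarith) (by rw [hzim]; linarith)
  have h1 := abs_le.1 ((abs_re_le_norm _).trans hmain)
  have hN : normSq z = ((σ + 2) ^ 2 + y ^ 2) / 4 := by
    rw [normSq_apply, hzre, hzim]; ring
  have hinv : (1 / (2 * z)).re = (σ + 2) / ((σ + 2) ^ 2 + y ^ 2) := by
    rw [one_div, mul_inv, show (2 : ℂ)⁻¹ = ((2⁻¹ : ℝ) : ℂ) by push_cast; rfl, re_ofReal_mul, inv_re,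
      hN, hzre]
    field_simp
    norm_num
  have hpole : (1 / (s - 1)).re = (σ - 1) / ((σ - 1) ^ 2 + y ^ 2) := by
    rw [one_div, inv_re, normSq_apply]
    simp only [sub_re, one_re, sub_im, one_im, sub_zero, ← hσ, ← hydef]
    congr 1; ring
  set v := (σ + 2) ^ 2 / y ^ 2 with hv
  have hv0 : 0 ≤ v := by positivity
  have hlog : (log z).re = Real.log (y / 2) + Real.log (1 + v) / 2 := by
    rw [log_re]
    have h2 : ‖z‖ ^ 2 = (y / 2) ^ 2 * (1 + v) := by
      rw [← normSq_eq_norm_sq, hN, hv]; field_simp; ring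
    have h3 : 2 * Real.log ‖z‖ = 2 * Real.log (y / 2) + Real.log (1 + v) := by
      have := congrArg Real.log h2
      rw [Real.log_mul (by positivity) (by positivity), Real.log_pow, Real.log_pow] at this
      exact_mod_cast this
    linarith
  have hlog2 : Real.log (1 + v) ≤ v := by
    have := Real.log_le_sub_one_of_pos (show 0 < 1 + v by linarith)
    linarith
  have hlog3 : v / (1 + v) ≤ Real.log (1 + v) := by
    have := Real.one_sub_inv_le_log_of_pos (show 0 < 1 + v by linarith)
    refine le_trans (le_of_eq ?_) this
    field_simp
    ring
  have hre : (archTerm s).re = (σ - 1) / ((σ - 1) ^ 2 + y ^ 2) + (digamma z).re / 2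
      - Real.log Real.pi / 2 := by
    rw [archTerm, sub_re, add_re, hpole, ← hz]
    have e1 : (digamma z / 2).re = (digamma z).re / 2 := by
      rw [show (2 : ℂ) = ((2 : ℝ) : ℂ) by norm_num, div_ofReal_re]
    have e2 : ((Real.log Real.pi : ℂ) / 2).re = Real.log Real.pi / 2 := by
      rw [show (2 : ℂ) = ((2 : ℝ) : ℂ) by norm_num, div_ofReal_re, ofReal_re]
    rw [e1, e2]
  have hsplit : Real.log (y / (2 * Real.pi)) = Real.log (y / 2) - Real.log Real.pi := by
    rw [← div_div, Real.log_div (by positivity) Real.pi_ne_zero]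
  have he : 1 / 6 * (1 / z.im ^ 3 + 1 / z.im ^ 2) = 2 * ((1 + 2 / y) / (3 * y ^ 2)) := by
    rw [hzim]; field_simp; ring
  rw [he] at h1
  simp only [sub_re, hinv, hlog] at h1
  have hq : (σ + 2) / ((σ + 2) ^ 2 + y ^ 2) = v / (1 + v) / (σ + 2) := by
    rw [hv]
    have : σ + 2 ≠ 0 := by linarith
    field_simp
    ring
  have hq1 : (σ + 2) / ((σ + 2) ^ 2 + y ^ 2) ≤ v / (1 + v) / 3 := by
    rw [hq]
    gcongr
    linarith
  have hq0 : 0 ≤ (σ + 2) / ((σ + 2) ^ 2 + y ^ 2) := by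
    have : 0 < σ + 2 := by linarith
    positivity
  have hvv : 0 ≤ v / (1 + v) := by positivity
  have hp0 : 0 ≤ (σ - 1) / ((σ - 1) ^ 2 + y ^ 2) := by
    have : 0 < σ - 1 := by linarith
    positivity
  have hp1 : (σ - 1) / ((σ - 1) ^ 2 + y ^ 2) ≤ (σ - 1) / y ^ 2 := by
    have : 0 < σ - 1 := by linarith
    gcongr
    nlinarith
  have hend : v / 4 + (σ - 1) / y ^ 2 = (σ ^ 2 / 4 + 2 * σ) / y ^ 2 := by
    rw [hv]; field_simp; ring
  rw [hre, hsplit]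
  constructor <;> linarith [h1.1, h1.2]

end

section

open Filter Topology MeasureTheory

/-- The (unnormalised) Poisson kernel of the half plane, the real part of `1 / (x + iy)`. -/
def hker (x y : ℝ) : ℝ := x / (x ^ 2 + y ^ 2)

theorem hker_nonneg {x : ℝ} (hx : 0 ≤ x) (y : ℝ) : 0 ≤ hker x y := by
  unfold hker; positivity

theorem continuous_hker {x : ℝ} (hx : 0 < x) : Continuous (hker x) := by
  unfold hker
  refine continuous_const.div (by fun_prop) fun y => by positivity

theorem tendsto_log_ratio {l : Filter ℝ} (hl : Tendsto (fun v : ℝ => v⁻¹) l (𝓝 0))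
    (hl0 : ∀ᶠ v in l, v ≠ 0) {A X : ℝ} (hA : 0 < A) (hX : 0 < X) (y : ℝ) :
    Tendsto (fun v : ℝ => Real.log (A ^ 2 + v ^ 2) - Real.log (X ^ 2 + (v - y) ^ 2)) l (𝓝 0) := by
  have h1 : Tendsto (fun v : ℝ => (A ^ 2 * v⁻¹ ^ 2 + 1) / (X ^ 2 * v⁻¹ ^ 2 + (1 - y * v⁻¹) ^ 2)) l
      (𝓝 ((A ^ 2 * 0 ^ 2 + 1) / (X ^ 2 * 0 ^ 2 + (1 - y * 0) ^ 2))) :=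
    (((hl.pow 2).const_mul _).add_const 1).div
      (((hl.pow 2).const_mul _).add (((hl.const_mul y).const_sub 1).pow 2)) (by norm_num)
  have h2 := h1.log (by norm_num)
  norm_num at h2
  refine h2.congr' ?_
  filter_upwards [hl0] with v hv
  rw [← Real.log_div (by positivity) (by positivity)]
  congr 1
  have : X ^ 2 + (v - y) ^ 2 ≠ 0 := by positivity
  field_simp

theorem integrable_hker_mul {A X : ℝ} (hA : 0 < A) (hX : 0 < X) (y : ℝ) :
    Integrable fun v => hker A v * hker X (y - v) := by
  have hInt : Integrable fun v => hker A v := by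
    have h1 := (integrable_inv_one_add_sq.comp_div hA.ne').const_mul A⁻¹
    refine h1.congr (Eventually.of_forall fun v => ?_)
    simp only [hker]
    have : A ^ 2 + v ^ 2 ≠ 0 := by positivity
    field_simp
  refine hInt.mul_bdd (c := X⁻¹) ?_ ?_
  · exact ((continuous_hker hX).comp (by fun_prop)).aestronglyMeasurable
  · refine Eventually.of_forall fun v => ?_
    rw [Real.norm_of_nonneg (hker_nonneg hX.le _), hker, div_le_iff₀ (by positivity)]
    field_simp
    nlinarith [sq_nonneg (y - v)]

theorem integral_hker_mul {A X y : ℝ} (hA : 0 < A) (hX : 0 < X) (hy : y ≠ 0) :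
    ∫ v, hker A v * hker X (y - v) = Real.pi * hker (X + A) y := by
  set N := ((X + A) ^ 2 + y ^ 2) * ((X - A) ^ 2 + y ^ 2) with hN
  have hy2 : 0 < y ^ 2 := by positivity
  have hNpos : 0 < N := by positivity
  set Φ : ℝ → ℝ := fun v => A * X * y / N * (Real.log (A ^ 2 + v ^ 2) - Real.log (X ^ 2 + (v - y) ^ 2))
    + X * (X ^ 2 - A ^ 2 + y ^ 2) / N * Real.arctan (v / A)
    + A * (A ^ 2 - X ^ 2 + y ^ 2) / N * Real.arctan ((v - y) / X) with hΦ
  have hd : ∀ v, HasDerivAt Φ (hker A v * hker X (y - v)) v := by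
    intro v
    have p1 : (A ^ 2 + v ^ 2) ≠ 0 := by positivity
    have p2 : (X ^ 2 + (v - y) ^ 2) ≠ 0 := by positivity
    have l1 : HasDerivAt (fun v : ℝ => A ^ 2 + v ^ 2) (2 * v) v := by
      simpa using (hasDerivAt_pow 2 v).const_add (A ^ 2)
    have l2 : HasDerivAt (fun v : ℝ => X ^ 2 + (v - y) ^ 2) (2 * (v - y)) v := by
      simpa using (((hasDerivAt_id v).sub_const y).fun_pow 2).const_add (X ^ 2)
    have l3 := ((hasDerivAt_id v).div_const A).arctan
    have l4 := (((hasDerivAt_id v).sub_const y).div_const X).arctan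
    refine (((((l1.log p1).fun_sub (l2.log p2)).const_mul (A * X * y / N)).fun_add
      (l3.const_mul (X * (X ^ 2 - A ^ 2 + y ^ 2) / N))).fun_add
      (l4.const_mul (A * (A ^ 2 - X ^ 2 + y ^ 2) / N))).congr_deriv ?_
    simp only [hker, id]
    have q1 : 1 + (v / A) ^ 2 = (A ^ 2 + v ^ 2) / A ^ 2 := by field_simp
    have q2 : 1 + ((v - y) / X) ^ 2 = (X ^ 2 + (v - y) ^ 2) / X ^ 2 := by field_simp
    have q3 : X ^ 2 + (y - v) ^ 2 = X ^ 2 + (v - y) ^ 2 := by ring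
    rw [q1, q2, q3]
    field_simp
    rw [hN]
    ring
  have htop : Tendsto Φ atTop (𝓝 (A * X * y / N * 0 + X * (X ^ 2 - A ^ 2 + y ^ 2) / N * (Real.pi / 2)
      + A * (A ^ 2 - X ^ 2 + y ^ 2) / N * (Real.pi / 2))) := by
    refine (((tendsto_log_ratio tendsto_inv_atTop_zero (eventually_ne_atTop 0) hA hX y).const_mul
      _).add (Tendsto.const_mul _ ?_)).add (Tendsto.const_mul _ ?_)
    · exact (tendsto_nhds_of_tendsto_nhdsWithin Real.tendsto_arctan_atTop).comp
        (tendsto_id.atTop_div_const hA)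
    · exact (tendsto_nhds_of_tendsto_nhdsWithin Real.tendsto_arctan_atTop).comp
        ((tendsto_atTop_add_const_right _ (-y) tendsto_id).atTop_div_const hX)
  have hbot : Tendsto Φ atBot (𝓝 (A * X * y / N * 0
      + X * (X ^ 2 - A ^ 2 + y ^ 2) / N * (-(Real.pi / 2))
      + A * (A ^ 2 - X ^ 2 + y ^ 2) / N * (-(Real.pi / 2)))) := by
    refine (((tendsto_log_ratio tendsto_inv_atBot_zero (eventually_ne_atBot 0) hA hX y).const_mul
      _).add (Tendsto.const_mul _ ?_)).add (Tendsto.const_mul _ ?_)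
    · exact (tendsto_nhds_of_tendsto_nhdsWithin Real.tendsto_arctan_atBot).comp
        (tendsto_id.atBot_div_const hA)
    · exact (tendsto_nhds_of_tendsto_nhdsWithin Real.tendsto_arctan_atBot).comp
        ((tendsto_atBot_add_const_right _ (-y) tendsto_id).atBot_div_const hX)
  rw [integral_of_hasDerivAt_of_tendsto hd (integrable_hker_mul hA hX y) hbot htop, hker, hN]
  have : (X + A) ^ 2 + y ^ 2 ≠ 0 := by positivity
  have : (X - A) ^ 2 + y ^ 2 ≠ 0 := by positivity
  field_simp
  ring

theorem sum_hker_add_nonneg {ι κ : Type*} (I : Finset ι) (J : Finset κ) (w X : ι → ℝ) (p a : κ → ℝ)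
    (hX : ∀ i ∈ I, 0 < X i) (ha : ∀ m ∈ J, 0 < a m)
    (hU : ∀ y, 0 ≤ ∑ i ∈ I, w i * hker (X i) y) (hM : ∀ v, 0 ≤ ∑ m ∈ J, p m * hker (a m) v) (y : ℝ) :
    0 ≤ ∑ i ∈ I, ∑ m ∈ J, w i * p m * hker (X i + a m) y := by
  have hne : ∀ y : ℝ, y ≠ 0 → 0 ≤ ∑ i ∈ I, ∑ m ∈ J, w i * p m * hker (X i + a m) y := by
    intro y hy
    have h1 : 0 ≤ ∫ v, (∑ m ∈ J, p m * hker (a m) v) * ∑ i ∈ I, w i * hker (X i) (y - v) :=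
      integral_nonneg fun v => mul_nonneg (hM v) (hU _)
    have h2 : ∫ v, (∑ m ∈ J, p m * hker (a m) v) * ∑ i ∈ I, w i * hker (X i) (y - v)
        = Real.pi * ∑ i ∈ I, ∑ m ∈ J, w i * p m * hker (X i + a m) y := by
      have h3 : ∀ v, (∑ m ∈ J, p m * hker (a m) v) * ∑ i ∈ I, w i * hker (X i) (y - v)
          = ∑ i ∈ I, ∑ m ∈ J, w i * p m * (hker (a m) v * hker (X i) (y - v)) := by
        intro v
        rw [Finset.sum_mul_sum, Finset.sum_comm]
        refine Finset.sum_congr rfl fun i _ => Finset.sum_congr rfl fun m _ => by ring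
      simp only [h3]
      rw [integral_finsetSum _ fun i hi => integrable_finsetSum _ fun m hm =>
        (integrable_hker_mul (ha m hm) (hX i hi) y).const_mul _, Finset.mul_sum]
      refine Finset.sum_congr rfl fun i hi => ?_
      rw [integral_finsetSum _ fun m hm => (integrable_hker_mul (ha m hm) (hX i hi) y).const_mul _,
        Finset.mul_sum]
      refine Finset.sum_congr rfl fun m hm => ?_
      rw [integral_const_mul, integral_hker_mul (ha m hm) (hX i hi) hy]
      ring
    rw [h2] at h1
    exact nonneg_of_mul_nonneg_right h1 Real.pi_pos
  by_cases hy : y = 0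
  · subst hy
    have hc : Continuous fun y => ∑ i ∈ I, ∑ m ∈ J, w i * p m * hker (X i + a m) y :=
      continuous_finsetSum _ fun i hi => continuous_finsetSum _ fun m hm =>
        continuous_const.mul (continuous_hker (add_pos (hX i hi) (ha m hm)))
    have ht : Tendsto (fun y => ∑ i ∈ I, ∑ m ∈ J, w i * p m * hker (X i + a m) y) (𝓝[≠] 0)
        (𝓝 (∑ i ∈ I, ∑ m ∈ J, w i * p m * hker (X i + a m) 0)) :=
      (hc.tendsto 0).mono_left nhdsWithin_le_nhds
    refine ge_of_tendsto ht ?_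
    filter_upwards [self_mem_nhdsWithin] with y hy using hne y hy
  · exact hne y hy

end

section

open Filter Topology MeasureTheory Complex
open scoped ComplexConjugate

theorem pairKernel_eq_hker (s ρ : ℂ) :
    pairKernel s ρ = hker (s.re - ρ.re) (s.im - ρ.im) + hker (s.re - 1 + ρ.re) (s.im - ρ.im) := by
  unfold pairKernel hker
  rw [one_div, one_div, inv_re, inv_re, normSq_apply, normSq_apply]
  simp only [sub_re, sub_im, one_re, one_im, conj_re, conj_im]
  congr 2 <;> ring

/-- Coefficients of the damping factor `E(u) = 1 - (54/49) e^{-qu} + (30/49) e^{-3qu/2}`. -/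
def dampCoeff : Fin 3 → ℝ := ![1, -54 / 49, 30 / 49]

/-- Exponents of the damping factor for `q = 1`. -/
def dampExp : Fin 3 → ℝ := ![0, 1, 3 / 2]

theorem damp_polynomial_nonneg {P Y : ℝ} (hP : 0 ≤ P) (hP4 : P ≤ 1 / 4) (hY : 0 ≤ Y) :
    0 ≤ (121 / 112 * Y ^ 2 + 33 / 112 * Y ^ 3 - 9 / 14 * Y ^ 4 + 1 / 7 * Y ^ 5)
      + P * (225 / 4 + 28393 / 112 * Y + 11687 / 112 * Y ^ 2 - 74 / 7 * Y ^ 3 - 3 / 7 * Y ^ 4)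
      + P ^ 2 * (30 + 13791 / 112 * Y + 155 / 7 * Y ^ 2 + 2 / 7 * Y ^ 3)
      + P ^ 3 * (-167 / 112 - 10 * Y + 2 / 7 * Y ^ 2) + P ^ 4 * (-13 / 14 - 3 / 7 * Y)
      + P ^ 5 * (1 / 7) := by
  have hhigh : 0 ≤ P ^ 2 * (30 + 13791 / 112 * Y + 155 / 7 * Y ^ 2 + 2 / 7 * Y ^ 3)
      + P ^ 3 * (-167 / 112 - 10 * Y + 2 / 7 * Y ^ 2) + P ^ 4 * (-13 / 14 - 3 / 7 * Y)
      + P ^ 5 * (1 / 7) := by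
    have h : 0 ≤ (30 + 13791 / 112 * Y + 155 / 7 * Y ^ 2 + 2 / 7 * Y ^ 3)
      + P * (-167 / 112 - 10 * Y + 2 / 7 * Y ^ 2) + P ^ 2 * (-13 / 14 - 3 / 7 * Y)
      + P ^ 3 * (1 / 7) := by
      have h1 : P * (167 / 112 + 10 * Y) ≤ 1 / 4 * (167 / 112 + 10 * Y) := by gcongr
      have h2 : P ^ 2 * (13 / 14 + 3 / 7 * Y) ≤ 1 * (13 / 14 + 3 / 7 * Y) := by
        gcongr; nlinarith
      have h3 : 0 ≤ P * Y ^ 2 := by positivity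
      have h4 : 0 ≤ P ^ 3 := by positivity
      have h5 : 0 ≤ Y ^ 2 := by positivity
      have h6 : 0 ≤ Y ^ 3 := by positivity
      nlinarith
    have := mul_nonneg (sq_nonneg P) h
    linarith [this]
  have hlow : 0 ≤ (121 / 112 * Y ^ 2 + 33 / 112 * Y ^ 3 - 9 / 14 * Y ^ 4 + 1 / 7 * Y ^ 5)
      + P * (225 / 4 + 28393 / 112 * Y + 11687 / 112 * Y ^ 2 - 74 / 7 * Y ^ 3 - 3 / 7 * Y ^ 4) := by
    have h0 : 121 / 112 * Y ^ 2 + 33 / 112 * Y ^ 3 - 9 / 14 * Y ^ 4 + 1 / 7 * Y ^ 5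
        = 1 / 7 * (Y ^ 2 * (Y - 11 / 4) ^ 2 * (Y + 1)) := by ring
    rcases le_total Y 8 with h8 | h8
    · have h1 : 0 ≤ 225 / 4 + 28393 / 112 * Y + 11687 / 112 * Y ^ 2 - 74 / 7 * Y ^ 3
          - 3 / 7 * Y ^ 4 := by
        have e2 : Y ^ 3 ≤ 8 * Y ^ 2 := by nlinarith [sq_nonneg Y]
        have e3 : Y ^ 4 ≤ 64 * Y ^ 2 := by nlinarith [sq_nonneg Y]
        have e4 : Y ^ 2 ≤ 8 * Y := by nlinarith
        nlinarith
      have h2 : 0 ≤ 1 / 7 * (Y ^ 2 * (Y - 11 / 4) ^ 2 * (Y + 1)) := by positivity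
      rw [h0]
      have := mul_nonneg hP h1
      linarith
    · have h3 : P * (74 / 7 * Y ^ 3 + 3 / 7 * Y ^ 4) ≤ 1 / 4 * (74 / 7 * Y ^ 3 + 3 / 7 * Y ^ 4) := by
        gcongr
      have h4 : 0 ≤ P * (225 / 4 + 28393 / 112 * Y + 11687 / 112 * Y ^ 2) := by positivity
      have h5 : 1 / 4 * (74 / 7 * Y ^ 3 + 3 / 7 * Y ^ 4)
          ≤ 1 / 7 * (Y ^ 2 * (Y - 11 / 4) ^ 2 * (Y + 1)) := by
        obtain ⟨x, rfl⟩ : ∃ x, Y = 8 + x := ⟨Y - 8, by ring⟩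
        have hx : 0 ≤ x := by linarith
        have : 0 ≤ (8 + x) ^ 2 * (1 / 7 * ((8 + x - 11 / 4) ^ 2 * (8 + x + 1))
          - 1 / 4 * (74 / 7 * (8 + x) + 3 / 7 * (8 + x) ^ 2)) := by
          refine mul_nonneg (by positivity) ?_
          ring_nf
          positivity
        nlinarith
      rw [h0]
      nlinarith
  linarith

theorem damp_kernel_nonneg_unit {x : ℝ} (hx : 0 < x) (hx1 : x < 1) (y : ℝ) :
    0 ≤ ∑ j, dampCoeff j * (hker (x + dampExp j) y + hker (1 - x + dampExp j) y) := by
  simp only [Fin.sum_univ_three, dampCoeff, dampExp, hker, Matrix.cons_val_zero, Matrix.cons_val_one,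
    Matrix.cons_val]
  set Y := y ^ 2 with hY
  have hY0 : 0 ≤ Y := sq_nonneg y
  have hx' : 0 < 1 - x := by linarith
  set P := x * (1 - x) with hP
  have hP0 : 0 < P := mul_pos hx hx'
  have hP4 : P ≤ 1 / 4 := by nlinarith [sq_nonneg (x - 1 / 2)]
  have hcomb : ∀ d : ℝ, 0 ≤ d → (x + d) / ((x + d) ^ 2 + Y) + (1 - x + d) / ((1 - x + d) ^ 2 + Y)
      = (1 + 2 * d) * (P + d + d ^ 2 + Y) / ((P + d + d ^ 2) ^ 2
        + Y * ((1 + 2 * d) ^ 2 - 2 * (P + d + d ^ 2)) + Y ^ 2) := by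
    intro d hd
    have h1 : 0 < (x + d) ^ 2 + Y := by positivity
    have h2 : 0 < (1 - x + d) ^ 2 + Y := by positivity
    have h3 : (P + d + d ^ 2) ^ 2 + Y * ((1 + 2 * d) ^ 2 - 2 * (P + d + d ^ 2)) + Y ^ 2
        = ((x + d) ^ 2 + Y) * ((1 - x + d) ^ 2 + Y) := by rw [hP]; ring
    rw [h3, div_add_div _ _ h1.ne' h2.ne']
    congr 1
    rw [hP]; ring
  have hpos : ∀ d : ℝ, 0 ≤ d → 0 < (P + d + d ^ 2) ^ 2
        + Y * ((1 + 2 * d) ^ 2 - 2 * (P + d + d ^ 2)) + Y ^ 2 := by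
    intro d hd
    have : 0 ≤ (1 + 2 * d) ^ 2 - 2 * (P + d + d ^ 2) := by nlinarith
    positivity
  rw [hcomb 0 le_rfl, hcomb 1 zero_le_one, hcomb (3 / 2) (by norm_num)]
  have d0 := hpos 0 le_rfl
  have d1 := hpos 1 zero_le_one
  have d2 := hpos (3 / 2) (by norm_num)
  have key := damp_polynomial_nonneg hP0.le hP4 hY0
  rw [← mul_div_assoc, ← mul_div_assoc, ← mul_div_assoc, div_add_div _ _ d0.ne' d1.ne',
    div_add_div _ _ (mul_pos d0 d1).ne' d2.ne']
  refine div_nonneg (key.trans (le_of_eq ?_)) (by positivity)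
  ring

theorem damp_kernel_nonneg {X X' q : ℝ} (hX : 0 < X) (hX' : 0 < X') (hq : X + X' = q) (y : ℝ) :
    0 ≤ ∑ j, dampCoeff j * (hker (X + q * dampExp j) y + hker (X' + q * dampExp j) y) := by
  have hq0 : 0 < q := by linarith
  have hscale : ∀ x d : ℝ, hker (x + q * d) y = q⁻¹ * hker (x / q + d) (y / q) := by
    intro x d
    unfold hker
    have : (x / q + d) ^ 2 + (y / q) ^ 2 = ((x + q * d) ^ 2 + y ^ 2) / q ^ 2 := by
      field_simp
    rw [this]
    field_simp
  have h := damp_kernel_nonneg_unit (x := X / q) (div_pos hX hq0)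
    ((div_lt_one hq0).2 (by linarith)) (y / q)
  have hX'q : 1 - X / q = X' / q := by field_simp; linarith
  rw [hX'q] at h
  have h2 := mul_nonneg (inv_nonneg.2 hq0.le) h
  rw [Finset.mul_sum] at h2
  refine h2.trans (le_of_eq (Finset.sum_congr rfl fun j _ => ?_))
  rw [hscale X, hscale X']
  ring

theorem damp_pairKernel_nonneg {κ : Type*} (J : Finset κ) (p a : κ → ℝ) (ha : ∀ m ∈ J, 0 < a m)
    (hM : ∀ v, 0 ≤ ∑ m ∈ J, p m * hker (a m) v) {η : ℝ} {ρ : ℂ} (h1 : η < ρ.re) (h2 : ρ.re < 1 - η)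
    (Y : ℝ) :
    0 ≤ ∑ j, ∑ m ∈ J, dampCoeff j * p m *
      pairKernel ⟨1 - η + a m + (1 - 2 * η) * dampExp j, Y⟩ ρ := by
  have hE : ∀ j, 0 ≤ dampExp j := by
    intro j; fin_cases j <;> norm_num [dampExp]
  set X : Fin 3 × Bool → ℝ := fun i => (bif i.2 then 1 - η - ρ.re else ρ.re - η)
    + (1 - 2 * η) * dampExp i.1 with hX
  have h := sum_hker_add_nonneg Finset.univ J (fun i : Fin 3 × Bool => dampCoeff i.1) X p a
    (fun i _ => by
      have := mul_nonneg (show 0 ≤ 1 - 2 * η by linarith) (hE i.1)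
      rcases i with ⟨j, _ | _⟩ <;> simp only [hX, cond_true, cond_false] <;>
      simp only at this <;> linarith) ha
    (fun y => by
      have := damp_kernel_nonneg (X := 1 - η - ρ.re) (X' := ρ.re - η) (q := 1 - 2 * η)
        (by linarith) (by linarith) (by ring) y
      rw [Fintype.sum_prod_type]
      refine this.trans (le_of_eq (Finset.sum_congr rfl fun j _ => ?_))
      simp [hX]
      ring) hM (Y - ρ.im)
  rw [Fintype.sum_prod_type] at h
  refine h.trans (le_of_eq (Finset.sum_congr rfl fun j _ => ?_))
  rw [Fintype.sum_bool, ← Finset.sum_add_distrib]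
  refine Finset.sum_congr rfl fun m _ => ?_
  rw [pairKernel_eq_hker, mul_add]
  simp only [hX, cond_true, cond_false]
  congr 3 <;> ring

theorem pairKernel_sum_nonneg {κ : Type*} (J : Finset κ) (p a : κ → ℝ) (ha : ∀ m ∈ J, 0 < a m)
    (hM : ∀ v, 0 ≤ ∑ m ∈ J, p m * hker (a m) v) {η : ℝ} {ρ : ℂ} (h1 : η < ρ.re) (h2 : ρ.re < 1 - η)
    (Y : ℝ) :
    0 ≤ ∑ m ∈ J, p m * pairKernel ⟨1 - η + a m, Y⟩ ρ := by
  set X : Bool → ℝ := fun i => (bif i then 1 - η - ρ.re else ρ.re - η) with hX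
  have hXpos : ∀ i, 0 < X i := by
    intro i
    rcases i with _ | _ <;> simp only [hX, cond_true, cond_false] <;> linarith
  have h := sum_hker_add_nonneg Finset.univ J (fun _ : Bool => 1) X p a
    (fun i _ => hXpos i) ha
    (fun y => Finset.sum_nonneg fun i _ => by
      rw [one_mul]; exact hker_nonneg (hXpos i).le y) hM (Y - ρ.im)
  refine h.trans (le_of_eq ?_)
  rw [Fintype.sum_bool, ← Finset.sum_add_distrib]
  refine Finset.sum_congr rfl fun m _ => ?_
  rw [pairKernel_eq_hker, mul_add, one_mul]
  simp only [hX, cond_true, cond_false]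
  congr 3 <;> ring

end

section

open Filter Topology Complex ArithmeticFunction
open scoped LSeries.notation

/-- `trigZero + ∑ k, trigCoeff k * cos ((k + 1) θ) = 8 (9/10 + cos θ)² (3/10 + cos θ)²`. -/
def trigZero : ℝ := 11.5032

/-- The non-constant coefficients of the trigonometric polynomial. -/
def trigCoeff : Fin 4 → ℝ := ![19.584, 11.92, 4.8, 1]

theorem trig_nonneg (θ : ℝ) : 0 ≤ trigZero + ∑ k, trigCoeff k * Real.cos (((k : ℕ) + 1 : ℝ) * θ) := by
  have h : trigZero + ∑ k, trigCoeff k * Real.cos (((k : ℕ) + 1 : ℝ) * θ)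
      = 8 * (0.9 + Real.cos θ) ^ 2 * (0.3 + Real.cos θ) ^ 2 := by
    simp only [Fin.sum_univ_four, trigZero, trigCoeff, Matrix.cons_val_zero, Matrix.cons_val_one,
      Matrix.cons_val]
    have h2 : Real.cos (((((1 : Fin 4) : ℕ) : ℝ) + 1) * θ) = 2 * Real.cos θ ^ 2 - 1 := by
      rw [← Real.cos_two_mul]; norm_num
    have h3 : Real.cos (((((2 : Fin 4) : ℕ) : ℝ) + 1) * θ) = 4 * Real.cos θ ^ 3 - 3 * Real.cos θ := by
      rw [← Real.cos_three_mul]; norm_num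
    have h4 : Real.cos (((((3 : Fin 4) : ℕ) : ℝ) + 1) * θ)
        = 2 * (2 * Real.cos θ ^ 2 - 1) ^ 2 - 1 := by
      rw [← Real.cos_two_mul, ← Real.cos_two_mul]; norm_num; ring_nf
    have h1 : Real.cos (((((0 : Fin 4) : ℕ) : ℝ) + 1) * θ) = Real.cos θ := by norm_num
    rw [h1, h2, h3, h4]
    ring
  rw [h]
  positivity

theorem damp_bounds {v : ℝ} (hv : 0 ≤ v) :
    0 ≤ ∑ j, dampCoeff j * Real.exp (-(dampExp j * v)) ∧
      ∑ j, dampCoeff j * Real.exp (-(dampExp j * v)) ≤ 1 := by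
  simp only [Fin.sum_univ_three, dampCoeff, dampExp, Matrix.cons_val_zero, Matrix.cons_val_one,
    Matrix.cons_val]
  set x := Real.exp (-(v / 2)) with hx
  have hx0 : 0 < x := Real.exp_pos _
  have hx1 : x ≤ 1 := Real.exp_le_one_iff.2 (by linarith)
  have e1 : Real.exp (-(1 * v)) = x ^ 2 := by rw [hx, ← Real.exp_nat_mul]; congr 1; push_cast; ring
  have e2 : Real.exp (-(3 / 2 * v)) = x ^ 3 := by
    rw [hx, ← Real.exp_nat_mul]; congr 1; push_cast; ring
  rw [e1, e2]
  have h3 : x ^ 3 ≤ x ^ 2 := by nlinarith [sq_nonneg x]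
  constructor
  · simp only [zero_mul, neg_zero, Real.exp_zero]
    nlinarith [sq_nonneg (x - 1), mul_nonneg hx0.le (sq_nonneg (x - 1)), sq_nonneg x]
  · simp only [zero_mul, neg_zero, Real.exp_zero]
    nlinarith [sq_nonneg x]

theorem main_inequality {κ : Type*} (J : Finset κ) (p a : κ → ℝ) {η t : ℝ} {ρ₀ : ℂ}
    (hf : ∀ u : ℝ, 0 ≤ u → 0 ≤ ∑ m ∈ J, p m * Real.exp (-(a m * u)))
    (ha : ∀ m ∈ J, η < a m) (hη2 : η < 1 / 2)
    (hK0 : ∀ ρ, xi ρ = 0 → 0 ≤ ∑ m ∈ J, p m * pairKernel ⟨1 - η + a m, 0⟩ ρ)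
    (hK : ∀ k : Fin 4, ∀ ρ, xi ρ = 0 → 0 ≤ ∑ j, ∑ m ∈ J, dampCoeff j * p m *
      pairKernel ⟨1 - η + a m + (1 - 2 * η) * dampExp j, ((k : ℕ) + 1 : ℝ) * t⟩ ρ)
    (h0 : xi ρ₀ = 0) (h2 : ρ₀.re ≠ 1 / 2) :
    trigCoeff 0 * ∑ j, ∑ m ∈ J, dampCoeff j * p m *
      pairKernel ⟨1 - η + a m + (1 - 2 * η) * dampExp j, t⟩ ρ₀ ≤
    trigZero * ∑ m ∈ J, p m * (archTerm ⟨1 - η + a m, 0⟩).re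
      + ∑ k : Fin 4, trigCoeff k * ∑ j, ∑ m ∈ J, dampCoeff j * p m *
        (archTerm ⟨1 - η + a m + (1 - 2 * η) * dampExp j, ((k : ℕ) + 1 : ℝ) * t⟩).re := by
  have hE : ∀ j, 0 ≤ dampExp j := by
    intro j; fin_cases j <;> norm_num [dampExp]
  have hb : ∀ k, 0 ≤ trigCoeff k := by
    intro k; fin_cases k <;> norm_num [trigCoeff]
  have hb0 : 0 ≤ trigZero := by norm_num [trigZero]
  have hre0 : ∀ m ∈ J, (1 : ℝ) < 1 - η + a m := fun m hm => by linarith [ha m hm]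
  have hre : ∀ j, ∀ m ∈ J, (1 : ℝ) < 1 - η + a m + (1 - 2 * η) * dampExp j := fun j m hm => by
    have := mul_nonneg (show 0 ≤ 1 - 2 * η by linarith) (hE j)
    linarith [ha m hm]
  -- the Dirichlet series side
  have hpos : 0 ≤ trigZero * ∑ m ∈ J, p m * (LSeries ↗Λ ⟨1 - η + a m, 0⟩).re
      + ∑ k : Fin 4, trigCoeff k * ∑ j, ∑ m ∈ J, dampCoeff j * p m *
        (LSeries ↗Λ ⟨1 - η + a m + (1 - 2 * η) * dampExp j, ((k : ℕ) + 1 : ℝ) * t⟩).re := by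
    have h := weighted_vonMangoldt_nonneg
      (J.disjSum ((Finset.univ : Finset (Fin 4)) ×ˢ (Finset.univ : Finset (Fin 3)) ×ˢ J))
      (Sum.elim (fun m => trigZero * p m)
        (fun i => trigCoeff i.1 * (dampCoeff i.2.1 * p i.2.2)))
      (Sum.elim (fun m => ⟨1 - η + a m, 0⟩)
        (fun i => ⟨1 - η + a i.2.2 + (1 - 2 * η) * dampExp i.2.1, ((i.1 : ℕ) + 1 : ℝ) * t⟩))
      (by
        intro i hi
        rcases i with m | ⟨k, j, m⟩
        · exact hre0 m (by simpa using hi)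
        · exact hre j m (by simpa using hi))
      (by
        intro u hu
        rw [Finset.sum_disjSum, Finset.sum_product]
        simp only [Finset.sum_product, Sum.elim_inl, Sum.elim_inr]
        obtain ⟨f, hfdef⟩ : ∃ f, f = ∑ m ∈ J, p m * Real.exp (-(a m * u)) := ⟨_, rfl⟩
        obtain ⟨E, hEdef⟩ : ∃ E, E = ∑ j, dampCoeff j * Real.exp (-(dampExp j * ((1 - 2 * η) * u))) :=
          ⟨_, rfl⟩
        obtain ⟨T, hT⟩ : ∃ T, T = ∑ k : Fin 4, trigCoeff k * Real.cos (((k : ℕ) + 1 : ℝ) * (t * u)) :=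
          ⟨_, rfl⟩
        have e1 : ∑ m ∈ J, trigZero * p m * (Real.exp (-(1 - η + a m) * u) * Real.cos (0 * u))
            = Real.exp (-(1 - η) * u) * f * trigZero := by
          rw [hfdef, Finset.mul_sum, Finset.sum_mul]
          refine Finset.sum_congr rfl fun m _ => ?_
          rw [zero_mul, Real.cos_zero,
            show -(1 - η + a m) * u = -(1 - η) * u + -(a m * u) by ring, Real.exp_add]
          ring
        have e2 : ∑ k : Fin 4, ∑ j, ∑ m ∈ J, trigCoeff k * (dampCoeff j * p m) *
            (Real.exp (-(1 - η + a m + (1 - 2 * η) * dampExp j) * u) *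
              Real.cos (((k : ℕ) + 1 : ℝ) * t * u)) = Real.exp (-(1 - η) * u) * f * (E * T) := by
          rw [hT, Finset.mul_sum, Finset.mul_sum]
          refine Finset.sum_congr rfl fun k _ => ?_
          rw [hEdef, Finset.sum_mul, Finset.mul_sum]
          refine Finset.sum_congr rfl fun j _ => ?_
          rw [hfdef, Finset.mul_sum, Finset.sum_mul]
          refine Finset.sum_congr rfl fun m _ => ?_
          rw [show -(1 - η + a m + (1 - 2 * η) * dampExp j) * u
            = -(1 - η) * u + -(a m * u) + -(dampExp j * ((1 - 2 * η) * u)) by ring,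
            Real.exp_add, Real.exp_add, mul_assoc _ t u]
          ring
        rw [e1, e2, ← mul_add]
        have hEb := damp_bounds (v := (1 - 2 * η) * u)
          (mul_nonneg (by linarith) hu)
        have hTb := trig_nonneg (t * u)
        rw [← hEdef] at hEb
        rw [← hT] at hTb
        refine mul_nonneg (mul_nonneg (Real.exp_pos _).le (hfdef ▸ hf u hu)) ?_
        have k1 := mul_nonneg hEb.1 hTb
        have k2 := mul_nonneg hb0 (sub_nonneg.2 hEb.2)
        nlinarith)
    rw [Finset.sum_disjSum, Finset.sum_product] at h
    simp only [Finset.sum_product, Sum.elim_inl, Sum.elim_inr] at h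
    refine h.trans (le_of_eq ?_)
    simp only [Finset.mul_sum, mul_assoc]
  -- the zeros side
  have hxi : ∀ σ y : ℝ, 1 < σ → xi ⟨σ, y⟩ ≠ 0 := fun σ y h =>
    xi_ne_zero_of_one_le_re (by simpa using h.le)
  have hZ0 : 0 ≤ ∑ m ∈ J, p m * (logDeriv xi ⟨1 - η + a m, 0⟩).re :=
    weighted_sum_nonneg J p _ (fun m hm => hxi _ _ (hre0 m hm)) hK0
  have hZ : ∀ k : Fin 4, 0 ≤ ∑ j, ∑ m ∈ J, dampCoeff j * p m *
      (logDeriv xi ⟨1 - η + a m + (1 - 2 * η) * dampExp j, ((k : ℕ) + 1 : ℝ) * t⟩).re := by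
    intro k
    have := weighted_sum_nonneg ((Finset.univ : Finset (Fin 3)) ×ˢ J)
      (fun i => dampCoeff i.1 * p i.2)
      (fun i => ⟨1 - η + a i.2 + (1 - 2 * η) * dampExp i.1, ((k : ℕ) + 1 : ℝ) * t⟩)
      (fun i hi => hxi _ _ (hre i.1 i.2 (by simpa using hi)))
      (fun ρ hρ => by rw [Finset.sum_product]; exact hK k ρ hρ)
    rwa [Finset.sum_product] at this
  have hZ1 : ∑ j, ∑ m ∈ J, dampCoeff j * p m *
      pairKernel ⟨1 - η + a m + (1 - 2 * η) * dampExp j, t⟩ ρ₀ ≤ ∑ j, ∑ m ∈ J, dampCoeff j * p m *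
      (logDeriv xi ⟨1 - η + a m + (1 - 2 * η) * dampExp j, t⟩).re := by
    have hk0 := hK 0
    simp only [Fin.val_zero, Nat.cast_zero, zero_add, one_mul] at hk0
    have := pairKernel_sum_le ((Finset.univ : Finset (Fin 3)) ×ˢ J)
      (fun i => dampCoeff i.1 * p i.2)
      (fun i => ⟨1 - η + a i.2 + (1 - 2 * η) * dampExp i.1, t⟩)
      (fun i hi => hxi _ _ (hre i.1 i.2 (by simpa using hi)))
      (fun ρ hρ => by rw [Finset.sum_product]; exact hk0 ρ hρ) h0 h2
    rwa [Finset.sum_product, Finset.sum_product] at this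
  have s0 : ∑ m ∈ J, p m * (LSeries ↗Λ ⟨1 - η + a m, 0⟩).re =
      ∑ m ∈ J, p m * (archTerm ⟨1 - η + a m, 0⟩).re
        - ∑ m ∈ J, p m * (logDeriv xi ⟨1 - η + a m, 0⟩).re := by
    rw [← Finset.sum_sub_distrib]
    refine Finset.sum_congr rfl fun m hm => ?_
    rw [LSeries_vonMangoldt_eq_archTerm (by simpa using hre0 m hm), sub_re]; ring
  have sk : ∀ y : ℝ, ∑ j, ∑ m ∈ J, dampCoeff j * p m *
        (LSeries ↗Λ ⟨1 - η + a m + (1 - 2 * η) * dampExp j, y⟩).re =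
      ∑ j, ∑ m ∈ J, dampCoeff j * p m *
        (archTerm ⟨1 - η + a m + (1 - 2 * η) * dampExp j, y⟩).re
      - ∑ j, ∑ m ∈ J, dampCoeff j * p m *
        (logDeriv xi ⟨1 - η + a m + (1 - 2 * η) * dampExp j, y⟩).re := by
    intro y
    rw [← Finset.sum_sub_distrib]
    refine Finset.sum_congr rfl fun j _ => ?_
    rw [← Finset.sum_sub_distrib]
    refine Finset.sum_congr rfl fun m hm => ?_
    rw [LSeries_vonMangoldt_eq_archTerm (by simpa using hre j m hm), sub_re]; ring
  simp only [s0, sk, mul_sub, Finset.sum_sub_distrib] at hpos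
  have hsum : trigCoeff 0 * ∑ j, ∑ m ∈ J, dampCoeff j * p m *
      pairKernel ⟨1 - η + a m + (1 - 2 * η) * dampExp j, t⟩ ρ₀ ≤
      ∑ k : Fin 4, trigCoeff k * ∑ j, ∑ m ∈ J, dampCoeff j * p m *
      (logDeriv xi ⟨1 - η + a m + (1 - 2 * η) * dampExp j, ((k : ℕ) + 1 : ℝ) * t⟩).re := by
    refine le_trans ?_ (Finset.single_le_sum (f := fun k : Fin 4 => trigCoeff k *
      ∑ j, ∑ m ∈ J, dampCoeff j * p m *
      (logDeriv xi ⟨1 - η + a m + (1 - 2 * η) * dampExp j, ((k : ℕ) + 1 : ℝ) * t⟩).re)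
      (fun k _ => mul_nonneg (hb k) (hZ k)) (Finset.mem_univ (0 : Fin 4)))
    simp only [Fin.val_zero, Nat.cast_zero, zero_add, one_mul]
    exact mul_le_mul_of_nonneg_left hZ1 (hb 0)
  have := mul_nonneg hb0 hZ0
  linarith

end

section

open Filter Topology Complex

theorem sum_one_div_sq_le {X : ℝ} (hX : 1 < X) (n : ℕ) :
    ∑ j ∈ Finset.range n, 1 / (X + 2 * j) ^ 2 ≤ 1 / 2 * (1 / (X - 1) - 1 / (X - 1 + 2 * n)) := by
  induction n with
  | zero => simp
  | succ n ih =>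
    rw [Finset.sum_range_succ]
    have hn : (0 : ℝ) ≤ n := Nat.cast_nonneg n
    have h1 : 1 / (X + 2 * n) ^ 2 ≤ 1 / 2 * (1 / (X - 1 + 2 * n) - 1 / (X - 1 + 2 * (n + 1))) := by
      have e1 : 0 < X - 1 + 2 * n := by linarith
      have e2 : 0 < X - 1 + 2 * (n + 1) := by linarith
      have : 1 / 2 * (1 / (X - 1 + 2 * n) - 1 / (X - 1 + 2 * (n + 1)))
          = 1 / ((X - 1 + 2 * n) * (X - 1 + 2 * (n + 1))) := by
        field_simp; ring
      rw [this]
      apply one_div_le_one_div_of_le (by positivity)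
      nlinarith
    push_cast
    linarith

theorem digamma_three_half_re_le : (digamma (3 / 2)).re ≤ 0.114 := by
  have h : digamma (3 / 2) = ((2 - 2 * Real.log 2 - Real.eulerMascheroniConstant : ℝ) : ℂ) := by
    rw [show (3 / 2 : ℂ) = 1 / 2 + 1 by norm_num, digamma_apply_add_one, digamma_one_half]
    · rw [show Complex.log 2 = ((Real.log 2 : ℝ) : ℂ) by simp]; push_cast; ring
    · intro m h
      have := congrArg Complex.re h
      simp at this
      have h2 : (0 : ℝ) ≤ m := Nat.cast_nonneg m
      linarith
  rw [h, ofReal_re]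
  linarith [Real.one_half_lt_eulerMascheroniConstant, Real.log_two_gt_d9]

theorem sum_archTerm_zero_le {κ : Type*} (J : Finset κ) (p a : κ → ℝ) {η l : ℝ}
    (hp : ∑ m ∈ J, p m = 1) (hη : 0 ≤ η) (hη2 : η ≤ 0.006) (hl : 0 ≤ l)
    (ha : ∀ m ∈ J, η < a m)
    (hFl : ∀ X : ℝ, 9 / 10 ≤ X → 1 / X - l / X ^ 2 ≤ ∑ m ∈ J, p m / (X + a m)) :
    ∑ m ∈ J, p m * (archTerm ⟨1 - η + a m, 0⟩).re
      ≤ ∑ m ∈ J, p m / (a m - η) - 0.512 + 0.251 * l := by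
  have hdig : Tendsto (fun n : ℕ => ∑ m ∈ J, p m * ((Real.log n
      - ∑ j ∈ Finset.range (n + 1), 1 / ((3 - η + a m) / 2 + j)) / 2)) atTop
      (𝓝 (∑ m ∈ J, p m * ((digamma ((⟨1 - η + a m, 0⟩ : ℂ) / 2 + 1)).re / 2))) := by
    refine tendsto_finsetSum _ fun m hm => ((?_ : Tendsto _ _ _).div_const 2).const_mul _
    have := tendsto_digamma (s := (⟨1 - η + a m, 0⟩ : ℂ) / 2 + 1) (by
      simp; linarith [ha m hm])
    refine ((Complex.continuous_re.tendsto _).comp this).congr fun n => ?_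
    simp only [Function.comp_apply, sub_re, ofReal_re, re_sum]
    congr 1
    refine Finset.sum_congr rfl fun j _ => ?_
    have : (⟨1 - η + a m, 0⟩ : ℂ) / 2 + 1 + j = (((3 - η + a m) / 2 + j : ℝ) : ℂ) := by
      apply Complex.ext
      · simp; ring
      · simp
    rw [this, ← ofReal_one, ← ofReal_div, ofReal_re]
  have hdig0 : Tendsto (fun n : ℕ => (Real.log n
      - ∑ j ∈ Finset.range (n + 1), 1 / ((3 : ℝ) / 2 + j)) / 2 + 0.251 * l) atTop
      (𝓝 ((digamma (3 / 2)).re / 2 + 0.251 * l)) := by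
    refine ((?_ : Tendsto _ _ _).div_const 2).add_const _
    have := tendsto_digamma (s := 3 / 2) (by norm_num)
    refine ((Complex.continuous_re.tendsto _).comp this).congr fun n => ?_
    simp only [Function.comp_apply, sub_re, ofReal_re, re_sum]
    congr 1
    refine Finset.sum_congr rfl fun j _ => ?_
    have : (3 / 2 : ℂ) + j = ((3 / 2 + j : ℝ) : ℂ) := by push_cast; ring
    rw [this, ← ofReal_one, ← ofReal_div, ofReal_re]
  have hle := le_of_tendsto_of_tendsto' hdig hdig0 (fun n => by
    have h1 : ∑ m ∈ J, p m * ((Real.log n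
        - ∑ j ∈ Finset.range (n + 1), 1 / ((3 - η + a m) / 2 + j)) / 2)
        = Real.log n / 2 - ∑ j ∈ Finset.range (n + 1), ∑ m ∈ J, p m / (3 - η + 2 * j + a m) := by
      rw [Finset.sum_comm]
      have : ∀ m ∈ J, p m * ((Real.log n
        - ∑ j ∈ Finset.range (n + 1), 1 / ((3 - η + a m) / 2 + j)) / 2)
        = p m * (Real.log n / 2) - ∑ j ∈ Finset.range (n + 1), p m / (3 - η + 2 * j + a m) := by
        intro m hm
        rw [sub_div, mul_sub, Finset.sum_div, Finset.mul_sum]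
        congr 1
        refine Finset.sum_congr rfl fun j _ => ?_
        have hj : (0 : ℝ) ≤ j := Nat.cast_nonneg j
        have h1 : 0 < 3 - η + 2 * j + a m := by linarith [ha m hm]
        rw [show (3 - η + a m) / 2 + j = (3 - η + 2 * j + a m) / 2 by ring]
        field_simp
      rw [Finset.sum_congr rfl this, Finset.sum_sub_distrib, ← Finset.sum_mul, hp, one_mul]
    have h2 : ∑ j ∈ Finset.range (n + 1), (1 / (2 * ((3 : ℝ) / 2 + j)) - l * (1 / (3 - η + 2 * j) ^ 2))
        ≤ ∑ j ∈ Finset.range (n + 1), ∑ m ∈ J, p m / (3 - η + 2 * j + a m) := by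
      refine Finset.sum_le_sum fun j _ => ?_
      have hj : (0 : ℝ) ≤ j := Nat.cast_nonneg j
      refine le_trans ?_ (hFl (3 - η + 2 * j) (by linarith))
      have : 1 / (2 * ((3 : ℝ) / 2 + j)) ≤ 1 / (3 - η + 2 * j) :=
        one_div_le_one_div_of_le (by linarith) (by linarith)
      rw [mul_one_div]
      linarith
    rw [Finset.sum_sub_distrib, ← Finset.mul_sum] at h2
    have h3 := sum_one_div_sq_le (X := 3 - η) (by linarith) (n + 1)
    have h4 : ∑ j ∈ Finset.range (n + 1), 1 / (3 - η + 2 * (j : ℝ)) ^ 2 ≤ 0.251 := by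
      refine h3.trans ?_
      have e1 : 0 ≤ 1 / (3 - η - 1 + 2 * ((n + 1 : ℕ) : ℝ)) := by
        have : (0 : ℝ) ≤ ((n + 1 : ℕ) : ℝ) := Nat.cast_nonneg _
        have : 0 ≤ 3 - η - 1 + 2 * ((n + 1 : ℕ) : ℝ) := by linarith
        positivity
      have e2 : 1 / (3 - η - 1) ≤ 0.502 := by
        rw [div_le_iff₀ (by linarith)]; linarith
      linarith
    have h5 := mul_le_mul_of_nonneg_left h4 hl
    have h6 : ∑ j ∈ Finset.range (n + 1), 1 / (2 * ((3 : ℝ) / 2 + j))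
        = (∑ j ∈ Finset.range (n + 1), 1 / ((3 : ℝ) / 2 + j)) / 2 := by
      rw [Finset.sum_div]
      refine Finset.sum_congr rfl fun j _ => ?_
      rw [div_div, mul_comm]
    rw [h1]
    linarith)
  have harch : ∀ m ∈ J, p m * (archTerm ⟨1 - η + a m, 0⟩).re = p m / (a m - η)
      + p m * ((digamma ((⟨1 - η + a m, 0⟩ : ℂ) / 2 + 1)).re / 2) - p m * (Real.log Real.pi / 2) := by
    intro m hm
    have h1 : (1 / ((⟨1 - η + a m, 0⟩ : ℂ) - 1)).re = 1 / (a m - η) := by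
      have : (⟨1 - η + a m, 0⟩ : ℂ) - 1 = ((a m - η : ℝ) : ℂ) := by
        apply Complex.ext
        · simp; ring
        · simp
      rw [this, ← ofReal_one, ← ofReal_div, ofReal_re]
    have h2 : (digamma ((⟨1 - η + a m, 0⟩ : ℂ) / 2 + 1) / 2).re
      = (digamma ((⟨1 - η + a m, 0⟩ : ℂ) / 2 + 1)).re / 2 := by simp
    have h3 : ((Real.log Real.pi : ℂ) / 2).re = Real.log Real.pi / 2 := by
      simp
    rw [archTerm, sub_re, add_re, h1, h2, h3]
    ring
  rw [Finset.sum_congr rfl harch, Finset.sum_sub_distrib, Finset.sum_add_distrib, ← Finset.sum_mul, hp]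
  have hpi : 1.1386 ≤ Real.log Real.pi := by
    have h1 : Real.log 3.14 ≤ Real.log Real.pi :=
      Real.log_le_log (by norm_num) Real.pi_gt_d2.le
    have h2 : Real.log 3.14 = 5 / 3 * Real.log 2 - Real.log (32 / 3.14 ^ 3) / 3 := by
      rw [Real.log_div (by norm_num) (by norm_num), Real.log_pow,
        show (32 : ℝ) = 2 ^ 5 by norm_num, Real.log_pow]
      push_cast; ring
    have h3 := Real.log_le_sub_one_of_pos (show (0 : ℝ) < 32 / 3.14 ^ 3 by norm_num)
    have h4 := Real.log_two_gt_d9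
    norm_num at h3 h2 ⊢
    linarith
  linarith [digamma_three_half_re_le]

theorem mul_archTerm_re_le (w : ℝ) {σ y : ℝ} (hσ : 1 < σ) (hy : 5 ≤ y) :
    w * (archTerm ⟨σ, y⟩).re ≤ w * (Real.log (y / (2 * Real.pi)) / 2)
      + (|w| * (7 / 15) + max w 0 * (σ ^ 2 / 4 + 2 * σ)) / y ^ 2 := by
  have hy0 : 0 < y := by linarith
  obtain ⟨h1, h2⟩ := archTerm_re_bounds (s := ⟨σ, y⟩) hσ hy0
  simp only at h1 h2
  have h3 : (1 + 2 / y) / (3 * y ^ 2) ≤ (7 / 15) / y ^ 2 := by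
    have : 2 / y ≤ 2 / 5 := by gcongr
    rw [← div_div]
    refine div_le_div_of_nonneg_right ?_ (by positivity)
    linarith
  rcases le_total 0 w with hw | hw
  · rw [abs_of_nonneg hw, max_eq_left hw]
    calc w * (archTerm ⟨σ, y⟩).re ≤ w * (Real.log (y / (2 * Real.pi)) / 2 + (7 / 15) / y ^ 2
          + (σ ^ 2 / 4 + 2 * σ) / y ^ 2) := mul_le_mul_of_nonneg_left (by linarith) hw
      _ = _ := by ring
  · rw [abs_of_nonpos hw, max_eq_right hw]
    calc w * (archTerm ⟨σ, y⟩).re ≤ w * (Real.log (y / (2 * Real.pi)) / 2 - (7 / 15) / y ^ 2) :=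
          mul_le_mul_of_nonpos_left (by linarith) hw
      _ = _ := by ring

theorem damp_archTerm_le {κ : Type*} (J : Finset κ) (p a : κ → ℝ) {η B : ℝ}
    (hp : ∑ m ∈ J, p m = 1) (hη2 : η < 1 / 2) (ha : ∀ m ∈ J, η < a m)
    (hE : ∑ j, ∑ m ∈ J, (|dampCoeff j * p m| * (7 / 15) + max (dampCoeff j * p m) 0 *
      ((1 - η + a m + (1 - 2 * η) * dampExp j) ^ 2 / 4
        + 2 * (1 - η + a m + (1 - 2 * η) * dampExp j))) ≤ B) {y : ℝ} (hy : 5 ≤ y) :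
    ∑ j, ∑ m ∈ J, dampCoeff j * p m * (archTerm ⟨1 - η + a m + (1 - 2 * η) * dampExp j, y⟩).re
      ≤ 25 / 98 * Real.log (y / (2 * Real.pi)) + B / y ^ 2 := by
  have hEx : ∀ j, 0 ≤ dampExp j := by
    intro j; fin_cases j <;> norm_num [dampExp]
  have h1 : ∑ j, ∑ m ∈ J, dampCoeff j * p m *
      (archTerm ⟨1 - η + a m + (1 - 2 * η) * dampExp j, y⟩).re
      ≤ ∑ j, ∑ m ∈ J, (dampCoeff j * p m * (Real.log (y / (2 * Real.pi)) / 2)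
      + (|dampCoeff j * p m| * (7 / 15) + max (dampCoeff j * p m) 0 *
      ((1 - η + a m + (1 - 2 * η) * dampExp j) ^ 2 / 4
        + 2 * (1 - η + a m + (1 - 2 * η) * dampExp j))) / y ^ 2) := by
    refine Finset.sum_le_sum fun j _ => Finset.sum_le_sum fun m hm => ?_
    refine mul_archTerm_re_le _ ?_ hy
    have := mul_nonneg (show 0 ≤ 1 - 2 * η by linarith) (hEx j)
    linarith [ha m hm]
  refine h1.trans ?_
  have h2 := div_le_div_of_nonneg_right hE (sq_nonneg y)
  simp only [Finset.sum_add_distrib, ← Finset.sum_div, ← Finset.sum_mul, ← Finset.mul_sum, hp] at h2 ⊢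
  have h3 : ∑ j, dampCoeff j = 25 / 49 := by
    simp only [Fin.sum_univ_three, dampCoeff, Matrix.cons_val_zero, Matrix.cons_val_one,
      Matrix.cons_val]
    norm_num
  simp only [mul_one, h3] at h2 ⊢
  simp only [add_div] at h2 ⊢
  linarith

theorem log_two_pi_ge : 1.83 ≤ Real.log (2 * Real.pi) := by
  have h1 : Real.log (247) ≤ Real.log ((2 * Real.pi) ^ 3) := by
    apply Real.log_le_log (by norm_num)
    have := Real.pi_gt_d4
    calc (247 : ℝ) ≤ (2 * 3.1415) ^ 3 := by norm_num
      _ ≤ _ := by gcongr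
  have h2 : Real.log 247 = 8 * Real.log 2 - Real.log (256 / 247) := by
    rw [Real.log_div (by norm_num) (by norm_num), show (256 : ℝ) = 2 ^ 8 by norm_num, Real.log_pow]
    push_cast; ring
  have h3 := Real.log_le_sub_one_of_pos (show (0 : ℝ) < 256 / 247 by norm_num)
  have h4 := Real.log_two_gt_d9
  rw [Real.log_pow] at h1
  norm_num at h1 h3 ⊢
  linarith

theorem log_three_le : Real.log 3 ≤ 1.11 := by
  have h1 : Real.log (3 ^ 5) ≤ Real.log (2 ^ 8) := Real.log_le_log (by norm_num) (by norm_num)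
  rw [Real.log_pow, Real.log_pow] at h1
  have := Real.log_two_lt_d9
  norm_num at h1 ⊢
  linarith

theorem trig_sum_log_le {B t : ℝ} (hB : 0 ≤ B) (ht : 5 ≤ t) :
    ∑ k : Fin 4, trigCoeff k * (25 / 98 * Real.log ((((k : ℕ) : ℝ) + 1) * t / (2 * Real.pi))
      + B / ((((k : ℕ) : ℝ) + 1) * t) ^ 2) ≤ 9.5164 * Real.log t - 13.5 + 23.16 * B / t ^ 2 := by
  have ht0 : 0 < t := by linarith
  have hlog : ∀ k : ℝ, 0 < k → Real.log (k * t / (2 * Real.pi))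
      = Real.log k + Real.log t - Real.log (2 * Real.pi) := by
    intro k hk
    rw [Real.log_div (by positivity) (by positivity), Real.log_mul hk.ne' ht0.ne']
  have h4 : Real.log 4 = 2 * Real.log 2 := by
    rw [show (4 : ℝ) = 2 ^ 2 by norm_num, Real.log_pow]; norm_num
  have hL : 0 ≤ Real.log t := Real.log_nonneg (by linarith)
  have e : B / (2 * t) ^ 2 = B / t ^ 2 / 4 := by field_simp; norm_num
  have e3 : B / (3 * t) ^ 2 = B / t ^ 2 / 9 := by field_simp; norm_num
  have e4 : B / (4 * t) ^ 2 = B / t ^ 2 / 16 := by field_simp; norm_num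
  have hBt : 0 ≤ B / t ^ 2 := by positivity
  have c1 : (((0 : Fin 4) : ℕ) : ℝ) + 1 = 1 := by norm_num
  have c2 : (((1 : Fin 4) : ℕ) : ℝ) + 1 = 2 := by norm_num
  have c3 : (((2 : Fin 4) : ℕ) : ℝ) + 1 = 3 := by norm_num
  have c4 : (((3 : Fin 4) : ℕ) : ℝ) + 1 = 4 := by norm_num
  rw [Fin.sum_univ_four, c1, c2, c3, c4, hlog 1 one_pos, hlog 2 two_pos, hlog 3 three_pos,
    hlog 4 four_pos, Real.log_one, h4, e, e3, e4, one_mul, mul_div_assoc]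
  simp only [trigCoeff, Matrix.cons_val_zero, Matrix.cons_val_one, Matrix.cons_val]
  have := log_two_pi_ge
  have := log_three_le
  have := Real.log_two_lt_d9
  norm_num at *
  linarith

theorem damp_remainder_ge {η x l : ℝ} {F : ℝ → ℝ} (hη : 0 ≤ η) (hηx : η ≤ x) (hη2 : η ≤ 0.006)
    (hx : x + 2 * η ≤ 0.0684) (hlx : l ≤ 3.25 * x)
    (hFu : ∀ X : ℝ, 9 / 10 ≤ X → F X ≤ 1 / X)
    (hFl : ∀ X : ℝ, 9 / 10 ≤ X → 1 / X - l / X ^ 2 ≤ F X) :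
    -(3.47 * x + 5 * η) ≤ -54 / 49 * (F (x - η + (1 - 2 * η)) + F (1 - x - η + (1 - 2 * η)))
      + 30 / 49 * (F (x - η + (1 - 2 * η) * (3 / 2)) + F (1 - x - η + (1 - 2 * η) * (3 / 2)))
      + F (1 - x - η) := by
  have hx0 : 0 ≤ x := hη.trans hηx
  have low : ∀ X b d : ℝ, 9 / 10 ≤ X → 0 ≤ b → b ≤ 1 / X → 1 / X ^ 2 ≤ d → b - 3.25 * x * d ≤ F X := by
    intro X b d hX hb h1 h2
    refine le_trans ?_ (hFl X hX)
    have : l / X ^ 2 ≤ 3.25 * x * d := by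
      rw [div_eq_mul_one_div]
      exact mul_le_mul hlx h2 (by positivity) (by linarith)
    linarith
  have f1 : F (x - η + (1 - 2 * η)) ≤ 1 - 0.93 * x + 3.1 * η := by
    refine (hFu _ (by linarith)).trans ?_
    rw [div_le_iff₀ (by linarith)]
    nlinarith
  have f2 : F (1 - x - η + (1 - 2 * η)) ≤ 0.5 + 0.26 * x + 0.8 * η := by
    refine (hFu _ (by linarith)).trans ?_
    rw [div_le_iff₀ (by linarith)]
    nlinarith
  have f3 : 2 / 3 - 4 / 9 * x - 3.25 * x * 0.4554 ≤ F (x - η + (1 - 2 * η) * (3 / 2)) := by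
    apply low _ _ _ (by linarith) (by linarith)
    · rw [le_div_iff₀ (by linarith)]; nlinarith
    · rw [div_le_iff₀ (by nlinarith)]; nlinarith
  have f4 : 2 / 5 + 0.16 * x - 3.25 * x * 0.1715 ≤ F (1 - x - η + (1 - 2 * η) * (3 / 2)) := by
    apply low _ _ _ (by linarith) (by linarith)
    · rw [le_div_iff₀ (by linarith)]; nlinarith
    · rw [div_le_iff₀ (by nlinarith)]; nlinarith
  have f5 : 1 + x + η - 3.25 * x * 1.155 ≤ F (1 - x - η) := by
    apply low _ _ _ (by linarith) (by linarith)
    · rw [le_div_iff₀ (by linarith)]; nlinarith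
    · rw [div_le_iff₀ (by nlinarith)]; nlinarith
  linarith

/-- The explicit-formula inequality for a zero `1 - x + i t`, with the gamma factors and the
secondary kernel values estimated. -/
theorem zero_inequality {κ : Type*} (J : Finset κ) (p a : κ → ℝ) {η x l t B : ℝ}
    (hp : ∑ m ∈ J, p m = 1)
    (hf : ∀ u : ℝ, 0 ≤ u → 0 ≤ ∑ m ∈ J, p m * Real.exp (-(a m * u)))
    (ha : ∀ m ∈ J, η < a m)
    (hη : 0 ≤ η) (hηx : η < x) (hη2 : η ≤ 0.006) (hx : x + 2 * η ≤ 0.0684) (hl : 0 ≤ l)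
    (hlx : l ≤ 3.25 * x)
    (hFu : ∀ X : ℝ, 9 / 10 ≤ X → ∑ m ∈ J, p m / (X + a m) ≤ 1 / X)
    (hFl : ∀ X : ℝ, 9 / 10 ≤ X → 1 / X - l / X ^ 2 ≤ ∑ m ∈ J, p m / (X + a m))
    (hB : 0 ≤ B) (ht : 5 ≤ t)
    (hE : ∑ j, ∑ m ∈ J, (|dampCoeff j * p m| * (7 / 15) + max (dampCoeff j * p m) 0 *
      ((1 - η + a m + (1 - 2 * η) * dampExp j) ^ 2 / 4
        + 2 * (1 - η + a m + (1 - 2 * η) * dampExp j))) ≤ B)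
    (hK0 : ∀ ρ, xi ρ = 0 → 0 ≤ ∑ m ∈ J, p m * pairKernel ⟨1 - η + a m, 0⟩ ρ)
    (hK : ∀ k : Fin 4, ∀ ρ, xi ρ = 0 → 0 ≤ ∑ j, ∑ m ∈ J, dampCoeff j * p m *
      pairKernel ⟨1 - η + a m + (1 - 2 * η) * dampExp j, ((k : ℕ) + 1 : ℝ) * t⟩ ρ)
    (h0 : xi ⟨1 - x, t⟩ = 0) :
    19.584 * ∑ m ∈ J, p m / (x - η + a m) - 11.5032 * ∑ m ∈ J, p m / (a m - η)
      ≤ 9.5164 * Real.log t - 13.5 + 23.16 * B / t ^ 2 := by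
  have hmain := main_inequality J p a hf ha (by linarith) hK0 hK h0
    (by simp only; intro h; linarith)
  have hz := sum_archTerm_zero_le J p a hp hη hη2 hl ha hFl
  have hdamp : ∑ k : Fin 4, trigCoeff k * ∑ j, ∑ m ∈ J, dampCoeff j * p m *
        (archTerm ⟨1 - η + a m + (1 - 2 * η) * dampExp j, ((k : ℕ) + 1 : ℝ) * t⟩).re
      ≤ 9.5164 * Real.log t - 13.5 + 23.16 * B / t ^ 2 := by
    refine le_trans (Finset.sum_le_sum fun k _ => mul_le_mul_of_nonneg_left
      (damp_archTerm_le J p a hp (by linarith) ha hE ?_) ?_) (trig_sum_log_le hB ht)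
    · have : (0 : ℝ) ≤ ((k : ℕ) : ℝ) := Nat.cast_nonneg _
      nlinarith
    · fin_cases k <;> norm_num [trigCoeff]
  have hker0 : ∀ y : ℝ, hker y 0 = 1 / y := by
    intro y
    rcases eq_or_ne y 0 with rfl | hy
    · simp [hker]
    · rw [hker]; field_simp; ring
  obtain ⟨F, hF⟩ : ∃ F : ℝ → ℝ, ∀ X, F X = ∑ m ∈ J, p m / (X + a m) := ⟨_, fun _ => rfl⟩
  have hlhs : ∑ j, ∑ m ∈ J, dampCoeff j * p m *
      pairKernel ⟨1 - η + a m + (1 - 2 * η) * dampExp j, t⟩ ⟨1 - x, t⟩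
      = ∑ j, dampCoeff j * (F (x - η + (1 - 2 * η) * dampExp j)
        + F (1 - x - η + (1 - 2 * η) * dampExp j)) := by
    refine Finset.sum_congr rfl fun j _ => ?_
    rw [hF, hF, ← Finset.sum_add_distrib, Finset.mul_sum]
    refine Finset.sum_congr rfl fun m _ => ?_
    rw [pairKernel_eq_hker]
    simp only [sub_self, hker0]
    rw [show 1 - η + a m + (1 - 2 * η) * dampExp j - (1 - x)
      = x - η + (1 - 2 * η) * dampExp j + a m by ring,
      show 1 - η + a m + (1 - 2 * η) * dampExp j - 1 + (1 - x)
      = 1 - x - η + (1 - 2 * η) * dampExp j + a m by ring]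
    ring
  have hR := damp_remainder_ge (F := F) hη hηx.le hη2 hx hlx
    (fun X hX => by rw [hF]; exact hFu X hX) (fun X hX => by rw [hF]; exact hFl X hX)
  rw [hlhs] at hmain
  simp only [Fin.sum_univ_three, dampCoeff, dampExp, Matrix.cons_val_zero, Matrix.cons_val_one,
    Matrix.cons_val, mul_zero, add_zero, mul_one] at hmain
  rw [← hF]
  have c0 : trigCoeff 0 = 19.584 := rfl
  have cz : trigZero = 11.5032 := rfl
  rw [c0, cz] at hmain
  have hz' := mul_le_mul_of_nonneg_left hz (show (0 : ℝ) ≤ 11.5032 by norm_num)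
  have hd := hdamp
  simp only [dampCoeff, dampExp, Fin.sum_univ_three, Matrix.cons_val_zero, Matrix.cons_val_one,
    Matrix.cons_val, mul_zero, add_zero, mul_one] at hd
  have hm := hmain.trans (add_le_add hz' hd)
  linarith

theorem log_five_ge : 1.606 ≤ Real.log 5 := by
  have h2 : Real.log 125 = 7 * Real.log 2 - Real.log (128 / 125) := by
    rw [Real.log_div (by norm_num) (by norm_num), show (128 : ℝ) = 2 ^ 7 by norm_num, Real.log_pow]
    push_cast; ring
  have h3 := Real.log_le_sub_one_of_pos (show (0 : ℝ) < 128 / 125 by norm_num)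
  have h4 := Real.log_two_gt_d9
  rw [show (125 : ℝ) = 5 ^ 3 by norm_num, Real.log_pow] at h2
  norm_num at h2 h3 ⊢
  linarith

theorem log_one_hundred_fifty_bounds : 4.99 ≤ Real.log 150 ∧ Real.log 150 ≤ 5.025 := by
  have h1 : Real.log 150 = 7 * Real.log 2 + Real.log (150 / 128) := by
    rw [Real.log_div (by norm_num) (by norm_num), show (128 : ℝ) = 2 ^ 7 by norm_num, Real.log_pow]
    push_cast; ring
  have h2 := Real.log_le_sub_one_of_pos (show (0 : ℝ) < 150 / 128 by norm_num)
  have h3 := Real.one_sub_inv_le_log_of_pos (show (0 : ℝ) < 150 / 128 by norm_num)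
  have h4 := Real.log_two_gt_d9
  have h5 := Real.log_two_lt_d9
  constructor
  · norm_num at h1 h2 h3 ⊢
    linarith
  · norm_num at h1 h2 h3 ⊢
    linarith

theorem zero_free_of_le {x t : ℝ} (hx : 0 < x) (ht5 : 5 ≤ t) (ht : t ≤ 150)
    (h0 : xi ⟨1 - x, t⟩ = 0) : 0.1782 ≤ x * (1 + Real.log t) := by
  by_contra! hcon
  have ht0 : 0 < t := by linarith
  have hL5 : 1.606 ≤ Real.log t := log_five_ge.trans (Real.log_le_log (by norm_num) ht5)
  have hx' : x ≤ 0.0684 := by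
    by_contra! h
    have : 0.0684 * (1 + 1.606) ≤ x * (1 + Real.log t) := by gcongr
    norm_num at this hcon
    linarith
  have hM : ∀ v : ℝ, 0 ≤ ∑ m ∈ (Finset.univ : Finset (Fin 1)), (fun _ => (1 : ℝ)) m *
      hker ((fun _ => 3.25 * x) m) v := by
    intro v
    simp only [Finset.univ_unique, Finset.sum_singleton, one_mul]
    exact hker_nonneg (by positivity) v
  have h := zero_inequality (Finset.univ : Finset (Fin 1)) (fun _ => 1) (fun _ => 3.25 * x)
    (η := 0) (x := x) (l := 3.25 * x) (t := t) (B := 8.6) (by simp)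
    (fun u _ => by simp; positivity) (fun _ _ => by positivity) le_rfl hx (by norm_num)
    (by linarith) (by positivity) le_rfl
    (fun X hX => by
      simp only [Finset.univ_unique, Finset.sum_singleton]
      exact one_div_le_one_div_of_le (by linarith) (by linarith))
    (fun X hX => by
      simp only [Finset.univ_unique, Finset.sum_singleton]
      have hX0 : 0 < X := by linarith
      rw [div_sub_div _ _ hX0.ne' (by positivity), div_le_div_iff₀ (by positivity) (by positivity)]
      have : 0 ≤ X * (3.25 * x) ^ 2 := by positivity
      nlinarith)
    (by norm_num) ht5
    (by
      simp only [Finset.univ_unique, Finset.sum_singleton, Fin.sum_univ_three, dampCoeff, dampExp,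
        Matrix.cons_val_zero, Matrix.cons_val_one, Matrix.cons_val]
      rw [max_eq_left (by norm_num), max_eq_right (by norm_num), max_eq_left (by norm_num),
        abs_of_nonneg (by norm_num), abs_of_nonpos (by norm_num), abs_of_nonneg (by norm_num)]
      nlinarith)
    (fun ρ hρ => by
      have := re_mem_of_xi_eq_zero hρ
      exact pairKernel_sum_nonneg _ _ _ (fun _ _ => by positivity) hM this.1 (by linarith [this.2]) _)
    (fun k ρ hρ => by
      have := re_mem_of_xi_eq_zero hρ
      exact damp_pairKernel_nonneg _ _ _ (fun _ _ => by positivity) hM this.1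
        (by linarith [this.2]) _)
    h0
  simp only [Finset.univ_unique, Finset.sum_singleton, sub_zero] at h
  have e : 19.584 * (1 / (x + 3.25 * x)) - 11.5032 * (1 / (3.25 * x))
      = (19.584 / 4.25 - 11.5032 / 3.25) / x := by field_simp; norm_num
  rw [e] at h
  have h1 : 5.99 * (1 + Real.log t) ≤ (19.584 / 4.25 - 11.5032 / 3.25) / x := by
    rw [le_div_iff₀ hx]
    norm_num at hcon ⊢
    linarith
  have hl2 := Real.log_two_lt_d9
  have key : ∀ u v c : ℝ, 0 < u → u ≤ t → t ≤ v → Real.log v ≤ c → 19.49 - 3.53 * c ≤ 199.2 / u ^ 2 := by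
    intro u v c hu h2 h3 h4
    have h5 : 23.16 * 8.6 / t ^ 2 ≤ 199.2 / u ^ 2 := by gcongr; norm_num
    have h6 := Real.log_le_log ht0 h3
    norm_num at *
    linarith
  have hp : ∀ n : ℕ, Real.log (2 ^ n) = n * Real.log 2 := fun n => by rw [Real.log_pow]
  rcases le_total t 16 with h16 | h16
  · have := key 5 16 2.78 (by norm_num) ht5 h16 (by
      have := hp 4
      norm_num at this ⊢; linarith)
    norm_num at this
  rcases le_total t 32 with h32 | h32
  · have := key 16 32 3.47 (by norm_num) h16 h32 (by
      have := hp 5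
      norm_num at this ⊢; linarith)
    norm_num at this
  · have := key 32 150 5.025 (by norm_num) h32 ht log_one_hundred_fifty_bounds.2
    norm_num at this

/-- Weights of the five-term exponential kernel. -/
def expWeight : Fin 5 → ℝ := ![64611456 / 821074, -232168125 / 821074, 332114176 / 821074,
  -219721329 / 821074, 55984896 / 821074]

/-- Decay rates of the five-term exponential kernel. -/
def expRate : Fin 5 → ℝ := ![2.1 * 4, 2.1 * 5, 2.1 * 6, 2.1 * 7, 2.1 * 8]

theorem sum_expWeight : ∑ m, expWeight m = 1 := by
  simp only [Fin.sum_univ_five, expWeight, Matrix.cons_val_zero, Matrix.cons_val_one,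
    Matrix.cons_val]
  norm_num

theorem expRate_bounds (m : Fin 5) : 8.4 ≤ expRate m ∧ expRate m ≤ 16.8 := by
  fin_cases m <;> norm_num [expRate]

theorem expWeight_sum_exp_nonneg {x u : ℝ} (hx : 0 < x) (hu : 0 ≤ u) :
    0 ≤ ∑ m, expWeight m * Real.exp (-(x * expRate m * u)) := by
  obtain ⟨e, he⟩ : ∃ e, e = Real.exp (-(2.1 * x * u)) := ⟨_, rfl⟩
  have hpow : ∀ n : ℕ, Real.exp (-(x * (2.1 * n) * u)) = e ^ n := by
    intro n
    rw [he, ← Real.exp_nat_mul]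
    congr 1; ring
  have h4 := hpow 4
  have h5 := hpow 5
  have h6 := hpow 6
  have h7 := hpow 7
  have h8 := hpow 8
  push_cast at h4 h5 h6 h7 h8
  simp only [Fin.sum_univ_five, expWeight, expRate, Matrix.cons_val_zero, Matrix.cons_val_one,
    Matrix.cons_val]
  rw [h4, h5, h6, h7, h8]
  have he0 : 0 ≤ e := he ▸ (Real.exp_pos _).le
  have he1 : e ≤ 1 := by
    rw [he]; apply Real.exp_le_one_iff.2
    have : 0 ≤ 2.1 * x * u := by positivity
    linarith
  obtain ⟨w, rfl⟩ : ∃ w, e = 1 - w := ⟨1 - e, by ring⟩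
  have hw : 0 ≤ w := by linarith
  have hw1 : w ≤ 1 := by linarith
  have hq : 0 ≤ 821074 + 3164176 * w + 8859565 * w ^ 2 - 4218255 * w ^ 3 + 55984896 * w ^ 4 := by
    have : w ^ 3 ≤ w ^ 2 := pow_le_pow_of_le_one hw hw1 (by norm_num)
    have : 0 ≤ w ^ 2 := by positivity
    have : 0 ≤ w ^ 4 := by positivity
    linarith
  have := mul_nonneg (pow_nonneg he0 4) hq
  have e2 : (1 - w) ^ 4 * (821074 + 3164176 * w + 8859565 * w ^ 2 - 4218255 * w ^ 3
      + 55984896 * w ^ 4) / 821074 = 64611456 / 821074 * (1 - w) ^ 4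
      + -232168125 / 821074 * (1 - w) ^ 5 + 332114176 / 821074 * (1 - w) ^ 6
      + -219721329 / 821074 * (1 - w) ^ 7 + 55984896 / 821074 * (1 - w) ^ 8 := by ring
  rw [← e2]
  positivity

theorem expWeight_sum_hker_nonneg {x : ℝ} (hx : 0 < x) (v : ℝ) :
    0 ≤ ∑ m, expWeight m * hker (x * expRate m) v := by
  obtain ⟨c, hc⟩ : ∃ c, c = 2.1 * x := ⟨_, rfl⟩
  have hc0 : 0 < c := by rw [hc]; positivity
  obtain ⟨w, hw⟩ : ∃ w, w = (v / c) ^ 2 := ⟨_, rfl⟩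
  have hw0 : 0 ≤ w := hw ▸ sq_nonneg _
  have hk : ∀ n : ℝ, 0 < n → hker (x * (2.1 * n)) v = c⁻¹ * (n / (n ^ 2 + w)) := by
    intro n hn
    have h1 : x * (2.1 * n) = c * n := by rw [hc]; ring
    have h2 : (c * n) ^ 2 + v ^ 2 = c ^ 2 * (n ^ 2 + w) := by
      rw [hw]; field_simp
    have h3 : 0 < n ^ 2 + w := by positivity
    rw [hker, h1, h2]
    field_simp
  simp only [Fin.sum_univ_five, expWeight, expRate, Matrix.cons_val_zero, Matrix.cons_val_one,
    Matrix.cons_val]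
  rw [hk 4 (by norm_num), hk 5 (by norm_num), hk 6 (by norm_num), hk 7 (by norm_num),
    hk 8 (by norm_num)]
  have key : 64611456 / 821074 * (4 / (4 ^ 2 + w)) + -232168125 / 821074 * (5 / (5 ^ 2 + w))
      + 332114176 / 821074 * (6 / (6 ^ 2 + w)) + -219721329 / 821074 * (7 / (7 ^ 2 + w))
      + 55984896 / 821074 * (8 / (8 ^ 2 + w)) = 60060 / 410537 * (w - 32) ^ 2 * (w - 500) ^ 2 /
      ((4 ^ 2 + w) * (5 ^ 2 + w) * (6 ^ 2 + w) * (7 ^ 2 + w) * (8 ^ 2 + w)) := by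
    field_simp
    ring
  have : 0 ≤ c⁻¹ * (60060 / 410537 * (w - 32) ^ 2 * (w - 500) ^ 2 /
      ((4 ^ 2 + w) * (5 ^ 2 + w) * (6 ^ 2 + w) * (7 ^ 2 + w) * (8 ^ 2 + w))) := by positivity
  rw [← key] at this
  linarith

theorem expWeight_sum_div_bounds {x X : ℝ} (hx : 0 < x) (hx' : x ≤ 0.03) (hX : 9 / 10 ≤ X) :
    ∑ m, expWeight m / (X + x * expRate m) ≤ 1 / X ∧
      1 / X - x / X ^ 2 ≤ ∑ m, expWeight m / (X + x * expRate m) := by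
  have hX0 : 0 < X := by linarith
  obtain ⟨s, hs⟩ : ∃ s, s = 2.1 * x / X := ⟨_, rfl⟩
  have hs0 : 0 < s := by rw [hs]; positivity
  have hs1 : s ≤ 0.07 := by
    rw [hs, div_le_iff₀ hX0]; linarith
  have hxs : x = s * X / 2.1 := by rw [hs]; field_simp
  have hk : ∀ c n : ℝ, 0 < n → c / (X + x * (2.1 * n)) = X⁻¹ * (c / (1 + n * s)) := by
    intro c n hn
    have h1 : X + x * (2.1 * n) = X * (1 + n * s) := by rw [hs]; field_simp
    rw [h1]; field_simp
  simp only [Fin.sum_univ_five, expWeight, expRate, Matrix.cons_val_zero, Matrix.cons_val_one,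
    Matrix.cons_val]
  rw [hk _ 4 (by norm_num), hk _ 5 (by norm_num), hk _ 6 (by norm_num), hk _ 7 (by norm_num),
    hk _ 8 (by norm_num)]
  obtain ⟨N, hN⟩ : ∃ N, N = 120120 + 1224870 * s + 121911180 * s ^ 2 + 304463856 * s ^ 3
    + 5517617280 * s ^ 4 := ⟨_, rfl⟩
  obtain ⟨D, hD⟩ : ∃ D, D = 1 + 30 * s + 355 * s ^ 2 + 2070 * s ^ 3 + 5944 * s ^ 4
    + 6720 * s ^ 5 := ⟨_, rfl⟩
  have hD0 : 0 < D := by rw [hD]; positivity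
  have hN0 : 0 < N := by rw [hN]; positivity
  have hDf : D = (1 + 4 * s) * (1 + 5 * s) * (1 + 6 * s) * (1 + 7 * s) * (1 + 8 * s) := by
    rw [hD]; ring
  have key : 64611456 / 821074 / (1 + 4 * s) + -232168125 / 821074 / (1 + 5 * s)
      + 332114176 / 821074 / (1 + 6 * s) + -219721329 / 821074 / (1 + 7 * s)
      + 55984896 / 821074 / (1 + 8 * s) = 1 - s * (N / (821074 * D)) := by
    rw [hDf, hN]
    field_simp
    ring
  have hND : N / (821074 * D) ≤ 0.47 := by
    rw [div_le_iff₀ (by positivity), hN, hD]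
    have h2 : 0 ≤ s ^ 2 := by positivity
    have h3 : 0 ≤ s ^ 3 := by positivity
    have h4 : s ^ 4 ≤ 0.07 * s ^ 3 := by nlinarith
    have h4' : 0 ≤ s ^ 4 := by positivity
    have h5 : 0 ≤ s ^ 5 := by positivity
    nlinarith
  have hND0 : 0 ≤ N / (821074 * D) := by positivity
  have hsum : X⁻¹ * (64611456 / 821074 / (1 + 4 * s)) + X⁻¹ * (-232168125 / 821074 / (1 + 5 * s))
      + X⁻¹ * (332114176 / 821074 / (1 + 6 * s)) + X⁻¹ * (-219721329 / 821074 / (1 + 7 * s))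
      + X⁻¹ * (55984896 / 821074 / (1 + 8 * s)) = X⁻¹ * (1 - s * (N / (821074 * D))) := by
    rw [← key]; ring
  rw [hsum]
  have hXi : 0 < X⁻¹ := inv_pos.2 hX0
  constructor
  · rw [one_div]
    have : 0 ≤ X⁻¹ * (s * (N / (821074 * D))) := by positivity
    linarith
  · have e : x / X ^ 2 = X⁻¹ * (s / 2.1) := by rw [hxs]; field_simp
    rw [e, one_div]
    have : X⁻¹ * (s * (N / (821074 * D))) ≤ X⁻¹ * (s / 2.1) := by
      refine mul_le_mul_of_nonneg_left ?_ hXi.le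
      rw [div_eq_mul_one_div s 2.1]
      refine mul_le_mul_of_nonneg_left (hND.trans ?_) hs0.le
      norm_num
    linarith

theorem expWeight_error_le {η x : ℝ} (hη : 0 ≤ η) (hη2 : η ≤ 0.006) (hx : 0 < x) (hx' : x ≤ 0.03) :
    ∑ j, ∑ m, (|dampCoeff j * expWeight m| * (7 / 15) + max (dampCoeff j * expWeight m) 0 *
      ((1 - η + x * expRate m + (1 - 2 * η) * dampExp j) ^ 2 / 4
        + 2 * (1 - η + x * expRate m + (1 - 2 * η) * dampExp j))) ≤ 10150 := by
  have hEx : ∀ j, 0 ≤ dampExp j := by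
    intro j; fin_cases j <;> norm_num [dampExp]
  have h1 : ∀ j m, |dampCoeff j * expWeight m| * (7 / 15) + max (dampCoeff j * expWeight m) 0 *
      ((1 - η + x * expRate m + (1 - 2 * η) * dampExp j) ^ 2 / 4
        + 2 * (1 - η + x * expRate m + (1 - 2 * η) * dampExp j))
      ≤ |dampCoeff j * expWeight m| * (7 / 15) + max (dampCoeff j * expWeight m) 0 *
      ((1.504 + dampExp j) ^ 2 / 4 + 2 * (1.504 + dampExp j)) := by
    intro j m
    obtain ⟨h8, h16⟩ := expRate_bounds m
    have ha : x * expRate m ≤ 0.504 := by nlinarith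
    have ha0 : 0 ≤ x * expRate m := by positivity
    have hd : 0 ≤ (1 - 2 * η) * dampExp j := mul_nonneg (by linarith) (hEx j)
    have hd1 : (1 - 2 * η) * dampExp j ≤ dampExp j := by nlinarith [hEx j]
    have hσ0 : 0 ≤ 1 - η + x * expRate m + (1 - 2 * η) * dampExp j := by linarith
    have hσ : 1 - η + x * expRate m + (1 - 2 * η) * dampExp j ≤ 1.504 + dampExp j := by linarith
    gcongr
  refine (Finset.sum_le_sum fun j _ => Finset.sum_le_sum fun m _ => h1 j m).trans ?_
  simp only [Fin.sum_univ_three, Fin.sum_univ_five, expWeight, dampCoeff, dampExp,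
    Matrix.cons_val_zero, Matrix.cons_val_one, Matrix.cons_val, abs_eq_max_neg, max_def]
  norm_num

/-- `zero_inequality` for the five-term kernel scaled by `x`, damped at the abscissa `1 - r x`. -/
theorem expWeight_zero_inequality {r x t : ℝ} (hr : 0 ≤ r) (hr1 : r < 1) (hx : 0 < x)
    (hx' : x ≤ 0.03) (hrx : r * x ≤ 0.006) (ht : 5 ≤ t)
    (hK0 : ∀ ρ, xi ρ = 0 →
      0 ≤ ∑ m, expWeight m * pairKernel ⟨1 - r * x + x * expRate m, 0⟩ ρ)
    (hK : ∀ k : Fin 4, ∀ ρ, xi ρ = 0 → 0 ≤ ∑ j, ∑ m, dampCoeff j * expWeight m *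
      pairKernel ⟨1 - r * x + x * expRate m + (1 - 2 * (r * x)) * dampExp j,
        ((k : ℕ) + 1 : ℝ) * t⟩ ρ)
    (h0 : xi ⟨1 - x, t⟩ = 0) :
    (19.584 * ∑ m, expWeight m / (1 - r + expRate m)
      - 11.5032 * ∑ m, expWeight m / (expRate m - r)) / x
      ≤ 9.5164 * Real.log t - 13.5 + 235074 / t ^ 2 := by
  have hrx0 : 0 ≤ r * x := by positivity
  have h := zero_inequality Finset.univ expWeight (fun m => x * expRate m) (η := r * x) (x := x)
    (l := x) (B := 10150) sum_expWeight (fun u hu => expWeight_sum_exp_nonneg hx hu)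
    (fun m _ => by nlinarith [expRate_bounds m]) hrx0 (by nlinarith) hrx (by linarith) hx.le
    (by linarith)
    (fun X hX => (expWeight_sum_div_bounds hx hx' hX).1)
    (fun X hX => (expWeight_sum_div_bounds hx hx' hX).2) (by norm_num) ht
    (expWeight_error_le hrx0 hrx hx hx') hK0 hK h0
  have e1 : ∑ m, expWeight m / (x - r * x + x * expRate m)
      = (∑ m, expWeight m / (1 - r + expRate m)) / x := by
    rw [Finset.sum_div]
    refine Finset.sum_congr rfl fun m _ => ?_
    rw [div_div]; congr 1; ring
  have e2 : ∑ m, expWeight m / (x * expRate m - r * x)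
      = (∑ m, expWeight m / (expRate m - r)) / x := by
    rw [Finset.sum_div]
    refine Finset.sum_congr rfl fun m _ => ?_
    rw [div_div]; congr 1; ring
  rw [e1, e2] at h
  calc _ = 19.584 * ((∑ m, expWeight m / (1 - r + expRate m)) / x)
      - 11.5032 * ((∑ m, expWeight m / (expRate m - r)) / x) := by ring
    _ ≤ _ := h
    _ ≤ _ := by
      have : 23.16 * 10150 / t ^ 2 ≤ 235074 / t ^ 2 := by gcongr; norm_num
      linarith

theorem expWeight_kernel_undamped :
    1.549 ≤ 19.584 * ∑ m, expWeight m / (1 - 0 + expRate m)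
      - 11.5032 * ∑ m, expWeight m / (expRate m - 0) := by
  simp only [Fin.sum_univ_five, expWeight, expRate, Matrix.cons_val_zero, Matrix.cons_val_one,
    Matrix.cons_val]
  norm_num

theorem expWeight_kernel_shifted :
    1.7041 ≤ 19.584 * ∑ m, expWeight m / (1 - 0.84 + expRate m)
      - 11.5032 * ∑ m, expWeight m / (expRate m - 0.84) := by
  simp only [Fin.sum_univ_five, expWeight, expRate, Matrix.cons_val_zero, Matrix.cons_val_one,
    Matrix.cons_val]
  norm_num

theorem zero_inequality_undamped {x t : ℝ} (hx : 0 < x) (ht : 150 ≤ t)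
    (hcon : x * (1 + Real.log t) < 0.1782) (h0 : xi ⟨1 - x, t⟩ = 0) :
    1.549 / x ≤ 9.5164 * Real.log t - 13.5 + 235074 / t ^ 2 := by
  have hL : 4.99 ≤ Real.log t :=
    log_one_hundred_fifty_bounds.1.trans (Real.log_le_log (by norm_num) ht)
  have hx' : x ≤ 0.03 := by
    by_contra! h
    have : 0.03 * (1 + 4.99) ≤ x * (1 + Real.log t) := by gcongr
    norm_num at this hcon
    linarith
  have hM := expWeight_sum_hker_nonneg hx
  have hpos : ∀ m ∈ (Finset.univ : Finset (Fin 5)), 0 < x * expRate m := fun m _ =>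
    mul_pos hx (by linarith [expRate_bounds m])
  have h := expWeight_zero_inequality (r := 0) le_rfl one_pos hx hx' (by norm_num) (by linarith)
    (fun ρ hρ => by
      have := re_mem_of_xi_eq_zero hρ
      exact pairKernel_sum_nonneg _ _ _ hpos hM (by linarith [this.1]) (by linarith [this.2]) _)
    (fun k ρ hρ => by
      have := re_mem_of_xi_eq_zero hρ
      exact damp_pairKernel_nonneg _ _ _ hpos hM (by linarith [this.1]) (by linarith [this.2]) _)
    h0
  exact (div_le_div_of_nonneg_right expWeight_kernel_undamped hx.le).trans h

theorem zero_free_of_log_le {x t : ℝ} (hx : 0 < x) (ht : 150 ≤ t) (hL : Real.log t ≤ 25)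
    (h0 : xi ⟨1 - x, t⟩ = 0) : 0.1782 ≤ x * (1 + Real.log t) := by
  by_contra! hcon
  have h := zero_inequality_undamped hx ht hcon h0
  have h1 : 8.69 * (1 + Real.log t) ≤ 1.549 / x := by
    rw [le_div_iff₀ hx]
    norm_num at hcon ⊢
    linarith
  rcases le_total t 1024 with h2 | h2
  · have h3 : Real.log t ≤ 10 * Real.log 2 := by
      refine (Real.log_le_log (by linarith) h2).trans (le_of_eq ?_)
      rw [show (1024 : ℝ) = 2 ^ 10 by norm_num, Real.log_pow]; norm_num
    have h4 : 235074 / t ^ 2 ≤ 235074 / 150 ^ 2 := by gcongr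
    have := Real.log_two_lt_d9
    norm_num at *
    linarith
  · have h4 : 235074 / t ^ 2 ≤ 235074 / 1024 ^ 2 := by gcongr
    norm_num at *
    linarith

theorem zero_free_weak_of_ge {x t : ℝ} (hx : 0 < x) (ht : 150 ≤ t)
    (h0 : xi ⟨1 - x, t⟩ = 0) : 0.16 ≤ x * (1 + Real.log t) := by
  by_contra! hcon
  have h := zero_inequality_undamped hx ht (hcon.trans (by norm_num)) h0
  have h1 : 9.68 * (1 + Real.log t) ≤ 1.549 / x := by
    rw [le_div_iff₀ hx]
    norm_num at hcon ⊢
    linarith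
  have h4 : 235074 / t ^ 2 ≤ 235074 / 150 ^ 2 := by gcongr
  have : 0 ≤ Real.log t := Real.log_nonneg (by linarith)
  norm_num at *
  linarith

/-- Reduction of statements about zeros of `xi` to zeros in the upper half plane. -/
theorem zero_free_of_upper {c : ℝ}
    (h : ∀ x t : ℝ, 0 < x → 5 ≤ t → xi ⟨1 - x, t⟩ = 0 → c ≤ x * (1 + Real.log t)) {ρ : ℂ}
    (hρ : xi ρ = 0) : c ≤ (1 - ρ.re) * (1 + Real.log |ρ.im|) := by
  have h5 := five_lt_abs_im_of_xi_eq_zero hρ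
  have hre := re_mem_of_xi_eq_zero hρ
  refine h _ _ (by linarith [hre.2]) h5.le ?_
  rcases le_total 0 ρ.im with him | him
  · rw [abs_of_nonneg him, show (⟨1 - (1 - ρ.re), ρ.im⟩ : ℂ) = ρ by apply Complex.ext <;> simp]
    exact hρ
  · rw [abs_of_nonpos him, show (⟨1 - (1 - ρ.re), -ρ.im⟩ : ℂ) = (starRingEnd ℂ) ρ by
      apply Complex.ext <;> simp, xi_conj, hρ, map_zero]

theorem zero_free_weak {ρ : ℂ} (hρ : xi ρ = 0) : 0.16 ≤ (1 - ρ.re) * (1 + Real.log |ρ.im|) := by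
  refine zero_free_of_upper (fun x t hx ht h0 => ?_) hρ
  rcases le_total t 150 with h | h
  · exact le_trans (by norm_num) (zero_free_of_le hx ht h h0)
  · exact zero_free_weak_of_ge hx h h0

theorem abs_hker_sub_le {x y : ℝ} (hx0 : 0 ≤ x) (hx : x ≤ 3) (hy : y ≠ 0) :
    |hker x y - x / y ^ 2| ≤ 27 / y ^ 4 := by
  have hy2 : 0 < y ^ 2 := by positivity
  have e : hker x y - x / y ^ 2 = -(x ^ 3 / ((x ^ 2 + y ^ 2) * y ^ 2)) := by
    have : 0 < x ^ 2 + y ^ 2 := by positivity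
    rw [hker]; field_simp; ring
  rw [e, abs_neg, abs_of_nonneg (by positivity)]
  calc x ^ 3 / ((x ^ 2 + y ^ 2) * y ^ 2) ≤ 3 ^ 3 / ((0 + y ^ 2) * y ^ 2) := by gcongr; positivity
    _ = 27 / y ^ 4 := by norm_num; congr 1; ring

theorem sum_pairKernel_nonneg_of_far {κ : Type*} (I : Finset κ) (w σ : κ → ℝ) {Y : ℝ} {ρ : ℂ}
    (hρ : 0 < ρ.re ∧ ρ.re < 1) (hσ : ∀ i ∈ I, 1 ≤ σ i ∧ σ i ≤ 3) {D W : ℝ}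
    (hD : D ≤ ∑ i ∈ I, w i * (2 * σ i - 1)) (hW : ∑ i ∈ I, |w i| ≤ W)
    (hy : Y - ρ.im ≠ 0) (hDW : 54 * W ≤ (Y - ρ.im) ^ 2 * D) :
    0 ≤ ∑ i ∈ I, w i * pairKernel ⟨σ i, Y⟩ ρ := by
  obtain ⟨y, hyd⟩ : ∃ y, y = Y - ρ.im := ⟨_, rfl⟩
  rw [← hyd] at hy hDW
  have hy2 : 0 < y ^ 2 := by positivity
  have h1 : ∀ i ∈ I, w i * (2 * σ i - 1) / y ^ 2 - |w i| * (54 / y ^ 4)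
      ≤ w i * pairKernel ⟨σ i, Y⟩ ρ := by
    intro i hi
    obtain ⟨hs1, hs3⟩ := hσ i hi
    rw [pairKernel_eq_hker]
    simp only [← hyd]
    have a1 := abs_hker_sub_le (x := σ i - ρ.re) (by linarith [hρ.2]) (by linarith [hρ.1]) hy
    have a2 := abs_hker_sub_le (x := σ i - 1 + ρ.re) (by linarith [hρ.1]) (by linarith [hρ.2]) hy
    have e : (2 * σ i - 1) / y ^ 2 = (σ i - ρ.re) / y ^ 2 + (σ i - 1 + ρ.re) / y ^ 2 := by ring
    have a3 : |hker (σ i - ρ.re) y + hker (σ i - 1 + ρ.re) y - (2 * σ i - 1) / y ^ 2|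
        ≤ 54 / y ^ 4 := by
      rw [e, show ∀ a b c d : ℝ, a + b - (c + d) = (a - c) + (b - d) by intros; ring]
      refine (abs_add_le _ _).trans ((add_le_add a1 a2).trans (le_of_eq ?_))
      ring
    have a4 := mul_le_mul_of_nonneg_left a3 (abs_nonneg (w i))
    rw [← abs_mul] at a4
    have a5 := (abs_le.1 a4).1
    rw [mul_div_assoc]
    linarith
  refine le_trans ?_ (Finset.sum_le_sum h1)
  rw [Finset.sum_sub_distrib, ← Finset.sum_div, ← Finset.sum_mul]
  have h2 : D / y ^ 2 ≤ (∑ i ∈ I, w i * (2 * σ i - 1)) / y ^ 2 := by gcongr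
  have h3 : (∑ i ∈ I, |w i|) * (54 / y ^ 4) ≤ W * (54 / y ^ 4) := by gcongr
  have h4 : W * (54 / y ^ 4) ≤ D / y ^ 2 := by
    rw [← mul_div_assoc, div_le_div_iff₀ (by positivity) hy2]
    nlinarith
  linarith

theorem expWeight_pairKernel_nonneg_of_far {η x Y : ℝ} {ρ : ℂ} (hη : 0 ≤ η) (hηx : η < x)
    (hx' : x ≤ 0.007) (hρ : xi ρ = 0) (hy : 10000 ≤ |Y - ρ.im|) :
    0 ≤ ∑ m, expWeight m * pairKernel ⟨1 - η + x * expRate m, Y⟩ ρ := by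
  have hx : 0 < x := by linarith
  have hy2 : (10000 : ℝ) ^ 2 ≤ (Y - ρ.im) ^ 2 := by
    rw [← sq_abs (Y - ρ.im)]; gcongr
  refine sum_pairKernel_nonneg_of_far _ _ _ (D := 0.9) (W := 1102) (re_mem_of_xi_eq_zero hρ)
    (fun m _ => ?_) ?_ ?_ ?_ (by nlinarith)
  · have := expRate_bounds m
    constructor <;> nlinarith
  · simp only [Fin.sum_univ_five, expWeight, expRate, Matrix.cons_val_zero, Matrix.cons_val_one,
      Matrix.cons_val]
    norm_num
    linarith
  · simp only [Fin.sum_univ_five, expWeight, Matrix.cons_val_zero, Matrix.cons_val_one,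
      Matrix.cons_val, abs_eq_max_neg, max_def]
    norm_num
  · intro h
    rw [h] at hy
    norm_num at hy

theorem expWeight_damp_pairKernel_nonneg_of_far {η x Y : ℝ} {ρ : ℂ} (hη : 0 ≤ η) (hηx : η < x)
    (hx' : x ≤ 0.007) (hρ : xi ρ = 0) (hy : 10000 ≤ |Y - ρ.im|) :
    0 ≤ ∑ j, ∑ m, dampCoeff j * expWeight m *
      pairKernel ⟨1 - η + x * expRate m + (1 - 2 * η) * dampExp j, Y⟩ ρ := by
  have hx : 0 < x := by linarith
  have hy2 : (10000 : ℝ) ^ 2 ≤ (Y - ρ.im) ^ 2 := by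
    rw [← sq_abs (Y - ρ.im)]; gcongr
  have h := sum_pairKernel_nonneg_of_far Finset.univ
    (fun i : Fin 3 × Fin 5 => dampCoeff i.1 * expWeight i.2)
    (fun i => 1 - η + x * expRate i.2 + (1 - 2 * η) * dampExp i.1) (Y := Y) (D := 0.13) (W := 2992)
    (re_mem_of_xi_eq_zero hρ)
    (fun i _ => by
      have h1 := expRate_bounds i.2
      have h2 : 0 ≤ dampExp i.1 ∧ dampExp i.1 ≤ 3 / 2 := by
        rcases i with ⟨j, _⟩
        fin_cases j <;> norm_num [dampExp]
      have h3 : 0 ≤ (1 - 2 * η) * dampExp i.1 := mul_nonneg (by linarith) h2.1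
      constructor <;> nlinarith)
    (by
      rw [Fintype.sum_prod_type]
      simp only [Fin.sum_univ_three, Fin.sum_univ_five, expWeight, expRate, dampCoeff, dampExp,
        Matrix.cons_val_zero, Matrix.cons_val_one, Matrix.cons_val]
      norm_num
      linarith)
    (by
      rw [Fintype.sum_prod_type]
      simp only [Fin.sum_univ_three, Fin.sum_univ_five, expWeight, dampCoeff,
        Matrix.cons_val_zero, Matrix.cons_val_one, Matrix.cons_val, abs_eq_max_neg, max_def]
      norm_num)
    (by
      intro h
      rw [h] at hy
      norm_num at hy)
    (by nlinarith)
  rwa [Fintype.sum_prod_type] at h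

theorem zero_free_of_log_ge {x t : ℝ} (hx : 0 < x) (ht0 : 0 < t) (hL : 25 ≤ Real.log t)
    (h0 : xi ⟨1 - x, t⟩ = 0) : 0.1782 ≤ x * (1 + Real.log t) := by
  by_contra! hcon
  have ht : 10000 ≤ t := by
    by_contra! h
    have h1 : Real.log t ≤ Real.log (2 ^ 14) := Real.log_le_log ht0 (by linarith)
    rw [Real.log_pow] at h1
    have := Real.log_two_lt_d9
    norm_num at h1 this
    linarith
  have hx' : x ≤ 0.0069 := by
    by_contra! h
    have : 0.0069 * (1 + 25) ≤ x * (1 + Real.log t) := by gcongr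
    norm_num at this hcon
    linarith
  have hη : 0.84 * x ≤ 0.006 := by linarith
  have hM := expWeight_sum_hker_nonneg hx
  have hpos : ∀ m ∈ (Finset.univ : Finset (Fin 5)), 0 < x * expRate m := fun m _ =>
    mul_pos hx (by linarith [expRate_bounds m])
  have hlog5 : Real.log 5 ≤ 1.618 := by
    have h1 : Real.log (5 ^ 3) ≤ Real.log (2 ^ 7) := Real.log_le_log (by norm_num) (by norm_num)
    rw [Real.log_pow, Real.log_pow] at h1
    have := Real.log_two_lt_d9
    norm_num at h1 this ⊢
    linarith
  have hright : ∀ ρ, xi ρ = 0 → |ρ.im| ≤ 5 * t → ρ.re < 1 - 0.84 * x := by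
    intro ρ hρ him
    have h5 := five_lt_abs_im_of_xi_eq_zero hρ
    have hre := re_mem_of_xi_eq_zero hρ
    have hw := zero_free_weak hρ
    have hl : Real.log |ρ.im| ≤ Real.log 5 + Real.log t := by
      rw [← Real.log_mul (by norm_num) ht0.ne']
      exact Real.log_le_log (by linarith) him
    have h1 : 0.16 ≤ (1 - ρ.re) * (2.618 + Real.log t) := by
      refine hw.trans (mul_le_mul_of_nonneg_left ?_ (by linarith [hre.2]))
      linarith
    by_contra! h
    have h2 : (1 - ρ.re) * (2.618 + Real.log t) ≤ 0.84 * x * (2.618 + Real.log t) :=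
      mul_le_mul_of_nonneg_right (by linarith) (by norm_num at *; linarith)
    norm_num at *
    nlinarith
  have hleft : ∀ ρ, xi ρ = 0 → |ρ.im| ≤ 5 * t → 0.84 * x < ρ.re := by
    intro ρ hρ him
    have := hright (1 - ρ) (by rw [xi_one_sub, hρ]) (by simpa using him)
    simp only [sub_re, one_re] at this
    linarith
  have h := expWeight_zero_inequality (r := 0.84) (by norm_num) (by norm_num) hx (by linarith) hη
    (by linarith)
    (fun ρ hρ => by
      rcases le_total |ρ.im| (5 * t) with him | him
      · exact pairKernel_sum_nonneg _ _ _ hpos hM (hleft ρ hρ him) (hright ρ hρ him) _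
      · refine expWeight_pairKernel_nonneg_of_far (by positivity) (by linarith) (by linarith) hρ ?_
        rw [zero_sub, abs_neg]
        linarith)
    (fun k ρ hρ => by
      rcases le_total |ρ.im| (5 * t) with him | him
      · exact damp_pairKernel_nonneg _ _ _ hpos hM (hleft ρ hρ him) (hright ρ hρ him) _
      · refine expWeight_damp_pairKernel_nonneg_of_far (by positivity) (by linarith) (by linarith)
          hρ ?_
        have hk : ((k : ℕ) : ℝ) + 1 ≤ 4 := by
          have : (k : ℕ) + 1 ≤ 4 := k.2
          exact_mod_cast this
        have h1 : |((k : ℕ) + 1 : ℝ) * t| ≤ 4 * t := by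
          rw [abs_of_nonneg (by positivity)]; gcongr
        have h2 := abs_sub_abs_le_abs_sub ρ.im (((k : ℕ) + 1 : ℝ) * t)
        rw [abs_sub_comm] at h2
        linarith)
    h0
  have h1 := (div_le_div_of_nonneg_right expWeight_kernel_shifted hx.le).trans h
  have h2 : 9.5628 * (1 + Real.log t) ≤ 1.7041 / x := by
    rw [le_div_iff₀ hx]
    norm_num at hcon ⊢
    linarith
  have h4 : 235074 / t ^ 2 ≤ 235074 / 10000 ^ 2 := by gcongr
  norm_num at *
  linarith

/-- An explicit classical zero-free region. -/
theorem zero_free {ρ : ℂ} (hρ : xi ρ = 0) : 0.1782 ≤ (1 - ρ.re) * (1 + Real.log |ρ.im|) := by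
  refine zero_free_of_upper (fun x t hx ht h0 => ?_) hρ
  rcases le_total t 150 with h | h
  · exact zero_free_of_le hx ht h h0
  rcases le_total (Real.log t) 25 with hl | hl
  · exact zero_free_of_log_le hx h hl h0
  · exact zero_free_of_log_ge hx (by linarith) hl h0

end

section

open Complex Filter Topology Metric MeasureTheory Set

/-- A holomorphic function on a star-convex open set has a primitive. -/
theorem exists_primitive_of_starConvex {U : Set ℂ} {z₀ : ℂ} (hU : IsOpen U)
    (hstar : StarConvex ℝ z₀ U) {f : ℂ → ℂ} (hf : DifferentiableOn ℂ f U) :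
    ∃ H : ℂ → ℂ, ∀ z ∈ U, HasDerivAt H (f z) z := by
  refine ⟨fun w => ∫ u in (0 : ℝ)..1, (w - z₀) * f (z₀ + u * (w - z₀)), fun z hz => ?_⟩
  obtain ⟨ε, hε, hball⟩ := Metric.isOpen_iff.1 hU z hz
  have hne : (ball z ε).Nonempty := ⟨z, mem_ball_self hε⟩
  obtain ⟨C, hC⟩ : ∃ C, C = convexJoin ℝ {z₀} (ball z ε) := ⟨_, rfl⟩
  have hCU : C ⊆ U := by
    rw [hC]
    intro w hw
    obtain ⟨a, ha, b, hb, hab⟩ := mem_convexJoin.1 hw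
    rw [mem_singleton_iff.1 ha] at hab
    exact hstar.segment_subset (hball hb) hab
  have hCconv : Convex ℝ C := by
    rw [hC]; exact (convex_singleton z₀).convexJoin (convex_ball z ε)
  have hsub : ball z ε ⊆ C := by
    rw [hC]; exact subset_convexJoin_right (singleton_nonempty _)
  have hz₀ : z₀ ∈ C := by
    rw [hC]; exact subset_convexJoin_left hne rfl
  obtain ⟨g, hg⟩ := hCconv.exists_forall_hasDerivWithinAt (hf.mono hCU)
  have hderiv : HasDerivAt g (f z) z :=
    (hg z (hsub (mem_ball_self hε))).hasDerivAt
      (Filter.mem_of_superset (ball_mem_nhds z hε) hsub)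
  refine (hderiv.sub_const (g z₀)).congr_of_eventuallyEq ?_
  filter_upwards [ball_mem_nhds z hε] with w hw
  have hwC : w ∈ C := hsub hw
  have hmem : ∀ u ∈ Icc (0 : ℝ) 1, z₀ + u * (w - z₀) ∈ C := by
    intro u hu
    have := hCconv.add_smul_sub_mem hz₀ hwC hu
    simpa [Complex.real_smul] using this
  have hpath : ∀ u : ℝ, HasDerivAt (fun u : ℝ => z₀ + (u : ℂ) * (w - z₀)) (w - z₀) u := by
    intro u
    simpa using ((Complex.ofRealCLM.hasDerivAt (x := u)).mul_const (w - z₀)).const_add z₀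
  have hcont : ContinuousOn (fun u : ℝ => z₀ + (u : ℂ) * (w - z₀)) (Icc 0 1) := by fun_prop
  have hftc := intervalIntegral.integral_eq_sub_of_hasDeriv_right_of_le (a := (0 : ℝ)) (b := 1)
    (f := fun u : ℝ => g (z₀ + u * (w - z₀)))
    (f' := fun u : ℝ => (w - z₀) * f (z₀ + u * (w - z₀))) zero_le_one ?_ ?_ ?_
  · rw [hftc]; simp
  · exact ContinuousOn.comp (t := C) (fun x hx => (hg x hx).continuousWithinAt) hcont hmem
  · intro u hu
    have h1 : HasDerivWithinAt (fun u : ℝ => z₀ + (u : ℂ) * (w - z₀)) (w - z₀) (Icc 0 1) u :=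
      (hpath u).hasDerivWithinAt
    have h2 := (hg _ (hmem u (Ioo_subset_Icc_self hu))).scomp (t' := C) u h1 hmem
    have h3 := h2.hasDerivAt (Icc_mem_nhds hu.1 hu.2)
    simpa [Function.comp_def, smul_eq_mul] using h3.hasDerivWithinAt
  · apply ContinuousOn.intervalIntegrable
    rw [uIcc_of_le zero_le_one]
    exact continuousOn_const.mul (((hf.mono hCU).continuousOn).comp hcont hmem)

end

section

open Complex Filter Topology Metric MeasureTheory Set ArithmeticFunction
open scoped LSeries.notation

theorem logPlus_nonneg (y : ℝ) : 0 ≤ logPlus y := le_max_left _ _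

theorem logPlus_abs_mono {x y : ℝ} (h : |x| ≤ |y|) : logPlus |x| ≤ logPlus |y| :=
  Real.monotoneOn_posLog (abs_nonneg x) (abs_nonneg y) h

theorem logPlus_of_one_le {y : ℝ} (h : 1 ≤ y) : logPlus y = Real.log y :=
  max_eq_right (Real.log_nonneg h)

theorem continuous_logPlus_abs_im : Continuous fun s : ℂ => logPlus |s.im| :=
  Real.continuous_posLog.comp (continuous_abs.comp continuous_im)

/-- The open region `{σ > 1 - c / (1 + log⁺ |τ|)}`. -/
def openRegion (c : ℝ) : Set ℂ := {s : ℂ | 1 - c / (1 + logPlus |s.im|) < s.re}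

theorem continuous_regionBound (c : ℝ) :
    Continuous fun s : ℂ => 1 - c / (1 + logPlus |s.im|) := by
  refine continuous_const.sub (continuous_const.div
    (continuous_const.add continuous_logPlus_abs_im) fun s => ?_)
  have := logPlus_nonneg |s.im|
  positivity

theorem isOpen_openRegion (c : ℝ) : IsOpen (openRegion c) :=
  isOpen_lt (continuous_regionBound c) continuous_re

theorem div_one_add_logPlus_le {c : ℝ} (hc : 0 ≤ c) (y : ℝ) : c / (1 + logPlus y) ≤ c :=
  div_le_self hc (by linarith [logPlus_nonneg y])

theorem mem_openRegion_of_one_lt {c : ℝ} (hc : 0 ≤ c) {s : ℂ} (hs : 1 < s.re) :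
    s ∈ openRegion c := by
  have := logPlus_nonneg |s.im|
  have : 0 ≤ c / (1 + logPlus |s.im|) := by positivity
  show 1 - c / (1 + logPlus |s.im|) < s.re
  linarith

theorem re_pos_of_mem_openRegion {c : ℝ} (hc : 0 ≤ c) (hc1 : c ≤ 1) {s : ℂ}
    (hs : s ∈ openRegion c) : 0 < s.re := by
  have h : 1 - c / (1 + logPlus |s.im|) < s.re := hs
  linarith [div_one_add_logPlus_le hc |s.im|]

theorem starConvex_openRegion {c : ℝ} (hc : 0 ≤ c) : StarConvex ℝ 2 (openRegion c) := by
  intro w hw a b ha hb hab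
  have hw' : 1 - c / (1 + logPlus |w.im|) < w.re := hw
  show 1 - c / (1 + logPlus |(a • (2 : ℂ) + b • w).im|) < (a • (2 : ℂ) + b • w).re
  have him : (a • (2 : ℂ) + b • w).im = b * w.im := by simp
  have hre : (a • (2 : ℂ) + b • w).re = a * 2 + b * w.re := by simp
  rw [him, hre]
  have h1 : logPlus |b * w.im| ≤ logPlus |w.im| := by
    apply logPlus_abs_mono
    rw [abs_mul, abs_of_nonneg hb]
    exact mul_le_of_le_one_left (abs_nonneg _) (by linarith)
  have h0 := logPlus_nonneg |b * w.im|
  have h2 : c / (1 + logPlus |w.im|) ≤ c / (1 + logPlus |b * w.im|) := by gcongr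
  have h3 : 0 ≤ c / (1 + logPlus |w.im|) := by
    have := logPlus_nonneg |w.im|
    positivity
  obtain ⟨B, hB⟩ : ∃ B, B = 1 - c / (1 + logPlus |w.im|) := ⟨_, rfl⟩
  have h4 : B < a * 2 + b * w.re := by
    have ha' : a = 1 - b := by linarith
    rw [← hB] at hw'
    subst ha'
    rcases hb.eq_or_lt with h | h
    · rw [← h]; linarith
    · nlinarith
  linarith

theorem xi_ne_zero_of_mem_openRegion {s : ℂ} (hs : s ∈ openRegion 0.1782) : xi s ≠ 0 := by
  intro h
  have h5 := five_lt_abs_im_of_xi_eq_zero h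
  have hz := zero_free h
  have hs' : 1 - 0.1782 / (1 + logPlus |s.im|) < s.re := hs
  rw [logPlus_of_one_le (by linarith)] at hs'
  have hl : 0 ≤ Real.log |s.im| := Real.log_nonneg (by linarith)
  have : 0.1782 / (1 + Real.log |s.im|) ≤ 1 - s.re := by
    rw [div_le_iff₀ (by linarith)]; exact hz
  linarith

theorem differentiableAt_digamma {s : ℂ} (hs : 0 < s.re) : DifferentiableAt ℂ digamma s := by
  have hopen : IsOpen {s : ℂ | 0 < s.re} := isOpen_lt continuous_const continuous_re
  have hne : ∀ s ∈ {s : ℂ | 0 < s.re}, ∀ m : ℕ, s ≠ -m := fun s hs m h => by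
    have := congrArg re h
    simp at this
    have hs' : 0 < s.re := hs
    linarith [(Nat.cast_nonneg m : (0 : ℝ) ≤ m)]
  have hG : DifferentiableOn ℂ Gamma {s : ℂ | 0 < s.re} := fun s hs =>
    (differentiableAt_Gamma s (hne s hs)).differentiableWithinAt
  have han := hG.analyticOnNhd hopen s hs
  rw [digamma_def]
  exact (han.deriv.differentiableAt).div han.differentiableAt (Gamma_ne_zero_of_re_pos hs)

theorem differentiableAt_logDeriv_xi {s : ℂ} (hs : xi s ≠ 0) :
    DifferentiableAt ℂ (logDeriv xi) s := by
  have han := differentiable_xi.analyticAt s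
  exact (han.deriv.differentiableAt).div han.differentiableAt hs

/-- The logarithmic derivative of `(s - 1) ζ(s)`. -/
def regularLogDeriv (s : ℂ) : ℂ :=
  logDeriv xi s - digamma (s / 2 + 1) / 2 + Real.log Real.pi / 2

theorem regularLogDeriv_eq (s : ℂ) :
    regularLogDeriv s = 1 / (s - 1) - (archTerm s - logDeriv xi s) := by
  rw [regularLogDeriv, archTerm]; ring

theorem differentiableOn_regularLogDeriv :
    DifferentiableOn ℂ regularLogDeriv (openRegion 0.1782) := by
  intro s hs
  have h1 := differentiableAt_logDeriv_xi (xi_ne_zero_of_mem_openRegion hs)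
  have h0 := re_pos_of_mem_openRegion (by norm_num) (by norm_num) hs
  have h2 : DifferentiableAt ℂ digamma (s / 2 + 1) := by
    apply differentiableAt_digamma
    simp; linarith
  have h3 : DifferentiableAt ℂ (fun s : ℂ => digamma (s / 2 + 1)) s :=
    DifferentiableAt.comp (g := digamma) s h2 (by fun_prop)
  exact ((h1.sub (h3.div_const 2)).add_const _).differentiableWithinAt

theorem logZeta_eq_LSeries (s : ℂ) :
    logZeta s = LSeries (fun n => (Λ n : ℂ) / (Real.log n : ℂ)) s := by
  unfold logZeta LSeries
  refine tsum_congr fun n => ?_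
  rcases eq_or_ne n 0 with rfl | hn
  · simp
  · rw [LSeries.term_of_ne_zero hn, div_div, mul_comm]

theorem norm_vonMangoldt_div_log_le (n : ℕ) : ‖(Λ n : ℂ) / (Real.log n : ℂ)‖ ≤ 1 := by
  rw [norm_div, Complex.norm_real, Complex.norm_real, Real.norm_of_nonneg vonMangoldt_nonneg,
    Real.norm_of_nonneg (Real.log_natCast_nonneg n)]
  exact div_le_one_of_le₀ vonMangoldt_le_log (Real.log_natCast_nonneg n)

theorem hasDerivAt_logZeta {s : ℂ} (hs : 1 < s.re) :
    HasDerivAt logZeta (-LSeries ↗Λ s) s := by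
  have habs : LSeries.abscissaOfAbsConv (fun n => (Λ n : ℂ) / (Real.log n : ℂ)) < s.re := by
    refine lt_of_le_of_lt (LSeries.abscissaOfAbsConv_le_of_forall_lt_LSeriesSummable' (x := 1)
      fun y hy => ?_) (by exact_mod_cast hs)
    exact LSeriesSummable_of_bounded_of_one_lt_re (m := 1)
      (fun n _ => norm_vonMangoldt_div_log_le n) (by simpa using mod_cast hy)
  have h := LSeries_hasDerivAt habs
  have he : LSeries (LSeries.logMul fun n => (Λ n : ℂ) / (Real.log n : ℂ)) s = LSeries ↗Λ s := by
    refine LSeries_congr (fun {n} hn => ?_) s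
    rw [LSeries.logMul]
    rcases eq_or_ne n 1 with rfl | h1
    · simp
    · have : Real.log n ≠ 0 :=
        Real.log_ne_zero_of_pos_of_ne_one (by positivity) (by exact_mod_cast h1)
      rw [← Complex.natCast_log, ← mul_div_assoc,
        mul_div_cancel_left₀ _ (Complex.ofReal_ne_zero.2 this)]
  rw [he] at h
  exact h.congr_of_eventuallyEq (Eventually.of_forall logZeta_eq_LSeries)

theorem norm_logZeta_le {s : ℂ} (hs : 1 < s.re) : ‖logZeta s‖ ≤ ‖logZeta (s.re : ℂ)‖ := by
  have hsum : ∀ w : ℂ, 1 < w.re → Summable (fun n : ℕ =>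
      ‖LSeries.term (fun n => (Λ n : ℂ) / (Real.log n : ℂ)) w n‖) := fun w hw =>
    (LSeriesSummable_of_bounded_of_one_lt_re (m := 1)
      (fun n _ => norm_vonMangoldt_div_log_le n) hw).norm
  have hterm : ∀ n : ℕ, LSeries.term (fun n => (Λ n : ℂ) / (Real.log n : ℂ)) (s.re : ℂ) n =
      ((‖LSeries.term (fun n => (Λ n : ℂ) / (Real.log n : ℂ)) s n‖ : ℝ) : ℂ) := by
    intro n
    rcases eq_or_ne n 0 with rfl | hn
    · simp
    · rw [LSeries.norm_term_eq, LSeries.term_of_ne_zero hn, if_neg hn, norm_div, Complex.norm_real,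
        Complex.norm_real, Real.norm_of_nonneg vonMangoldt_nonneg,
        Real.norm_of_nonneg (Real.log_natCast_nonneg n)]
      push_cast
      rw [Complex.ofReal_cpow (Nat.cast_nonneg n)]
      simp
  rw [logZeta_eq_LSeries, logZeta_eq_LSeries, LSeries, LSeries, tsum_congr hterm,
    ← Complex.ofReal_tsum, Complex.norm_real]
  exact (norm_tsum_le_tsum_norm (hsum s hs)).trans (le_abs_self _)

theorem norm_LSeries_vonMangoldt_le {s : ℂ} (hs : 1 < s.re) :
    ‖LSeries ↗Λ s‖ ≤ ‖LSeries ↗Λ (s.re : ℂ)‖ := by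
  have hterm : ∀ n : ℕ, LSeries.term ↗Λ (s.re : ℂ) n = ((‖LSeries.term ↗Λ s n‖ : ℝ) : ℂ) := by
    intro n
    rcases eq_or_ne n 0 with rfl | hn
    · simp
    · rw [LSeries.norm_term_eq, LSeries.term_of_ne_zero hn, if_neg hn, Complex.norm_real,
        Real.norm_of_nonneg vonMangoldt_nonneg]
      push_cast
      rw [Complex.ofReal_cpow (Nat.cast_nonneg n)]
      simp
  rw [LSeries, LSeries, tsum_congr hterm, ← Complex.ofReal_tsum, Complex.norm_real]
  exact (norm_tsum_le_tsum_norm (LSeriesSummable_vonMangoldt hs).norm).trans (le_abs_self _)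

/-- A branch of `log ((s - 1) ζ(s))` on the zero-free region. -/
theorem exists_regularLog : ∃ H : ℂ → ℂ,
    (∀ s ∈ openRegion 0.1782, HasDerivAt H (regularLogDeriv s) s) ∧
    ∀ s : ℂ, 1 < s.re → H s - Complex.log (s - 1) = logZeta s := by
  obtain ⟨H₀, hH₀⟩ := exists_primitive_of_starConvex (isOpen_openRegion 0.1782)
    (starConvex_openRegion (by norm_num)) differentiableOn_regularLogDeriv
  refine ⟨fun s => H₀ s + (logZeta 2 - (H₀ 2 - Complex.log (2 - 1))),
    fun s hs => (hH₀ s hs).add_const _, fun s hs => ?_⟩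
  have hopen : IsOpen {s : ℂ | 1 < s.re} := isOpen_lt continuous_const continuous_re
  have hconn : IsPreconnected {s : ℂ | 1 < s.re} :=
    (convex_halfSpace_re_gt 1).isPreconnected
  have hd : ∀ s ∈ {s : ℂ | 1 < s.re}, HasDerivAt
      (fun s => H₀ s + (logZeta 2 - (H₀ 2 - Complex.log (2 - 1))) - Complex.log (s - 1)) (-LSeries ↗Λ s) s := by
    intro s hs
    have hs' : 1 < s.re := hs
    have h1 := (hH₀ s (mem_openRegion_of_one_lt (by norm_num) hs)).add_const
      (logZeta 2 - (H₀ 2 - Complex.log (2 - 1)))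
    have h2 : HasDerivAt (fun s : ℂ => Complex.log (s - 1)) (1 / (s - 1)) s := by
      refine ((hasDerivAt_id s).sub_const 1).clog ?_
      left; simp; linarith
    refine (h1.sub h2).congr_deriv ?_
    rw [regularLogDeriv_eq, LSeries_vonMangoldt_eq_archTerm hs]; ring
  refine hopen.eqOn_of_deriv_eq hconn (x := 2)
    (fun s hs => (hd s hs).differentiableAt.differentiableWithinAt)
    (fun s hs => (hasDerivAt_logZeta hs).differentiableAt.differentiableWithinAt)
    (fun s hs => by rw [(hd s hs).deriv, (hasDerivAt_logZeta hs).deriv]) (by simp) ?_ hs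
  ring

theorem digamma_conj {s : ℂ} (hs : 0 < s.re) :
    digamma ((starRingEnd ℂ) s) = (starRingEnd ℂ) (digamma s) := by
  have h1 := tendsto_digamma (s := (starRingEnd ℂ) s) (by simpa using hs)
  have h2 := (continuous_conj.tendsto _).comp (tendsto_digamma hs)
  refine tendsto_nhds_unique h1 (h2.congr fun n => ?_)
  simp only [Function.comp_apply, map_sub, map_sum, conj_ofReal, map_div₀, map_one, map_add,
    map_natCast]

theorem norm_log_le_of_one_le {w : ℂ} (hw : 1 ≤ ‖w‖) : ‖log w‖ ≤ Real.log ‖w‖ + Real.pi := by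
  refine (Complex.norm_le_abs_re_add_abs_im _).trans ?_
  rw [log_re, log_im, abs_of_nonneg (Real.log_nonneg hw)]
  gcongr
  exact abs_arg_le_pi w

theorem norm_digamma_le {z : ℂ} (hz : 0 < z.re) (hy : 1 ≤ |z.im|) :
    ‖digamma z‖ ≤ Real.log ‖z‖ + 5 := by
  wlog h : 0 < z.im generalizing z
  · have hlt : z.im < 0 := by
      rcases lt_trichotomy z.im 0 with h1 | h1 | h1
      · exact h1
      · simp [h1] at hy; linarith
      · exact absurd h1 h
    have := this (z := (starRingEnd ℂ) z) (by simpa using hz) (by simpa using hy)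
      (by simpa using hlt)
    rwa [digamma_conj hz, Complex.norm_conj, Complex.norm_conj] at this
  have h1 : 1 ≤ z.im := by rwa [abs_of_pos h] at hy
  have hn : 1 ≤ ‖z‖ := hy.trans (abs_im_le_norm z)
  have hb := norm_digamma_sub_log_le hz h
  have h2 : (1 / 6 : ℝ) * (1 / z.im ^ 3 + 1 / z.im ^ 2) ≤ 1 / 3 := by
    have a1 : 1 / z.im ^ 3 ≤ 1 := div_le_one_of_le₀ (one_le_pow₀ h1) (by positivity)
    have a2 : 1 / z.im ^ 2 ≤ 1 := div_le_one_of_le₀ (one_le_pow₀ h1) (by positivity)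
    linarith
  have h3 : ‖1 / (2 * z)‖ ≤ 1 / 2 := by
    rw [norm_div, norm_mul, norm_one]
    simp only [Complex.norm_ofNat]
    apply div_le_div_of_nonneg_left <;> linarith
  have h4 := norm_log_le_of_one_le hn
  have h5 := Real.pi_lt_d2
  have : ‖digamma z‖ ≤ ‖digamma z - (log z - 1 / (2 * z))‖ + (‖log z‖ + ‖1 / (2 * z)‖) := by
    calc ‖digamma z‖ = ‖(digamma z - (log z - 1 / (2 * z))) + (log z - 1 / (2 * z))‖ := by
          congr 1; ring
      _ ≤ _ := (norm_add_le _ _).trans (by gcongr; exact norm_sub_le _ _)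
  linarith

theorem norm_archTerm_le {s : ℂ} (h0 : 0 < s.re) (h3 : s.re ≤ 3) (ht : 3 ≤ |s.im|) :
    ‖archTerm s‖ ≤ Real.log |s.im| + 5 := by
  have him : (s / 2 + 1).im = s.im / 2 := by simp
  have hre : (s / 2 + 1).re = s.re / 2 + 1 := by simp
  have h1 := norm_digamma_le (z := s / 2 + 1) (by rw [hre]; linarith)
    (by rw [him, abs_div, abs_two]; linarith)
  have h2 : ‖s / 2 + 1‖ ≤ |s.im| ^ 2 := by
    refine (Complex.norm_le_abs_re_add_abs_im _).trans ?_
    rw [hre, him, abs_div, abs_two, abs_of_pos (by linarith)]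
    nlinarith
  have h4 : Real.log ‖s / 2 + 1‖ ≤ 2 * Real.log |s.im| := by
    have hpow : Real.log (|s.im| ^ 2) = 2 * Real.log |s.im| := by
      rw [Real.log_pow, Nat.cast_two]
    rw [← hpow]
    refine Real.log_le_log ?_ h2
    refine norm_pos_iff.2 fun h => ?_
    rw [h] at hre
    simp at hre
    linarith
  have h5 : ‖1 / (s - 1)‖ ≤ 1 / 3 := by
    rw [norm_div, norm_one]
    apply div_le_div_of_nonneg_left zero_le_one (by norm_num)
    refine ht.trans ?_
    have := abs_im_le_norm (s - 1)
    simpa using this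
  have h6 : ‖(Real.log Real.pi / 2 : ℂ)‖ ≤ 1.5 := by
    rw [norm_div, Complex.norm_real, Complex.norm_ofNat,
      Real.norm_of_nonneg (Real.log_nonneg (by linarith [Real.pi_gt_three]))]
    have := Real.log_le_sub_one_of_pos Real.pi_pos
    linarith [Real.pi_lt_d2]
  have h7 : ‖digamma (s / 2 + 1) / 2‖ = ‖digamma (s / 2 + 1)‖ / 2 := by simp
  have : ‖archTerm s‖ ≤
      ‖1 / (s - 1)‖ + ‖digamma (s / 2 + 1) / 2‖ + ‖(Real.log Real.pi / 2 : ℂ)‖ := by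
    rw [archTerm]
    exact (norm_sub_le _ _).trans (by gcongr; exact norm_add_le _ _)
  linarith

theorem six_le_log {t : ℝ} (ht : 10000 ≤ t) : 6 ≤ Real.log t := by
  rw [Real.le_log_iff_exp_le (by linarith)]
  have h : Real.exp 6 = Real.exp 1 ^ 6 := by rw [← Real.exp_nat_mul]; norm_num
  rw [h]
  have := Real.exp_one_lt_d9
  calc Real.exp 1 ^ 6 ≤ 3 ^ 6 := by gcongr; linarith
    _ ≤ t := by linarith

/-- Points slightly inside the zero-free region keep a distance `≫ 1 / log t` from the zeros. -/
theorem norm_sub_zero_ge {s ρ : ℂ} (ht : 10000 ≤ |s.im|)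
    (hσ : 1 - 0.17804 / (1 + Real.log |s.im|) ≤ s.re) (hρ : xi ρ = 0) :
    0.0001 / Real.log |s.im| ≤ ‖s - ρ‖ := by
  have hL := six_le_log ht
  obtain ⟨t, htdef⟩ : ∃ t, t = |s.im| := ⟨_, rfl⟩
  rw [← htdef] at ht hσ hL ⊢
  obtain ⟨ℓ, hLdef⟩ : ∃ ℓ, ℓ = Real.log t := ⟨_, rfl⟩
  rw [← hLdef] at hσ hL ⊢
  rcases le_or_gt 1 |s.im - ρ.im| with h | h
  · have h1 := abs_im_le_norm (s - ρ)
    rw [sub_im] at h1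
    have : 0.0001 / ℓ ≤ 1 := by rw [div_le_one₀ (by linarith)]; linarith
    linarith
  · have hγ : |ρ.im| ≤ t + 1 := by
      have := abs_sub_abs_le_abs_sub ρ.im s.im
      rw [abs_sub_comm, ← htdef] at this
      linarith
    have h5 := five_lt_abs_im_of_xi_eq_zero hρ
    have hlog : Real.log |ρ.im| ≤ ℓ + 0.0001 := by
      have h1 : Real.log |ρ.im| ≤ Real.log (t * (1 + 1 / t)) := by
        apply Real.log_le_log (by linarith)
        have : t * (1 + 1 / t) = t + 1 := by field_simp
        rw [this]; exact hγ
      rw [Real.log_mul (by positivity) (by positivity), ← hLdef] at h1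
      have h2 := Real.log_le_sub_one_of_pos (x := 1 + 1 / t) (by positivity)
      have h3 : 1 / t ≤ 0.0001 := by
        rw [div_le_iff₀ (by linarith)]; linarith
      linarith
    have hl0 : 0 < Real.log |ρ.im| := Real.log_pos (by linarith)
    have hz := zero_free hρ
    have hz' : 0.1782 / (1 + (ℓ + 0.0001)) ≤ 1 - ρ.re := by
      rw [div_le_iff₀ (by linarith)]
      have hb := (re_mem_of_xi_eq_zero hρ).2
      refine hz.trans (mul_le_mul_of_nonneg_left ?_ (by linarith))
      linarith
    have h6 : 0.0001 / ℓ ≤ 0.1782 / (1 + (ℓ + 0.0001)) - 0.17804 / (1 + ℓ) := by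
      rw [div_sub_div _ _ (by linarith) (by linarith), div_le_div_iff₀ (by linarith) (by positivity)]
      nlinarith [mul_self_nonneg (ℓ - 6)]
    have h7 := (le_abs_self _).trans (abs_re_le_norm (s - ρ))
    rw [sub_re] at h7
    linarith

theorem exists_norm_logDeriv_le : ∃ K : ℝ, 0 < K ∧ ∀ s : ℂ, 10000 ≤ |s.im| →
    1 - 0.17804 / (1 + Real.log |s.im|) ≤ s.re → s.re ≤ 1 + 1 / Real.log |s.im| →
    ‖archTerm s - logDeriv xi s‖ ≤ K * Real.log |s.im| := by
  have hcomp : IsCompact ((fun x : ℝ => (x : ℂ)) '' Icc 1 2) :=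
    isCompact_Icc.image continuous_ofReal
  have hsub : (fun x : ℝ => (x : ℂ)) '' Icc 1 2 ⊆ openRegion 0.1782 := by
    rintro _ ⟨x, hx, rfl⟩
    show 1 - 0.1782 / (1 + logPlus |(x : ℂ).im|) < (x : ℂ).re
    rw [ofReal_im, ofReal_re, logPlus, abs_zero, Real.log_zero, max_self]
    linarith [hx.1]
  obtain ⟨B, hB⟩ := hcomp.exists_bound_of_continuousOn
    (differentiableOn_regularLogDeriv.continuousOn.mono hsub)
  have hB0 : 0 ≤ B := (norm_nonneg _).trans (hB 1 ⟨1, by norm_num, by simp⟩)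
  refine ⟨30001 * (B + 7) + 6, by positivity, fun s ht h1 h2 => ?_⟩
  have hL := six_le_log ht
  obtain ⟨ℓ, hLdef⟩ : ∃ ℓ, ℓ = Real.log |s.im| := ⟨_, rfl⟩
  have hdist := fun ρ (hρ : xi ρ = 0) => norm_sub_zero_ge ht h1 hρ
  have harch := norm_archTerm_le (s := s)
  rw [← hLdef] at h1 h2 hL hdist harch ⊢
  have hinv : 1 / ℓ ≤ 1 / 6 := by gcongr
  have hinv0 : 0 < 1 / ℓ := by positivity
  have hc1 : 0.17804 / (1 + ℓ) ≤ 0.2 * (1 / ℓ) := by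
    rw [mul_one_div, div_le_div_iff₀ (by linarith) (by linarith)]
    nlinarith
  have harch := harch (by linarith) (by linarith) (by linarith)
  obtain ⟨σ, hσ⟩ : ∃ σ : ℝ, σ = 1 + 1 / ℓ := ⟨_, rfl⟩
  obtain ⟨w, hw⟩ : ∃ w : ℂ, w = ⟨σ, s.im⟩ := ⟨_, rfl⟩
  have hwre : w.re = σ := by rw [hw]
  have hwim : w.im = s.im := by rw [hw]
  have hw1 : 1 < w.re := by rw [hwre]; linarith
  have hxis : xi s ≠ 0 := fun h => by
    have := hdist s h
    rw [sub_self, norm_zero] at this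
    have : 0 < 0.0001 / ℓ := by positivity
    linarith
  have hxiw : xi w ≠ 0 := xi_ne_zero_of_one_le_re hw1.le
  have hsw : ‖s - w‖ ≤ 1.2 * (1 / ℓ) := by
    have : s - w = ((s.re - σ : ℝ) : ℂ) := by
      apply Complex.ext <;> simp [hwre, hwim]
    rw [this, Complex.norm_real, Real.norm_eq_abs, abs_le]
    constructor <;> linarith
  have hK : ∀ ρ, xi ρ = 0 → ‖1 / (s - ρ) - 1 / (w - ρ)‖ ≤ 30000 * (pairKernel w ρ / 2) := by
    intro ρ hρ
    have hd := hdist ρ hρ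
    have hβ := re_mem_of_xi_eq_zero hρ
    have hsρ : s - ρ ≠ 0 := sub_ne_zero.2 fun h => hxis (h ▸ hρ)
    have hwρ : w - ρ ≠ 0 := sub_ne_zero.2 fun h => hxiw (h ▸ hρ)
    have ha : 0 < ‖s - ρ‖ := norm_pos_iff.2 hsρ
    have hb : 0 < ‖w - ρ‖ := norm_pos_iff.2 hwρ
    have hle : ‖w - ρ‖ ≤ 12001 * ‖s - ρ‖ := by
      have : ‖w - ρ‖ ≤ ‖s - w‖ + ‖s - ρ‖ := by
        rw [norm_sub_rev s w]
        exact norm_sub_le_norm_sub_add_norm_sub w s ρ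
      have h0 : 0.0001 / ℓ = 0.0001 * (1 / ℓ) := by ring
      rw [h0] at hd
      linarith
    have hker1 : (1 / ℓ) / ‖w - ρ‖ ^ 2 ≤ pairKernel w ρ := by
      rw [pairKernel_eq_hker]
      have hn : 0 ≤ hker (w.re - 1 + ρ.re) (w.im - ρ.im) := hker_nonneg (by linarith [hβ.1]) _
      have he : hker (w.re - ρ.re) (w.im - ρ.im) = (w.re - ρ.re) / ‖w - ρ‖ ^ 2 := by
        rw [hker, Complex.sq_norm, Complex.normSq_apply, sub_re, sub_im, sq, sq]
      have hf : (1 / ℓ) / ‖w - ρ‖ ^ 2 ≤ (w.re - ρ.re) / ‖w - ρ‖ ^ 2 := by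
        gcongr
        linarith [hβ.2]
      linarith
    have hdiff : 1 / (s - ρ) - 1 / (w - ρ) = (w - s) / ((s - ρ) * (w - ρ)) := by
      field_simp; ring
    rw [hdiff, norm_div, norm_mul, norm_sub_rev w s]
    calc ‖s - w‖ / (‖s - ρ‖ * ‖w - ρ‖) ≤ 1.2 * (1 / ℓ) / (‖w - ρ‖ / 12001 * ‖w - ρ‖) := by
          gcongr
          rw [div_le_iff₀ (by norm_num)]; linarith
      _ = 14401.2 * ((1 / ℓ) / ‖w - ρ‖ ^ 2) := by field_simp; norm_num
      _ ≤ 15000 * ((1 / ℓ) / ‖w - ρ‖ ^ 2) := by gcongr; norm_num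
      _ ≤ 15000 * pairKernel w ρ := by gcongr
      _ = _ := by ring
  have hmain := norm_logDeriv_xi_sub_le hxis hxiw hK
  have hLw : ‖LSeries ↗Λ w‖ ≤ ℓ + B := by
    refine (norm_LSeries_vonMangoldt_le hw1).trans ?_
    rw [hwre] at hw1 ⊢
    rw [LSeries_vonMangoldt_eq_archTerm (by simpa using hw1)]
    have : archTerm σ - logDeriv xi σ = ((ℓ : ℝ) : ℂ) - regularLogDeriv σ := by
      rw [regularLogDeriv_eq]
      have : (1 : ℂ) / (σ - 1) = ℓ := by
        rw [hσ]
        have : (ℓ : ℂ) ≠ 0 := ofReal_ne_zero.2 (by linarith)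
        push_cast
        rw [add_sub_cancel_left, one_div_one_div]
      rw [this]; ring
    rw [this]
    refine (norm_sub_le _ _).trans ?_
    rw [Complex.norm_real, Real.norm_of_nonneg (by linarith)]
    gcongr
    exact hB _ ⟨σ, ⟨hw1.le, by linarith⟩, rfl⟩
  have harchw : ‖archTerm w‖ ≤ ℓ + 5 := by
    have := norm_archTerm_le (s := w) (by linarith) (by linarith) (by rw [hwim]; linarith)
    rwa [hwim, ← hLdef] at this
  have hdw : ‖logDeriv xi w‖ ≤ 2 * ℓ + 5 + B := by
    have : logDeriv xi w = archTerm w - LSeries ↗Λ w := by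
      rw [LSeries_vonMangoldt_eq_archTerm hw1]; ring
    rw [this]
    exact (norm_sub_le _ _).trans (by linarith)
  have hre := (re_le_norm (logDeriv xi w)).trans hdw
  have hds : ‖logDeriv xi s‖ ≤ 30001 * (2 * ℓ + 5 + B) := by
    have : ‖logDeriv xi s‖ ≤ ‖logDeriv xi s - logDeriv xi w‖ + ‖logDeriv xi w‖ := by
      simpa using norm_add_le (logDeriv xi s - logDeriv xi w) (logDeriv xi w)
    linarith
  refine (norm_sub_le _ _).trans ?_
  nlinarith

end

section

open Complex Filter Topology Metric MeasureTheory Set ArithmeticFunction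

theorem mem_openRegion_of_le {c c' : ℝ} (hc : c < c') {s : ℂ}
    (hs : 1 - c / (1 + logPlus |s.im|) ≤ s.re) : s ∈ openRegion c' := by
  refine lt_of_lt_of_le ?_ hs
  have := logPlus_nonneg |s.im|
  gcongr

theorem isCompact_truncatedRegion {c : ℝ} (hc : 0 ≤ c) (hc1 : c ≤ 1) (T : ℝ) :
    IsCompact {s : ℂ | 1 - c / (1 + logPlus |s.im|) ≤ s.re ∧ s.re ≤ 2 ∧ |s.im| ≤ T} := by
  refine ((isCompact_Icc (a := (0 : ℝ)) (b := 2)).reProdIm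
    (isCompact_Icc (a := -T) (b := T))).of_isClosed_subset ?_ ?_
  · exact (isClosed_le (continuous_regionBound c) continuous_re).inter
      ((isClosed_le continuous_re continuous_const).inter
        (isClosed_le (continuous_abs.comp continuous_im) continuous_const))
  · rintro s ⟨h1, h2, h3⟩
    rw [mem_reProdIm]
    exact ⟨⟨by linarith [div_one_add_logPlus_le hc |s.im|], h2⟩, abs_le.1 h3⟩

theorem hasDerivAt_sub_log {H : ℂ → ℂ} {s : ℂ} (hH : HasDerivAt H (regularLogDeriv s) s)
    (hs : s.im ≠ 0) :
    HasDerivAt (fun s => H s - Complex.log (s - 1)) (-(archTerm s - logDeriv xi s)) s := by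
  have h2 : HasDerivAt (fun s : ℂ => Complex.log (s - 1)) (1 / (s - 1)) s := by
    refine ((hasDerivAt_id s).sub_const 1).clog ?_
    right; simpa using hs
  refine (hH.sub h2).congr_deriv ?_
  rw [regularLogDeriv_eq]; ring

/-- A branch of `log ((s - 1) ζ(s))` on the zero-free region, with bounds. -/
theorem exists_regularLog_bound : ∃ (H : ℂ → ℂ) (C : ℝ), 0 ≤ C ∧
    (∀ s ∈ openRegion 0.1782, HasDerivAt H (regularLogDeriv s) s) ∧
    (∀ s : ℂ, 1 < s.re → H s - Complex.log (s - 1) = logZeta s) ∧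
    ∀ s : ℂ, 1 - 0.17804 / (1 + logPlus |s.im|) ≤ s.re → s.re ≤ 2 →
      (|s.im| ≤ 3 → ‖H s‖ ≤ C) ∧
      (3 ≤ |s.im| → ‖H s - Complex.log (s - 1)‖ ≤ Real.log (Real.log |s.im|) + C) := by
  obtain ⟨H, hH, hW⟩ := exists_regularLog
  obtain ⟨K, hK0, hK⟩ := exists_norm_logDeriv_le
  obtain ⟨B, hB⟩ := (isCompact_truncatedRegion (c := 0.17804) (by norm_num) (by norm_num)
    10000).exists_bound_of_continuousOn (f := H) fun s hs =>
      (hH s (mem_openRegion_of_le (by norm_num) hs.1)).continuousAt.continuousWithinAt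
  have hB0 : 0 ≤ B := by
    refine (norm_nonneg _).trans (hB 2 ⟨?_, by simp, by simp⟩)
    have := mem_openRegion_of_one_lt (c := 0.17804) (by norm_num) (s := 2) (by simp)
    exact le_of_lt this
  refine ⟨H, B + 10010 + 1.2 * K, by positivity, hH, hW, fun s hs hs2 => ⟨fun h3 => ?_, fun h3 => ?_⟩⟩
  · linarith [hB s ⟨hs, hs2, by linarith⟩]
  have hright : ∀ s : ℂ, 10000 ≤ |s.im| → 1 + 1 / Real.log |s.im| ≤ s.re → s.re ≤ 2 →
      ‖H s - Complex.log (s - 1)‖ ≤ Real.log (Real.log |s.im|) + B := by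
    intro s ht h1 h2
    have hℓ := six_le_log ht
    have hinv : 0 < 1 / Real.log |s.im| := by positivity
    have hs1 : 1 < s.re := by linarith
    rw [hW s hs1]
    refine (norm_logZeta_le hs1).trans ?_
    rw [← hW s.re (by simpa using hs1)]
    have hHb : ‖H s.re‖ ≤ B := by
      refine hB _ ⟨?_, by simpa using h2, by simp⟩
      exact le_of_lt (mem_openRegion_of_one_lt (c := 0.17804) (by norm_num) (s := s.re)
        (by simpa using hs1))
    have hlog : ‖Complex.log ((s.re : ℂ) - 1)‖ ≤ Real.log (Real.log |s.im|) := by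
      have he : (s.re : ℂ) - 1 = ((s.re - 1 : ℝ) : ℂ) := by push_cast; rfl
      rw [he, ← Complex.ofReal_log (by linarith), Complex.norm_real, Real.norm_eq_abs,
        abs_of_nonpos (Real.log_nonpos (by linarith) (by linarith)), ← Real.log_inv]
      apply Real.log_le_log (inv_pos.2 (by linarith))
      rw [inv_le_comm₀ (by linarith) (by linarith), ← one_div]
      linarith
    exact (norm_sub_le _ _).trans (by linarith)
  have hloglog : 0 ≤ Real.log (Real.log |s.im|) := by
    apply Real.log_nonneg
    rw [Real.le_log_iff_exp_le (by linarith)]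
    linarith [Real.exp_one_lt_d9]
  rcases le_or_gt |s.im| 10000 with ht | ht
  · have h1 := hB s ⟨hs, hs2, ht⟩
    have hre : 0 < s.re :=
      re_pos_of_mem_openRegion (by norm_num) (by norm_num)
        (mem_openRegion_of_le (c' := 0.1782) (by norm_num) hs)
    have h4 : 3 ≤ ‖s - 1‖ := by
      have := abs_im_le_norm (s - 1)
      rw [sub_im, one_im, sub_zero] at this
      linarith
    have h5 : ‖s - 1‖ ≤ 10001 := by
      refine (Complex.norm_le_abs_re_add_abs_im _).trans ?_
      rw [sub_im, one_im, sub_zero, sub_re, one_re]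
      have : |s.re - 1| ≤ 1 := abs_le.2 ⟨by linarith, by linarith⟩
      linarith
    have h6 := norm_log_le_of_one_le (w := s - 1) (by linarith)
    have h7 := Real.log_le_sub_one_of_pos (x := ‖s - 1‖) (by linarith)
    have h8 := Real.pi_lt_d2
    refine (norm_sub_le _ _).trans ?_
    linarith
  rcases le_or_gt (1 + 1 / Real.log |s.im|) s.re with hσ | hσ
  · linarith [hright s ht.le hσ hs2]
  have hℓ := six_le_log ht.le
  rw [logPlus_of_one_le (by linarith)] at hs
  obtain ⟨w, hw⟩ : ∃ w : ℂ, w = ⟨1 + 1 / Real.log |s.im|, s.im⟩ := ⟨_, rfl⟩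
  have hwim : w.im = s.im := by rw [hw]
  have hwre : w.re = 1 + 1 / Real.log |s.im| := by rw [hw]
  have hinv : 1 / Real.log |s.im| ≤ 1 / 6 := by gcongr
  have hWw := hright w (by rw [hwim]; exact ht.le) (by rw [hwim, hwre]) (by rw [hwre]; linarith)
  rw [hwim] at hWw
  have hseg : ∀ x ∈ segment ℝ w s, x.im = s.im ∧ s.re ≤ x.re ∧ x.re ≤ w.re := by
    rintro x ⟨a, b, ha, hb, hab, rfl⟩
    have e1 : (a • w + b • s).im = a * w.im + b * s.im := by simp
    have e2 : (a • w + b • s).re = a * w.re + b * s.re := by simp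
    have hb' : b = 1 - a := by linarith
    rw [e1, e2, hwim, hb']
    refine ⟨by ring, ?_, ?_⟩ <;> nlinarith
  have hmv := Convex.norm_image_sub_le_of_norm_hasDerivWithin_le
    (f := fun s => H s - Complex.log (s - 1)) (f' := fun s => -(archTerm s - logDeriv xi s))
    (C := K * Real.log |s.im|) (s := segment ℝ w s) (x := w) (y := s)
    (fun x hx => ?_) (fun x hx => ?_) (convex_segment _ _) (left_mem_segment ℝ _ _)
    (right_mem_segment ℝ _ _)
  · have hsw : ‖s - w‖ ≤ 1.2 * (1 / Real.log |s.im|) := by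
      have : s - w = ((s.re - w.re : ℝ) : ℂ) := by
        apply Complex.ext <;> simp [hwim]
      have hc1 : 0.17804 / (1 + Real.log |s.im|) ≤ 0.2 * (1 / Real.log |s.im|) := by
        rw [mul_one_div, div_le_div_iff₀ (by linarith) (by linarith)]
        nlinarith
      rw [this, Complex.norm_real, Real.norm_eq_abs, abs_le, hwre]
      constructor <;> linarith
    have h1 : K * Real.log |s.im| * ‖s - w‖ ≤ 1.2 * K := by
      calc K * Real.log |s.im| * ‖s - w‖
          ≤ K * Real.log |s.im| * (1.2 * (1 / Real.log |s.im|)) := by gcongr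
        _ = 1.2 * K := by field_simp
    have h2 := norm_sub_norm_le (H s - Complex.log (s - 1)) (H w - Complex.log (w - 1))
    have h3 := h2.trans (hmv.trans h1)
    linarith
  · obtain ⟨h1, h2, h3⟩ := hseg x hx
    refine (hasDerivAt_sub_log (hH x (mem_openRegion_of_le (c := 0.17804) (by norm_num) ?_))
      ?_).hasDerivWithinAt
    · rw [h1, logPlus_of_one_le (by linarith)]; linarith
    · rw [h1]; intro h
      rw [h, abs_zero] at ht
      linarith
  · obtain ⟨h1, h2, h3⟩ := hseg x hx
    rw [norm_neg, ← h1]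
    apply hK x <;> rw [h1] <;> linarith

theorem log_rpow_le {A δ t : ℝ} (hA : 1 ≤ A) (hδ : 0 < δ) (ht : 1 ≤ t) :
    Real.log t ^ A ≤ (2 * A) ^ A * δ ^ (-A) * (1 + t) ^ (δ / 2) := by
  have hε : 0 < δ / (2 * A) := by positivity
  have h1 : Real.log t ≤ (1 + t) ^ (δ / (2 * A)) / (δ / (2 * A)) :=
    (Real.log_le_log (by linarith) (by linarith)).trans
      (Real.log_le_rpow_div (by linarith) hε)
  calc Real.log t ^ A ≤ ((1 + t) ^ (δ / (2 * A)) / (δ / (2 * A))) ^ A :=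
        Real.rpow_le_rpow (Real.log_nonneg ht) h1 (by linarith)
    _ = ((1 + t) ^ (δ / (2 * A)) * (2 * A * δ⁻¹)) ^ A := by congr 1; field_simp
    _ = (2 * A) ^ A * δ ^ (-A) * (1 + t) ^ (δ / 2) := by
      rw [Real.mul_rpow (by positivity) (by positivity), ← Real.rpow_mul (by linarith),
        Real.mul_rpow (by positivity) (by positivity), Real.inv_rpow hδ.le, Real.rpow_neg hδ.le]
      have : δ / (2 * A) * A = δ / 2 := by field_simp
      rw [this]; ring

theorem norm_log_le_of_norm_le_four {w : ℂ} (h0 : w ≠ 0) (h4 : ‖w‖ ≤ 4) :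
    ‖Complex.log w‖ ≤ -Real.log ‖w‖ + 10 := by
  have hr : 0 < ‖w‖ := norm_pos_iff.2 h0
  have h1 : Real.log ‖w‖ ≤ 3 := by
    have := Real.log_le_sub_one_of_pos hr
    linarith
  have h2 : |Real.log ‖w‖| ≤ -Real.log ‖w‖ + 6 := abs_le.2 ⟨by linarith, by linarith⟩
  have h3 := abs_arg_le_pi w
  have h5 := Real.pi_lt_d2
  have h6 := Complex.norm_le_abs_re_add_abs_im (Complex.log w)
  rw [log_re, log_im] at h6
  linarith

theorem norm_exp_mul_le {A : ℝ} {z w : ℂ} (hz : ‖z‖ ≤ A) {b : ℝ} (hw : ‖w‖ ≤ b) :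
    ‖Complex.exp (z * w)‖ ≤ Real.exp (A * b) := by
  refine (Complex.norm_exp_le_exp_norm _).trans (Real.exp_le_exp.2 ?_)
  rw [norm_mul]
  exact mul_le_mul hz hw (norm_nonneg _) ((norm_nonneg _).trans hz)

theorem stmt17 (A : ℝ) (hA : 1 ≤ A) : ∃ CA : ℝ, 0 < CA ∧
    ∀ (z : ℂ) (c₀ δ M : ℝ) (a : ℕ → ℂ),
      ‖z‖ ≤ A → 0 < c₀ → c₀ ≤ 2 / 11 → 0 < δ → δ ≤ 1 → 0 < M →
      HasPropertyP a z c₀ δ M →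
      ∃ F : ℂ → ℂ, AnalyticOnNhd ℂ F (sdOmega (47 / 48 * c₀)) ∧
        (∀ s : ℂ, 1 < s.re → F s = DSeries a s) ∧
        ∀ s ∈ sdOmega (47 / 48 * c₀), s.re ≤ 2 →
          (3 ≤ |s.im| → ‖F s‖ ≤ CA * δ ^ (-A) * M * (1 + |s.im|) ^ (1 - δ / 2)) ∧
          (|s.im| ≤ 3 → ‖F s‖ ≤ CA * M * ‖s - 1‖ ^ (-A)) := by
  obtain ⟨H, C, hC, hH, hW, hbound⟩ := exists_regularLog_bound
  refine ⟨Real.exp (A * (C + 10)) * (4 + (2 * A) ^ A), by positivity, ?_⟩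
  intro z c₀ δ M a hz hc₀ hc₀' hδ hδ1 hM hP
  obtain ⟨-, G, U, hU, hsub, hG, hGeq, hGb⟩ := hP
  have hregion : ∀ s ∈ sdOmega (47 / 48 * c₀),
      1 - 0.17804 / (1 + logPlus |s.im|) ≤ s.re ∧ s ∈ sdRegion c₀ ∧ s - 1 ∈ slitPlane := by
    rintro s ⟨h1, h2⟩
    have h1' : 1 - 47 / 48 * c₀ / (1 + logPlus |s.im|) < s.re := h1
    have hl := logPlus_nonneg |s.im|
    refine ⟨?_, ?_, ?_⟩
    · have : 47 / 48 * c₀ / (1 + logPlus |s.im|) ≤ 0.17804 / (1 + logPlus |s.im|) := by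
        gcongr
        linarith
      linarith
    · have : 47 / 48 * c₀ / (1 + logPlus |s.im|) ≤ c₀ / (1 + logPlus |s.im|) := by
        gcongr
        linarith
      show 1 - c₀ / (1 + logPlus |s.im|) ≤ s.re
      linarith
    · rw [mem_slitPlane_iff, sub_re, one_re, sub_im, one_im, sub_zero]
      by_contra! h
      exact h2 ⟨h.2, by linarith [h.1]⟩
  have hHan : AnalyticOnNhd ℂ H (openRegion 0.1782) :=
    DifferentiableOn.analyticOnNhd
      (fun s hs => (hH s hs).differentiableAt.differentiableWithinAt) (isOpen_openRegion _)
  refine ⟨fun s => G s * Complex.exp (z * (H s - Complex.log (s - 1))), ?_, ?_, ?_⟩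
  · intro s hs
    obtain ⟨h1, h2, h3⟩ := hregion s hs
    have hlog : AnalyticAt ℂ (fun s : ℂ => Complex.log (s - 1)) s :=
      (analyticAt_id.sub analyticAt_const).clog h3
    have hHs := hHan s (mem_openRegion_of_le (by norm_num) h1)
    exact (hG s (hsub h2)).mul (analyticAt_const.mul (hHs.sub hlog)).cexp
  · intro s hs
    show G s * Complex.exp (z * (H s - Complex.log (s - 1))) = DSeries a s
    rw [hW s hs, hGeq s hs, mul_assoc, ← Complex.exp_add]
    simp
  · intro s hs hs2
    obtain ⟨h1, h2, h3⟩ := hregion s hs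
    have hGs := hGb s h2
    obtain ⟨hb1, hb2⟩ := hbound s h1 hs2
    have hA0 : 0 ≤ A := by linarith
    have hE0 : 0 < (2 * A) ^ A := by positivity
    refine ⟨fun ht => ?_, fun ht => ?_⟩
    · have hlogt : 0 < Real.log |s.im| := Real.log_pos (by linarith)
      rw [norm_mul]
      have hexp : ‖Complex.exp (z * (H s - Complex.log (s - 1)))‖ ≤
          Real.exp (A * (C + 10)) * Real.log |s.im| ^ A := by
        refine (norm_exp_mul_le hz (hb2 ht)).trans ?_
        rw [Real.rpow_def_of_pos hlogt, ← Real.exp_add]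
        apply Real.exp_le_exp.2
        nlinarith
      have hlp := log_rpow_le hA hδ (t := |s.im|) (by linarith)
      have hpow : (1 + |s.im|) ^ (1 - δ) * (1 + |s.im|) ^ (δ / 2) = (1 + |s.im|) ^ (1 - δ / 2) := by
        rw [← Real.rpow_add (by positivity)]; congr 1; ring
      calc ‖G s‖ * ‖Complex.exp (z * (H s - Complex.log (s - 1)))‖
          ≤ (M * (1 + |s.im|) ^ (1 - δ)) * (Real.exp (A * (C + 10)) *
            ((2 * A) ^ A * δ ^ (-A) * (1 + |s.im|) ^ (δ / 2))) := by
              refine mul_le_mul hGs (hexp.trans ?_) (norm_nonneg _) (by positivity)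
              gcongr
        _ = Real.exp (A * (C + 10)) * (2 * A) ^ A * δ ^ (-A) * M * (1 + |s.im|) ^ (1 - δ / 2) := by
              rw [← hpow]; ring
        _ ≤ _ := by gcongr; linarith
    · have h10 : s - 1 ≠ 0 := slitPlane_ne_zero h3
      have hr : 0 < ‖s - 1‖ := norm_pos_iff.2 h10
      have hre : 0 < s.re :=
        re_pos_of_mem_openRegion (by norm_num) (by norm_num)
          (mem_openRegion_of_le (c' := 0.1782) (by norm_num) h1)
      have hr4 : ‖s - 1‖ ≤ 4 := by
        refine (Complex.norm_le_abs_re_add_abs_im _).trans ?_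
        rw [sub_im, one_im, sub_zero, sub_re, one_re]
        have : |s.re - 1| ≤ 1 := abs_le.2 ⟨by linarith, by linarith⟩
        linarith
      have hlog := norm_log_le_of_norm_le_four h10 hr4
      have hexp : ‖Complex.exp (z * (H s - Complex.log (s - 1)))‖ ≤
          Real.exp (A * (C + 10)) * ‖s - 1‖ ^ (-A) := by
        refine (norm_exp_mul_le (b := C + (-Real.log ‖s - 1‖ + 10)) hz
          ((norm_sub_le _ _).trans (add_le_add (hb1 ht) hlog))).trans (le_of_eq ?_)
        rw [Real.rpow_def_of_pos hr, ← Real.exp_add]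
        congr 1; ring
      have hpow : (1 + |s.im|) ^ (1 - δ) ≤ 4 := by
        calc (1 + |s.im|) ^ (1 - δ) ≤ (1 + |s.im|) ^ (1 : ℝ) :=
              Real.rpow_le_rpow_of_exponent_le (by linarith [abs_nonneg s.im]) (by linarith)
          _ ≤ 4 := by rw [Real.rpow_one]; linarith
      rw [norm_mul]
      calc ‖G s‖ * ‖Complex.exp (z * (H s - Complex.log (s - 1)))‖
          ≤ (M * 4) * (Real.exp (A * (C + 10)) * ‖s - 1‖ ^ (-A)) := by
              refine mul_le_mul (hGs.trans ?_) hexp (norm_nonneg _) (by positivity)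
              gcongr
        _ = Real.exp (A * (C + 10)) * 4 * M * ‖s - 1‖ ^ (-A) := by ring
        _ ≤ _ := by gcongr; linarith

end
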